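/- arXiv:1508.00778 — 3 statements merged into one kernel-verified Lean document; each statement's English description precedes it below -/
import Mathlib

section
/- Let S be a nonempty compact subset of a Busemann surface (𝒮,d), let δ > 0, and let u,v ∈ S be a diametral pair of S, i.e., d(u,v) = diam(S). Then B_{2δ}(v) ∩ S can be covered by 19 closed balls of radius δ, i.e., ρ_δ(B_{2δ}(v) ∩ S) ≤ 19. -/
open Metric Set

section Defs

variable {X : Type*} [MetricSpace X]

/-- `γ` is a geodesic parametrized by arclength on the interval `[0, l]`. -/
def IsGeodesicMap (γ : ℝ → X) (l : ℝ) : Prop :=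
  ∀ s ∈ Set.Icc (0 : ℝ) l, ∀ t ∈ Set.Icc (0 : ℝ) l, dist (γ s) (γ t) = |s - t|

/-- A geodesic metric space: every pair of points is joined by a geodesic. -/
def IsGeodesicSpace (X : Type*) [MetricSpace X] : Prop :=
  ∀ x y : X, ∃ γ : ℝ → X, IsGeodesicMap γ (dist x y) ∧ γ 0 = x ∧ γ (dist x y) = y

/-- A Busemann space: a geodesic metric space in which the distance between
any two (affinely reparametrized) geodesics is convex. -/
def IsBusemannSpace (X : Type*) [MetricSpace X] : Prop :=
  IsGeodesicSpace X ∧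
    ∀ (γ γ' : ℝ → X) (l l' : ℝ), 0 ≤ l → 0 ≤ l' →
      IsGeodesicMap γ l → IsGeodesicMap γ' l' →
        ∀ t ∈ Set.Icc (0 : ℝ) 1,
          dist (γ (t * l)) (γ' (t * l')) ≤
            (1 - t) * dist (γ 0) (γ' 0) + t * dist (γ l) (γ' l')

/-- A Busemann surface: a Busemann space homeomorphic to the Euclidean plane. -/
def IsBusemannSurface (X : Type*) [MetricSpace X] : Prop :=
  IsBusemannSpace X ∧ Nonempty (X ≃ₜ EuclideanSpace ℝ (Fin 2))

/-- The covering number `ρ_δ(S)`: the least number of closed balls of radius `δ`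
(centered at arbitrary points of `X`) needed to cover `S`. -/
noncomputable def covNum (δ : ℝ) (S : Set X) : ℕ∞ :=
  sInf {n : ℕ∞ | ∃ T : Set X, T.encard = n ∧ S ⊆ ⋃ x ∈ T, Metric.closedBall x δ}

/-- The packing number `ν_δ(S)`: the largest cardinality of a subset `P ⊆ S`
whose points are pairwise at distance `> 2δ`. -/
noncomputable def packNum (δ : ℝ) (S : Set X) : ℕ∞ :=
  sSup {n : ℕ∞ | ∃ P : Set X, P ⊆ S ∧ P.encard = n ∧
    P.Pairwise fun p q => 2 * δ < dist p q}

/-- The geodesic segment `[x,y]` in a (uniquely geodesic) metric space. -/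
def seg (x y : X) : Set X := {z | dist x z + dist z y = dist x y}

/-- A set is (geodesically) convex if it contains the segment between any two of its points. -/
def GConvex (C : Set X) : Prop := ∀ x ∈ C, ∀ y ∈ C, seg x y ⊆ C

/-- The (geodesic) convex hull of a set. -/
def gHull (Q : Set X) : Set X := ⋂₀ {C : Set X | GConvex C ∧ Q ⊆ C}

/-- The triangle `Δ(x,y,z)`: the convex hull of `{x,y,z}`. -/
def triangleG (x y z : X) : Set X := gHull {x, y, z}

/-- The perimeter `π(a,b,c)` of a triangle. -/
def perim (a b c : X) : ℝ := dist a b + dist b c + dist c a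

/-- Three points are collinear if one lies on the geodesic segment between the other two. -/
def CollinearPts (a b c : X) : Prop := b ∈ seg a c ∨ a ∈ seg b c ∨ c ∈ seg a b

/-- A geodesic line: the image of an isometric embedding of `ℝ`. -/
def IsGeodesicLine (L : Set X) : Prop := ∃ γ : ℝ → X, Isometry γ ∧ L = Set.range γ

/-- A closed halfplane determined by the line `L`: the union of `L` with a
connected component of its complement. -/
def IsHalfplane (L H : Set X) : Prop :=
  ∃ p, p ∉ L ∧ H = connectedComponentIn Lᶜ p ∪ L

/-- The line `L` separates `A` from `B`: they lie in different closed halfplanes of `L`. -/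
def LineSep (L A B : Set X) : Prop :=
  ∃ H₁ H₂ : Set X, IsHalfplane L H₁ ∧ IsHalfplane L H₂ ∧ H₁ ≠ H₂ ∧ A ⊆ H₁ ∧ B ⊆ H₂

/-- The shade `Sh_u(x,y)` of the segment `[x,y]` with respect to `u`. -/
def Shade (u x y : X) : Set X :=
  {p | (seg u p ∩ seg x y).Nonempty ∧
    ∃ L : Set X, IsGeodesicLine L ∧ u ∈ L ∧ p ∈ L ∧ LineSep L {x} {y}}

/-- The shade `St_u(x,y,z)` of the triangle `Δ(x,y,z)` with respect to `u`. -/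
def TriShade (u x y z : X) : Set X := Shade u x y ∪ Shade u y z ∪ Shade u z x

end Defs


section LogLift

theorem ll_isSimplyConnected_univ {E : Type*} [TopologicalSpace E] [ContractibleSpace E] :
    IsSimplyConnected (Set.univ : Set E) := by
  have : SimplyConnectedSpace (Set.univ : Set E) := by
    have : ContractibleSpace (Set.univ : Set E) := (Homeomorph.Set.univ E).contractibleSpace
    infer_instance
  exact this

theorem ll_exists_log {E : Type*} [AddCommGroup E] [Module ℝ E] [TopologicalSpace E]
    [IsTopologicalAddGroup E] [ContinuousSMul ℝ E] [LocallyPathConnectedSpace E]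
    (f : E → ℂ) (hf : Continuous f) (h0 : ∀ x, f x ≠ 0) :
    ∃ g : E → ℂ, Continuous g ∧ ∀ x, Complex.exp (g x) = f x := by
  have : ContractibleSpace E := RealTopologicalVectorSpace.contractibleSpace
  obtain ⟨g, hg, he⟩ := Complex.exists_continuousOn_eqOn_exp_comp (X := E)
    (U := Set.univ) ll_isSimplyConnected_univ isOpen_univ (g := f) hf.continuousOn
    (by rintro ⟨x, -, hx⟩; exact h0 x hx)
  exact ⟨g, continuousOn_univ.1 hg, fun x => he (Set.mem_univ x)⟩

theorem ll_unique (g₁ g₂ : ℝ → ℂ) (h₁ : Continuous g₁) (h₂ : Continuous g₂)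
    (h : ∀ t, Complex.exp (g₁ t) = Complex.exp (g₂ t)) (s t : ℝ) :
    g₁ t - g₁ s = g₂ t - g₂ s := by
  have key := Complex.isCoveringMap_exp.eq_of_comp_eq (g₁ := g₁)
    (g₂ := fun t => g₂ t + (g₁ s - g₂ s)) h₁ (by fun_prop) (by
      ext t
      simp only [Function.comp_apply, Complex.exp_add, Complex.exp_sub, h]
      rw [div_self (Complex.exp_ne_zero _), mul_one]) s (by ring)
  have := congrFun key t

  rw [this]; ring

/-- variation of the logarithm along a path -/
noncomputable def Lg (f : ℝ → ℂ) : ℂ :=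
  open Classical in
  if h : ∃ g : ℝ → ℂ, Continuous g ∧ ∀ x, Complex.exp (g x) = f x
  then h.choose 1 - h.choose 0 else 0

theorem Lg_eq (f g : ℝ → ℂ) (hg : Continuous g) (h : ∀ x, Complex.exp (g x) = f x) :
    Lg f = g 1 - g 0 := by
  have hh : ∃ g : ℝ → ℂ, Continuous g ∧ ∀ x, Complex.exp (g x) = f x := ⟨g, hg, h⟩
  rw [Lg, dif_pos hh]
  exact ll_unique _ _ hh.choose_spec.1 hg (fun t => by rw [hh.choose_spec.2, h]) 0 1

theorem Lg_exp (f : ℝ → ℂ) (hf : Continuous f) (h0 : ∀ x, f x ≠ 0) :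
    Complex.exp (Lg f) = f 1 / f 0 := by
  obtain ⟨g, hg, h⟩ := ll_exists_log f hf h0
  rw [Lg_eq f g hg h, Complex.exp_sub, h, h]

theorem Lg_rev (f : ℝ → ℂ) (hf : Continuous f) (h0 : ∀ x, f x ≠ 0) :
    Lg (fun t => f (1 - t)) = - Lg f := by
  obtain ⟨g, hg, h⟩ := ll_exists_log f hf h0
  rw [Lg_eq f g hg h, Lg_eq (fun t => f (1 - t)) (fun t => g (1 - t)) (by fun_prop)
    (fun x => h _)]
  simp

theorem Lg_neg (f : ℝ → ℂ) (hf : Continuous f) (h0 : ∀ x, f x ≠ 0) :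
    Lg (fun t => - f t) = Lg f := by
  obtain ⟨g, hg, h⟩ := ll_exists_log f hf h0
  rw [Lg_eq f g hg h, Lg_eq (fun t => - f t) (fun t => g t + Real.pi * Complex.I) (by fun_prop)
    (fun x => by rw [Complex.exp_add, h, Complex.exp_pi_mul_I]; ring)]
  ring

theorem Lg_const (c : ℂ) (hc : c ≠ 0) : Lg (fun _ => c) = 0 := by
  rw [Lg_eq (fun _ => c) (fun _ => Complex.log c) (by fun_prop) (fun _ => Complex.exp_log hc)]
  ring

theorem Lg_sq (F : ℝ × ℝ → ℂ) (hF : Continuous F) (h0 : ∀ x, F x ≠ 0) :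
    Lg (fun t => F (0, t)) + Lg (fun t => F (t, 1)) =
      Lg (fun t => F (t, 0)) + Lg (fun t => F (1, t)) := by
  obtain ⟨g, hg, h⟩ := ll_exists_log F hF h0
  rw [Lg_eq (fun t => F (0, t)) (fun t => g (0, t)) (by fun_prop) (fun _ => h _),
    Lg_eq (fun t => F (t, 1)) (fun t => g (t, 1)) (by fun_prop) (fun _ => h _),
    Lg_eq (fun t => F (t, 0)) (fun t => g (t, 0)) (by fun_prop) (fun _ => h _),
    Lg_eq (fun t => F (1, t)) (fun t => g (1, t)) (by fun_prop) (fun _ => h _)]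
  ring

end LogLift


section MetricBasics

variable {X : Type*} [MetricSpace X]

theorem seg_comm' {x y z : X} (h : z ∈ seg x y) : z ∈ seg y x := by
  simp only [seg, Set.mem_ofPred_eq] at *
  rw [dist_comm y z, dist_comm z x, dist_comm y x]; linarith

theorem left_mem_seg' (x y : X) : x ∈ seg x y := by simp [seg]
theorem right_mem_seg' (x y : X) : y ∈ seg x y := by simp [seg]

theorem seg_self_eq {x z : X} (h : z ∈ seg x x) : z = x := by
  simp only [seg, Set.mem_ofPred_eq, dist_self] at h
  have h1 := dist_nonneg (x := x) (y := z)
  have h2 := dist_nonneg (x := z) (y := x)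
  exact dist_le_zero.1 (by linarith)

/-- transitivity of segments -/
theorem seg_trans {u a z y : X} (h1 : a ∈ seg u z) (h2 : z ∈ seg u y) : a ∈ seg u y := by
  simp only [seg, Set.mem_ofPred_eq] at *
  have := dist_triangle a z y
  have := dist_triangle u a y
  linarith

theorem seg_trans2 {u a z y : X} (h1 : a ∈ seg u z) (h2 : z ∈ seg u y) : z ∈ seg a y := by
  simp only [seg, Set.mem_ofPred_eq] at *
  have := dist_triangle a z y
  have := dist_triangle u a y
  linarith

theorem mem_seg_iff {x y z : X} : z ∈ seg x y ↔ dist x z + dist z y = dist x y := Iff.rfl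

theorem geod_exists (hB : IsBusemannSpace X) (x y : X) : ∃ γ : ℝ → X,
    IsGeodesicMap γ (dist x y) ∧ γ 0 = x ∧ γ (dist x y) = y := hB.1 x y

/-- the point of the geodesic from `x` to `y` at fraction `t` -/
noncomputable def gpt (hB : IsBusemannSpace X) (x y : X) (t : ℝ) : X :=
  (hB.1 x y).choose (max 0 (min t 1) * dist x y)

variable (hB : IsBusemannSpace X)

theorem clamp_mem (t : ℝ) : max 0 (min t 1) ∈ Set.Icc (0 : ℝ) 1 := by
  constructor
  · exact le_max_left _ _
  · exact max_le (by norm_num) (min_le_right _ _)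

theorem clamp_eq {t : ℝ} (h : t ∈ Set.Icc (0 : ℝ) 1) : max 0 (min t 1) = t := by
  rw [min_eq_left h.2, max_eq_right h.1]

theorem gpt_of_mem (x y : X) {t : ℝ} (h : t ∈ Set.Icc (0 : ℝ) 1) :
    gpt hB x y t = (hB.1 x y).choose (t * dist x y) := by
  rw [gpt, clamp_eq h]

theorem gpt_clamp (x y : X) (t : ℝ) : gpt hB x y t = gpt hB x y (max 0 (min t 1)) := by
  rw [gpt_of_mem hB x y (clamp_mem t), gpt]

theorem gpt_zero (x y : X) : gpt hB x y 0 = x := by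
  rw [gpt_of_mem hB x y (by simp), zero_mul]; exact (hB.1 x y).choose_spec.2.1

theorem gpt_one (x y : X) : gpt hB x y 1 = y := by
  rw [gpt_of_mem hB x y (by simp), one_mul]; exact (hB.1 x y).choose_spec.2.2

theorem dist_gpt (x y : X) {s t : ℝ} (hs : s ∈ Set.Icc (0 : ℝ) 1) (ht : t ∈ Set.Icc (0 : ℝ) 1) :
    dist (gpt hB x y s) (gpt hB x y t) = |s - t| * dist x y := by
  rw [gpt_of_mem hB x y hs, gpt_of_mem hB x y ht]
  have h := (hB.1 x y).choose_spec.1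
  have hd := dist_nonneg (x := x) (y := y)
  rw [h _ ⟨by nlinarith [hs.1], by nlinarith [hs.2]⟩ _ ⟨by nlinarith [ht.1], by nlinarith [ht.2]⟩,
    ← sub_mul, abs_mul, abs_of_nonneg hd]

theorem gpt_busemann (x y x' y' : X) {t : ℝ} (ht : t ∈ Set.Icc (0 : ℝ) 1) :
    dist (gpt hB x y t) (gpt hB x' y' t) ≤ (1 - t) * dist x x' + t * dist y y' := by
  rw [gpt_of_mem hB x y ht, gpt_of_mem hB x' y' ht]
  have h1 := (hB.1 x y).choose_spec
  have h2 := (hB.1 x' y').choose_spec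
  have := hB.2 _ _ _ _ dist_nonneg dist_nonneg h1.1 h2.1 t ht
  rwa [h1.2.1, h1.2.2, h2.2.1, h2.2.2] at this

theorem gpt_continuous : Continuous (fun p : X × X × ℝ => gpt hB p.1 p.2.1 p.2.2) := by
  rw [continuous_iff_continuousAt]
  rintro ⟨x, y, s⟩
  rw [ContinuousAt, tendsto_iff_dist_tendsto_zero]
  have hle : ∀ p : X × X × ℝ, dist (gpt hB p.1 p.2.1 p.2.2) (gpt hB x y s) ≤
      dist p.1 x + dist p.2.1 y + |max 0 (min p.2.2 1) - max 0 (min s 1)| * dist x y := by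
    rintro ⟨x', y', t⟩
    simp only
    rw [gpt_clamp hB x' y' t, gpt_clamp hB x y s]
    have h1 := gpt_busemann hB x' y' x y (clamp_mem t)
    have h2 := dist_gpt hB x y (clamp_mem t) (clamp_mem s)
    have h3 := clamp_mem t
    have h4 := dist_triangle (gpt hB x' y' (max 0 (min t 1))) (gpt hB x y (max 0 (min t 1)))
      (gpt hB x y (max 0 (min s 1)))
    have := dist_nonneg (x := x') (y := x)
    have := dist_nonneg (x := y') (y := y)
    nlinarith [h3.1, h3.2]
  refine squeeze_zero (fun _ => dist_nonneg) hle ?_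
  have hc : Continuous (fun p : X × X × ℝ =>
      dist p.1 x + dist p.2.1 y + |max 0 (min p.2.2 1) - max 0 (min s 1)| * dist x y) := by
    fun_prop
  have := hc.tendsto (x, y, s)
  simpa using this

theorem gpt_cont {E : Type*} [TopologicalSpace E] {f g : E → X} {h : E → ℝ}
    (hf : Continuous f) (hg : Continuous g) (hh : Continuous h) :
    Continuous (fun e => gpt hB (f e) (g e) (h e)) :=
  (gpt_continuous hB).comp (hf.prodMk (hg.prodMk hh))

theorem dist_left_gpt (x y : X) {t : ℝ} (ht : t ∈ Set.Icc (0 : ℝ) 1) :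
    dist x (gpt hB x y t) = t * dist x y := by
  have := dist_gpt hB x y (s := 0) (by simp) ht
  rw [gpt_zero] at this
  rw [this, zero_sub, abs_neg, abs_of_nonneg ht.1]

theorem dist_gpt_right (x y : X) {t : ℝ} (ht : t ∈ Set.Icc (0 : ℝ) 1) :
    dist (gpt hB x y t) y = (1 - t) * dist x y := by
  have := dist_gpt hB x y (t := 1) ht (by simp)
  rw [gpt_one] at this
  rw [this, abs_sub_comm, abs_of_nonneg (by linarith [ht.2])]

theorem gpt_mem_seg (x y : X) (t : ℝ) : gpt hB x y t ∈ seg x y := by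
  rw [gpt_clamp, mem_seg_iff, dist_left_gpt hB x y (clamp_mem t),
    dist_gpt_right hB x y (clamp_mem t)]
  ring

include hB in
theorem seg_unique {x y z w : X} (hz : z ∈ seg x y) (hw : w ∈ seg x y)
    (h : dist x z = dist x w) : z = w := by
  -- concatenated geodesics
  have key : ∀ z ∈ seg x y, ∃ γ : ℝ → X, IsGeodesicMap γ (dist x y) ∧ γ 0 = x ∧
      γ (dist x y) = y ∧ γ (dist x z) = z := by
    intro z hz
    obtain ⟨γ₁, h1, h10, h11⟩ := hB.1 x z
    obtain ⟨γ₂, h2, h20, h21⟩ := hB.1 z y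
    rw [mem_seg_iff] at hz
    have p1 := dist_nonneg (x := x) (y := z)
    have p2 := dist_nonneg (x := z) (y := y)
    set γ : ℝ → X := fun s => if s ≤ dist x z then γ₁ s else γ₂ (s - dist x z) with hγ
    have g1 : ∀ s, s ≤ dist x z → γ s = γ₁ s := fun s hs => by simp only [hγ]; rw [if_pos hs]
    have g2 : ∀ s, dist x z ≤ s → γ s = γ₂ (s - dist x z) := by
      intro s hs
      rcases hs.eq_or_lt with h | h
      · rw [g1 s h.ge, ← h, h11, sub_self, h20]
      · simp only [hγ]; rw [if_neg (not_le.2 h)]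
    have e0 : γ 0 = x := by rw [g1 0 p1, h10]
    have e1 : γ (dist x y) = y := by
      rw [g2 _ (by linarith), show dist x y - dist x z = dist z y by linarith, h21]
    have mixed : ∀ s t, 0 ≤ s → s ≤ dist x z → dist x z ≤ t → t ≤ dist x y →
        dist (γ s) (γ t) = t - s := by
      intro s t hs0 hs ht ht1
      rw [g1 s hs, g2 t ht]
      have a1 := h1 s ⟨hs0, hs⟩ (dist x z) ⟨p1, le_rfl⟩
      have a2 := h2 0 ⟨le_rfl, p2⟩ (t - dist x z) ⟨by linarith, by linarith⟩
      have a3 := h1 0 ⟨le_rfl, p1⟩ s ⟨hs0, hs⟩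
      have a4 := h2 (t - dist x z) ⟨by linarith, by linarith⟩ (dist z y) ⟨p2, le_rfl⟩
      rw [h11, abs_sub_comm, abs_of_nonneg (by linarith)] at a1
      rw [h20, abs_sub_comm, abs_of_nonneg (by linarith)] at a2
      rw [h10, abs_sub_comm, abs_of_nonneg (by linarith)] at a3
      rw [h21, abs_sub_comm, abs_of_nonneg (by linarith)] at a4
      have t1 := dist_triangle (γ₁ s) z (γ₂ (t - dist x z))
      have t2 := dist_triangle4 x (γ₁ s) (γ₂ (t - dist x z)) y
      apply le_antisymm <;> linarith
    refine ⟨γ, ?_, e0, e1, by rw [g1 _ le_rfl, h11]⟩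
    intro s hs t ht
    rcases le_total s (dist x z) with hs' | hs' <;> rcases le_total t (dist x z) with ht' | ht'
    · rw [g1 s hs', g1 t ht']; exact h1 s ⟨hs.1, hs'⟩ t ⟨ht.1, ht'⟩
    · rw [mixed s t hs.1 hs' ht' ht.2, abs_sub_comm, abs_of_nonneg (by linarith)]
    · rw [dist_comm, mixed t s ht.1 ht' hs' hs.2, abs_of_nonneg (by linarith)]
    · rw [g2 s hs', g2 t ht', h2 _ ⟨by linarith, by linarith [hs.2]⟩ _
        ⟨by linarith, by linarith [ht.2]⟩]
      congr 1; ring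
  obtain ⟨γ, h1, h2, h3, h4⟩ := key z hz
  obtain ⟨γ', h1', h2', h3', h4'⟩ := key w hw
  rcases (dist_nonneg (x := x) (y := y)).eq_or_lt with h0 | h0
  · have : x = y := dist_le_zero.1 h0.ge
    subst this
    rw [seg_self_eq hz, seg_self_eq hw]
  · have hle : dist x z ≤ dist x y := by
      rw [mem_seg_iff] at hz; linarith [dist_nonneg (x := z) (y := y)]
    have := hB.2 γ γ' _ _ dist_nonneg dist_nonneg h1 h1' (dist x z / dist x y)
      ⟨by positivity, by rw [div_le_one h0]; exact hle⟩
    rw [div_mul_cancel₀ _ h0.ne', h4, h, h4', h2, h2', h3, h3', dist_self, dist_self] at this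
    exact dist_le_zero.1 (by linarith)

theorem mem_seg_gpt {x y z : X} (hz : z ∈ seg x y) :
    ∃ t ∈ Set.Icc (0 : ℝ) 1, z = gpt hB x y t := by
  rcases (dist_nonneg (x := x) (y := y)).eq_or_lt with h0 | h0
  · have : x = y := dist_le_zero.1 h0.ge
    subst this
    exact ⟨0, by simp, by rw [gpt_zero, seg_self_eq hz]⟩
  · have hle : dist x z ≤ dist x y := by
      rw [mem_seg_iff] at hz; linarith [dist_nonneg (x := z) (y := y)]
    have ht : dist x z / dist x y ∈ Set.Icc (0 : ℝ) 1 :=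
      ⟨by positivity, by rw [div_le_one h0]; exact hle⟩
    refine ⟨_, ht, seg_unique hB hz (gpt_mem_seg hB x y _) ?_⟩
    rw [dist_left_gpt hB x y ht, div_mul_cancel₀ _ h0.ne']

theorem gpt_symm (x y : X) (t : ℝ) : gpt hB y x t = gpt hB x y (1 - t) := by
  have hc : max 0 (min (1 - t) 1) = 1 - max 0 (min t 1) := by
    rcases le_total t 0 with h | h
    · rw [min_eq_left (by linarith : t ≤ 1), max_eq_left h, min_eq_right (by linarith),
        max_eq_right (by linarith)]; ring
    · rcases le_total t 1 with h' | h'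
      · rw [min_eq_left h', max_eq_right h, min_eq_left (by linarith), max_eq_right (by linarith)]
      · rw [min_eq_right h', min_eq_left (by linarith), max_eq_left (by linarith),
          max_eq_right (by norm_num)]; ring
  rw [gpt_clamp, gpt_clamp hB x y, hc]
  have h1 := clamp_mem t
  have h2 : 1 - max 0 (min t 1) ∈ Set.Icc (0 : ℝ) 1 := ⟨by linarith [h1.2], by linarith [h1.1]⟩
  refine seg_unique hB (seg_comm' (gpt_mem_seg hB _ _ _)) (gpt_mem_seg hB _ _ _) ?_
  rw [dist_left_gpt hB x y h2, dist_comm, dist_gpt_right hB y x h1, dist_comm y x]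

theorem gpt_self (x : X) (t : ℝ) : gpt hB x x t = x := seg_self_eq (gpt_mem_seg hB x x t)

theorem dist_gpt_le (c x y : X) {t : ℝ} (ht : t ∈ Set.Icc (0 : ℝ) 1) :
    dist c (gpt hB x y t) ≤ (1 - t) * dist c x + t * dist c y := by
  have := gpt_busemann hB c c x y ht
  rwa [gpt_self] at this

include hB in
theorem seg_ball {c x y z : X} {r : ℝ} (hz : z ∈ seg x y) (h1 : dist c x ≤ r) (h2 : dist c y ≤ r) :
    dist c z ≤ r := by
  obtain ⟨t, ht, rfl⟩ := mem_seg_gpt hB hz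
  have := dist_gpt_le hB c x y ht
  nlinarith [ht.1, ht.2]

include hB in
theorem seg_exists (x y : X) {r : ℝ} (h0 : 0 ≤ r) (h1 : r ≤ dist x y) :
    ∃ z ∈ seg x y, dist x z = r := by
  rcases (dist_nonneg (x := x) (y := y)).eq_or_lt with h | h
  · exact ⟨x, left_mem_seg' x y, by rw [dist_self]; linarith⟩
  · have ht : r / dist x y ∈ Set.Icc (0 : ℝ) 1 := ⟨by positivity, by rw [div_le_one h]; exact h1⟩
    exact ⟨gpt hB x y (r / dist x y), gpt_mem_seg hB _ _ _, by
      rw [dist_left_gpt hB x y ht, div_mul_cancel₀ _ h.ne']⟩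

theorem seg_dist_le {x y z : X} (hz : z ∈ seg x y) : dist x z ≤ dist x y := by
  rw [mem_seg_iff] at hz; linarith [dist_nonneg (x := z) (y := y)]

include hB in
theorem seg_order {u y a b : X} (ha : a ∈ seg u y) (hb : b ∈ seg u y) (h : dist u a ≤ dist u b) :
    a ∈ seg u b := by
  obtain ⟨a', ha', hd⟩ := seg_exists hB u b dist_nonneg h
  have : a' = a := seg_unique hB (seg_trans ha' hb) ha hd
  rwa [← this]

include hB in
theorem seg_dist_eq {u y a b : X} (ha : a ∈ seg u y) (hb : b ∈ seg u y) :
    dist a b = |dist u a - dist u b| := by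
  rcases le_total (dist u a) (dist u b) with h | h
  · have := seg_order hB ha hb h
    rw [mem_seg_iff] at this
    rw [abs_of_nonpos (by linarith)]; linarith
  · have := seg_order hB hb ha h
    rw [mem_seg_iff] at this
    rw [abs_of_nonneg (by linarith), dist_comm]; linarith

include hB in
theorem seg_total {u y a b : X} (ha : a ∈ seg u y) (hb : b ∈ seg u y) :
    a ∈ seg u b ∨ b ∈ seg u a := by
  rcases le_total (dist u a) (dist u b) with h | h
  · exact Or.inl (seg_order hB ha hb h)
  · exact Or.inr (seg_order hB hb ha h)

/-- subsegments -/
theorem seg_sub_mem {x y a b z : X} (hB : IsBusemannSpace X) (ha : a ∈ seg x y) (hb : b ∈ seg x y)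
    (hz : z ∈ seg a b) : z ∈ seg x y := by
  rcases seg_total hB ha hb with h | h
  · have h1 : z ∈ seg b a := seg_comm' hz
    have h2 : a ∈ seg b x := seg_comm' h
    have h3 : z ∈ seg b x := seg_trans h1 h2
    exact seg_trans (seg_comm' h3) hb
  · have h2 : b ∈ seg a x := seg_comm' h
    have h3 : z ∈ seg a x := seg_trans hz h2
    exact seg_trans (seg_comm' h3) ha

include hB in
/-- equal-depth contraction -/
theorem depth_contract {u p q a b : X} (ha : a ∈ seg u p) (hb : b ∈ seg u q)
    (h : dist a p = dist b q) : dist a b ≤ dist p q := by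
  -- auxiliary: assume d u p ≤ d u q
  have key : ∀ p q a b : X, a ∈ seg u p → b ∈ seg u q → dist a p = dist b q →
      dist u p ≤ dist u q → dist a b ≤ dist p q := by
    intro p q a b ha hb h hle
    rcases (dist_nonneg (x := u) (y := p)).eq_or_lt with h0 | h0
    · have : u = p := dist_le_zero.1 h0.ge
      subst this
      have ha := seg_self_eq ha
      subst ha
      rw [dist_self] at h
      have : b = q := dist_le_zero.1 h.ge
      rw [this]
    · have ha' := ha
      have hb' := hb
      rw [mem_seg_iff] at ha hb
      have n1 := dist_nonneg (x := u) (y := a)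
      have n2 := dist_nonneg (x := a) (y := p)
      set f := dist u p with hf
      set f2 := dist u q with hf2
      set hh := dist a p with hhdef
      have h00 : 0 < f2 := lt_of_lt_of_le h0 hle
      -- from p to u at fraction hh / f
      have ht : hh / f ∈ Set.Icc (0 : ℝ) 1 := ⟨by positivity, by rw [div_le_one h0]; linarith⟩
      have e1 : a = gpt hB p u (hh / f) := by
        refine seg_unique hB (seg_comm' ha') (gpt_mem_seg hB p u _) ?_
        rw [dist_left_gpt hB p u ht, dist_comm p u, ← hf, div_mul_cancel₀ _ h0.ne', dist_comm]
      have b1 := gpt_busemann hB p u q u ht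
      rw [← e1, dist_self, mul_zero, add_zero] at b1
      have b2 : dist (gpt hB q u (hh / f)) b = (hh / f) * (f2 - f) := by
        rw [seg_dist_eq hB (gpt_mem_seg hB q u _) (seg_comm' hb'), dist_left_gpt hB q u ht,
          dist_comm q u, ← hf2, dist_comm q b, ← h]
        have : hh / f * f2 - hh = (hh / f) * (f2 - f) := by field_simp
        rw [this, abs_of_nonneg (mul_nonneg ht.1 (by linarith))]
      have b3 : f2 - f ≤ dist p q := by
        have := dist_triangle u p q; linarith
      have b4 := dist_triangle a (gpt hB q u (hh / f)) b
      have b5 : (hh / f) * (f2 - f) ≤ (hh / f) * dist p q := mul_le_mul_of_nonneg_left b3 ht.1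
      nlinarith
  rcases le_total (dist u p) (dist u q) with hle | hle
  · exact key p q a b ha hb h hle
  · rw [dist_comm a b, dist_comm p q]; exact key q p b a hb ha h.symm hle

include hB in
theorem depth_contract2 {u p q a b : X} (ha : a ∈ seg u p) (hb : b ∈ seg u q) :
    dist a b ≤ dist p q + |dist a p - dist b q| := by
  have key : ∀ p q a b : X, a ∈ seg u p → b ∈ seg u q → dist a p ≤ dist b q →
      dist a b ≤ dist p q + |dist a p - dist b q| := by
    intro p q a b ha hb h
    have hbq : dist b q ≤ dist u q := by
      rw [mem_seg_iff] at hb; linarith [dist_nonneg (x := u) (y := b)]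
    obtain ⟨b', hb', hd⟩ := seg_exists hB q u (r := dist a p) dist_nonneg
      (by rw [dist_comm q u]; linarith)
    have h1 := depth_contract hB ha (seg_comm' hb') (by rw [dist_comm b' q, hd])
    have h2 := seg_dist_eq hB hb' (seg_comm' hb)
    rw [hd, dist_comm q b] at h2
    have := dist_triangle a b' b
    linarith
  rcases le_total (dist a p) (dist b q) with h | h
  · exact key p q a b ha hb h
  · rw [dist_comm a b, dist_comm p q, abs_sub_comm]; exact key q p b a hb ha h

end MetricBasics


section Winding

variable {X : Type*} [MetricSpace X] (hB : IsBusemannSpace X) (φ : X ≃ₜ ℂ)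

/-- variation of the argument, seen from `x`, along the segment from `p` to `q` -/
noncomputable def Aw (x p q : X) : ℂ := Lg (fun t => φ (gpt hB p q t) - φ x)

theorem aw_cont (x p q : X) : Continuous (fun t : ℝ => φ (gpt hB p q t) - φ x) :=
  (φ.continuous.comp (gpt_cont hB continuous_const continuous_const continuous_id)).sub
    continuous_const

theorem aw_ne {x p q : X} (h : x ∉ seg p q) (t : ℝ) : φ (gpt hB p q t) - φ x ≠ 0 := by
  intro h0
  apply h
  rw [← φ.injective (sub_eq_zero.1 h0)]
  exact gpt_mem_seg hB p q t

theorem Aw_swap {x p q : X} (h : x ∉ seg p q) : Aw hB φ x q p = - Aw hB φ x p q := by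
  have := Lg_rev _ (aw_cont hB φ x p q) (aw_ne hB φ h)
  rw [Aw, Aw, ← this]
  congr 1
  ext t
  rw [gpt_symm]

theorem Aw_exp {x p q : X} (h : x ∉ seg p q) :
    Complex.exp (Aw hB φ x p q) = (φ q - φ x) / (φ p - φ x) := by
  have := Lg_exp _ (aw_cont hB φ x p q) (aw_ne hB φ h)
  rw [gpt_zero, gpt_one] at this
  exact this

theorem Aw_cone {x o p q : X} (h : ∀ z ∈ seg p q, x ∉ seg o z) :
    Aw hB φ x o p + Aw hB φ x p q = Aw hB φ x o q := by
  have hc : Continuous (fun s : ℝ × ℝ => φ (gpt hB o (gpt hB p q s.1) s.2) - φ x) :=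
    (φ.continuous.comp (gpt_cont hB continuous_const
      (gpt_cont hB continuous_const continuous_const continuous_fst) continuous_snd)).sub
      continuous_const
  have := Lg_sq _ hc (fun s => aw_ne hB φ (h _ (gpt_mem_seg hB p q s.1)) s.2)
  simp only [gpt_zero, gpt_one] at this
  rw [Lg_const (φ o - φ x), zero_add] at this
  · exact this
  · intro h0
    apply h p (left_mem_seg' p q)
    rw [← φ.injective (sub_eq_zero.1 h0)]
    exact left_mem_seg' o p

theorem Aw_sq {a b c d : X} (h : ∀ z, z ∈ seg a b → z ∉ seg c d) :
    Aw hB φ c a b + Aw hB φ b c d = Aw hB φ a c d + Aw hB φ d a b := by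
  have hc : Continuous (fun s : ℝ × ℝ => φ (gpt hB a b s.1) - φ (gpt hB c d s.2)) :=
    (φ.continuous.comp (gpt_cont hB continuous_const continuous_const continuous_fst)).sub
    (φ.continuous.comp (gpt_cont hB continuous_const continuous_const continuous_snd))
  have := Lg_sq _ hc (fun s => by
    intro h0
    have := φ.injective (sub_eq_zero.1 h0)
    exact h _ (gpt_mem_seg hB a b s.1) (this ▸ gpt_mem_seg hB c d s.2))
  simp only [gpt_zero, gpt_one] at this
  have e : ∀ x : X, x ∉ seg c d →
      Lg (fun t => φ x - φ (gpt hB c d t)) = Aw hB φ x c d := by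
    intro x hx
    rw [Aw, ← Lg_neg _ (aw_cont hB φ x c d) (aw_ne hB φ hx)]
    congr 1
    ext t
    ring
  rw [e a (h a (left_mem_seg' a b)), e b (h b (right_mem_seg' a b))] at this
  exact this.symm

/-! ### sides of the segment `[u,v]` -/

/-- `a` lies on a geodesic from `u` to a point of `[v,b]` -/
def Below (u v a b : X) : Prop := ∃ z ∈ seg v b, a ∈ seg u z
/-- `[u,a]` meets `[v,b]` -/
def Cross (u v a b : X) : Prop := ∃ z ∈ seg v b, z ∈ seg u a

/-- side invariant -/
noncomputable def sg (u v a : X) : ℂ := Aw hB φ a u v + Aw hB φ u v a - Aw hB φ v u a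

theorem sg_exp {u v a : X} (h1 : a ∉ seg u v) (h2 : u ∉ seg v a) (h3 : v ∉ seg u a) :
    Complex.exp (sg hB φ u v a) = -1 := by
  rw [sg, Complex.exp_sub, Complex.exp_add, Aw_exp hB φ h1, Aw_exp hB φ h2, Aw_exp hB φ h3]
  have e1 : φ u - φ a ≠ 0 := fun h => h1 (by
    rw [← φ.injective (sub_eq_zero.1 h)]; exact left_mem_seg' _ _)
  have e2 : φ v - φ u ≠ 0 := fun h => h2 (by
    rw [← φ.injective (sub_eq_zero.1 h)]; exact left_mem_seg' _ _)
  have e3 : φ a - φ v ≠ 0 := fun h => h3 (by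
    rw [← φ.injective (sub_eq_zero.1 h)]; exact right_mem_seg' _ _)
  have e4 : φ u - φ v ≠ 0 := fun h => e2 (by rw [← neg_eq_zero]; rw [← h]; ring)
  field_simp
  ring

theorem exp_neg_one_im {z : ℂ} (h : Complex.exp z = -1) : z.im ≠ 0 := by
  intro h0
  have h1 := congrArg Complex.re h
  rw [Complex.exp_re, h0, Real.cos_zero, mul_one] at h1
  have := Real.exp_pos z.re
  simp at h1
  linarith

theorem sg_side {u v a b : X} (h1 : ¬ Below u v a b) (h2 : ¬ Below u v b a)
    (h3 : ¬ Cross u v a b) (h4 : ¬ Cross u v b a) : sg hB φ u v a + sg hB φ u v b = 0 := by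
  have e1 : Aw hB φ a u v + Aw hB φ a v b = Aw hB φ a u b :=
    Aw_cone hB φ (fun z hz h => h1 ⟨z, hz, h⟩)
  have e2 : Aw hB φ b u v + Aw hB φ b v a = Aw hB φ b u a :=
    Aw_cone hB φ (fun z hz h => h2 ⟨z, hz, h⟩)
  have e3 : Aw hB φ v u a + Aw hB φ a v b = Aw hB φ u v b + Aw hB φ b u a :=
    Aw_sq hB φ (fun z hz h => h3 ⟨z, h, hz⟩)
  have e4 : Aw hB φ v u b + Aw hB φ b v a = Aw hB φ u v a + Aw hB φ a u b :=
    Aw_sq hB φ (fun z hz h => h4 ⟨z, h, hz⟩)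
  rw [sg, sg]
  linear_combination e1 + e2 - e3 - e4

theorem sg_slide {u v x c : X} (hx : x ∈ seg v c) (hx2 : x ∉ seg u v)
    (h1 : ∀ z ∈ seg x c, v ∉ seg u z) (h2 : u ∉ seg v c) :
    sg hB φ u v x = sg hB φ u v c := by
  have hsub : ∀ z ∈ seg x c, z ∈ seg v c := fun z hz =>
    seg_comm' (seg_trans (seg_comm' hz) (seg_comm' hx))
  have e1 : Aw hB φ x u v + Aw hB φ v x c = Aw hB φ u x c + Aw hB φ c u v := by
    refine Aw_sq hB φ (fun w hw hw2 => hx2 ?_)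
    have hxw : x ∈ seg v w := by
      have h := seg_trans2 (seg_comm' hw2) (seg_comm' hx)
      exact seg_comm' h
    exact seg_comm' (seg_trans hxw (seg_comm' hw))
  have e2 : Aw hB φ u v x + Aw hB φ u x c = Aw hB φ u v c :=
    Aw_cone hB φ (fun z hz h => h2 (seg_trans h (hsub z hz)))
  have e3 : Aw hB φ v u x + Aw hB φ v x c = Aw hB φ v u c := Aw_cone hB φ h1
  rw [sg, sg]
  linear_combination e1 + e2 - e3

/-! ### winding of a triangle -/

/-- the points radially comparable with `[a,b]` as seen from `o` -/
def Wr (o a b q : X) : Prop := ∃ z ∈ seg a b, z ∈ seg o q ∨ q ∈ seg o z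

noncomputable def kp (o a q : X) : ℂ := Aw hB φ a o q - Aw hB φ q o a

noncomputable def tau (o a b c : X) : ℂ := Aw hB φ o a b + Aw hB φ o b c + Aw hB φ o c a

theorem Wr_comm {o a b q : X} (h : Wr o a b q) : Wr o b a q := by
  obtain ⟨z, hz, h⟩ := h
  exact ⟨z, seg_comm' hz, h⟩

theorem Aw_kp {o a b q : X} (hq : ¬ Wr o a b q) :
    Aw hB φ o a b = kp hB φ o a q - kp hB φ o b q := by
  have e1 : Aw hB φ a o q + Aw hB φ q a b = Aw hB φ o a b + Aw hB φ b o q :=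
    Aw_sq hB φ (fun z hz hz2 => hq ⟨z, hz2, Or.inl hz⟩)
  have e2 : Aw hB φ q o a + Aw hB φ q a b = Aw hB φ q o b :=
    Aw_cone hB φ (fun z hz h => hq ⟨z, hz, Or.inr h⟩)
  rw [kp, kp]
  linear_combination e2 - e1

theorem kp_exp {o a q : X} (h1 : a ∉ seg o q) (h2 : q ∉ seg o a) :
    Complex.exp (kp hB φ o a q) = - ((φ o - φ q) / (φ o - φ a)) := by
  rw [kp, Complex.exp_sub, Aw_exp hB φ h1, Aw_exp hB φ h2]
  have e1 : φ o - φ a ≠ 0 := fun h => h1 (by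
    rw [← φ.injective (sub_eq_zero.1 h)]; exact left_mem_seg' _ _)
  have e2 : φ o - φ q ≠ 0 := fun h => h2 (by
    rw [← φ.injective (sub_eq_zero.1 h)]; exact left_mem_seg' _ _)
  have e3 : φ a - φ q ≠ 0 := fun h => h1 (by
    rw [φ.injective (sub_eq_zero.1 h)]; exact right_mem_seg' _ _)
  field_simp
  ring

theorem tau_sur {o a b c : X} (h : tau hB φ o a b c ≠ 0) (q : X) :
    Wr o a b q ∨ Wr o b c q ∨ Wr o c a q := by
  by_contra hc
  push Not at hc
  obtain ⟨h1, h2, h3⟩ := hc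
  apply h
  rw [tau, Aw_kp hB φ h1, Aw_kp hB φ h2, Aw_kp hB φ h3]
  ring

theorem tau_in {o a b c : X} (h : tau hB φ o a b c ≠ 0) (hbc : o ∉ seg b c) :
    ∃ z ∈ seg a b, o ∈ seg c z := by
  by_contra hc
  push Not at hc
  apply h
  have := Aw_cone hB φ hc
  rw [Aw_swap hB φ hbc] at this
  rw [tau]
  linear_combination this

theorem tau_cyc (o a b c : X) : tau hB φ o b c a = tau hB φ o a b c := by
  rw [tau, tau]; ring

theorem tau_rad {o a b x : X} (h : tau hB φ o a b x = 0) : Wr o a b x ∨ Wr o b x a ∨ Wr o x a b := by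
  by_contra hc
  push Not at hc
  obtain ⟨h1, h2, h3⟩ := hc
  have e0 : (2 : ℂ) * (kp hB φ o a x + kp hB φ o x b + kp hB φ o b a) = 0 := by
    rw [tau, Aw_kp hB φ h1, Aw_kp hB φ h2, Aw_kp hB φ h3] at h
    simp only [kp] at h ⊢
    linear_combination h
  have e1 : kp hB φ o a x + kp hB φ o x b + kp hB φ o b a = 0 := by
    rcases mul_eq_zero.1 e0 with h | h
    · norm_num at h
    · exact h
  have n1 : a ∉ seg o x := fun h => h1 ⟨a, left_mem_seg' _ _, Or.inl h⟩
  have n2 : x ∉ seg o a := fun h => h1 ⟨a, left_mem_seg' _ _, Or.inr h⟩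
  have n3 : b ∉ seg o x := fun h => h1 ⟨b, right_mem_seg' _ _, Or.inl h⟩
  have n4 : x ∉ seg o b := fun h => h1 ⟨b, right_mem_seg' _ _, Or.inr h⟩
  have n5 : b ∉ seg o a := fun h => h2 ⟨b, left_mem_seg' _ _, Or.inl h⟩
  have n6 : a ∉ seg o b := fun h => h2 ⟨b, left_mem_seg' _ _, Or.inr h⟩
  have e2 := congrArg Complex.exp e1
  rw [Complex.exp_add, Complex.exp_add, kp_exp hB φ n1 n2, kp_exp hB φ n4 n3, kp_exp hB φ n5 n6,
    Complex.exp_zero] at e2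
  have f1 : φ o - φ a ≠ 0 := fun h => n1 (by
    rw [← φ.injective (sub_eq_zero.1 h)]; exact left_mem_seg' _ _)
  have f2 : φ o - φ b ≠ 0 := fun h => n3 (by
    rw [← φ.injective (sub_eq_zero.1 h)]; exact left_mem_seg' _ _)
  have f3 : φ o - φ x ≠ 0 := fun h => n2 (by
    rw [← φ.injective (sub_eq_zero.1 h)]; exact left_mem_seg' _ _)
  have e3 : -((φ o - φ x) / (φ o - φ a)) * -((φ o - φ b) / (φ o - φ x)) *
    -((φ o - φ a) / (φ o - φ b)) = -1 := by
    field_simp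
  rw [e3] at e2
  norm_num at e2

end Winding


section Chains

variable {X : Type*} [MetricSpace X] (hB : IsBusemannSpace X) (φ : X ≃ₜ ℂ)

/-- the points of the ball to be treated, outside of the first ball -/
structure E0 (u v w : X) (δ : ℝ) (a : X) : Prop where
  hu : dist u a ≤ dist u v
  hv : dist v a ≤ 2 * δ
  hw : δ < dist w a

/-- far pairs -/
def Far (u v : X) (δ : ℝ) (a b : X) : Prop := 2 * δ < dist a b ∧ Below u v a b

variable {u v w : X} {δ : ℝ}

include hB in
theorem E0.not1 {a : X} (h : E0 u v w δ a) (hw : w ∈ seg v u) (hwd : dist v w = δ) :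
    a ∉ seg u v := by
  intro ha
  have := seg_dist_eq hB hw (seg_comm' ha)
  have h1 := h.hv
  have h2 := h.hw
  rw [this, hwd] at h2
  have h3 := dist_nonneg (x := v) (y := a)
  have : |δ - dist v a| ≤ δ := abs_le.2 ⟨by linarith, by linarith⟩
  linarith

theorem E0.not2 {a : X} (h : E0 u v w δ a) (hD : 2 * δ < dist u v) : u ∉ seg v a := by
  intro ha
  have := seg_dist_le ha
  rw [dist_comm v u] at this
  linarith [h.hv]

theorem E0.not3 {a : X} (h : E0 u v w δ a) (hwd : dist v w = δ) : v ∉ seg u a := by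
  intro ha
  rw [mem_seg_iff] at ha
  have : v = a := dist_le_zero.1 (by linarith [h.hu])
  have h2 := h.hw
  rw [← this, dist_comm, hwd] at h2
  linarith

theorem cross_le {a b : X} (ha : dist u a ≤ dist u v) (hb : dist v b ≤ 2 * δ)
    (h : Cross u v a b) : dist a b ≤ 2 * δ := by
  obtain ⟨z, h1, h2⟩ := h
  rw [mem_seg_iff] at h1 h2
  have := dist_triangle a z b
  have := dist_triangle u z v
  rw [dist_comm a z] at *
  rw [dist_comm z v] at *
  linarith

theorem below_X {a b : X} (h : Below u v a b) :
    dist v a + dist u a ≤ dist v b + dist u b := by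
  obtain ⟨z, h1, h2⟩ := h
  rw [mem_seg_iff] at h1 h2
  have := dist_triangle v z a
  have := dist_triangle u b z
  rw [dist_comm z a] at *
  rw [dist_comm b z] at *
  linarith

include hB in
theorem far_z {a b z : X} (ha : E0 u v w δ a) (hb : E0 u v w δ b) (hw : w ∈ seg v u)
    (hwd : dist v w = δ) (hd : 2 * δ < dist a b)
    (hz : z ∈ seg v b) (haz : a ∈ seg u z) :
    dist v z < dist a z ∧ 2 * δ < dist a z + dist v z := by
  have hz' := hz
  rw [mem_seg_iff] at hz'
  have t1 := dist_triangle a z b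
  have e1 : dist v z < dist a z := by linarith [hb.hv]
  have e2 := depth_contract2 hB haz (seg_comm' hw)
  have e3 := ha.hw
  rw [dist_comm a w, dist_comm z v, dist_comm w v, hwd] at e2
  refine ⟨e1, ?_⟩
  rcases le_total (dist a z) δ with h | h
  · rw [abs_of_nonpos (by linarith)] at e2; linarith
  · rw [abs_of_nonneg (by linarith)] at e2; linarith

include hB in
theorem far_g {a b : X} (ha : E0 u v w δ a) (hb : E0 u v w δ b) (hw : w ∈ seg v u)
    (hwd : dist v w = δ) (h : Far u v δ a b) :
    dist u a < dist u b ∧ dist v a + dist u a < dist v b + dist u b := by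
  obtain ⟨hd, z, hz, haz⟩ := h
  have h1 := (far_z hB ha hb hw hwd hd hz haz).2
  rw [mem_seg_iff] at hz haz
  have := dist_triangle u b z
  rw [dist_comm b z] at this
  have := ha.hv
  have := hb.hv
  constructor <;> linarith

include hB in
theorem no_chain {a b c : X} (hD : 2 * δ < dist u v) (hw : w ∈ seg v u)
    (hwd : dist v w = δ)
    (ha : E0 u v w δ a) (hb : E0 u v w δ b) (hc : E0 u v w δ c)
    (hcmp : ∀ x, sg hB φ u v x = sg hB φ u v c →
      Below u v a x ∨ Below u v x a ∨ Cross u v a x ∨ Cross u v x a)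
    (hab : Far u v δ a b) (hbc : Far u v δ b c) : False := by
  obtain ⟨gab, Xab⟩ := far_g hB ha hb hw hwd hab
  have habd := hab.1
  obtain ⟨hd, z2, hz2, hbz2⟩ := hbc
  obtain ⟨hs, -⟩ := far_z hB hb hc hw hwd hd hz2 hbz2
  have n1 : z2 ∉ seg u v := fun h => hb.not1 hB hw hwd (seg_trans hbz2 h)
  have hzD : ∀ z ∈ seg v c, dist u z ≤ dist u v := fun z hz => seg_ball hB hz le_rfl hc.hu
  have nb : ¬ Below u v b a := fun h => by linarith [below_X h]
  have hsub : ∀ z ∈ seg z2 c, z ∈ seg v c := fun z hz =>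
    seg_comm' (seg_trans (seg_comm' hz) (seg_comm' hz2))
  have slide : sg hB φ u v z2 = sg hB φ u v c := by
    refine sg_slide hB φ hz2 n1 ?_ (hc.not2 hD)
    intro z hz hvz
    have h1 := hzD z (hsub z hz)
    have hvz' := hvz
    rw [mem_seg_iff] at hvz'
    have : v = z := dist_le_zero.1 (by linarith)
    subst this
    have hz2' := hz2
    rw [mem_seg_iff] at hz2' hz
    rw [dist_comm z2 v] at hz
    have : v = z2 := dist_le_zero.1 (by linarith)
    apply n1
    rw [← this]
    exact right_mem_seg' _ _
  have hz2v := seg_dist_le hz2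
  have hbz2' := hbz2
  rw [mem_seg_iff] at hbz2'
  have hz2D := hzD z2 hz2
  have hcv := hc.hv
  have hav := ha.hv
  have tva := dist_triangle u a v
  rw [dist_comm a v] at tva
  rcases hcmp z2 slide with h | h | h | h
  · obtain ⟨z', hz', haz'⟩ := h
    have k1 := depth_contract2 hB haz' hbz2
    have k2 := hzD z' (seg_trans hz' hz2)
    have k3 := hz'
    have k4 := haz'
    rw [mem_seg_iff] at k3 k4
    have k5 := dist_triangle u z' v
    rw [dist_comm z' v] at k5
    rcases le_total (dist a z') (dist b z2) with hh | hh
    · rw [abs_of_nonpos (by linarith)] at k1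
      linarith
    · rw [abs_of_nonneg (by linarith)] at k1
      linarith [dist_nonneg (x := v) (y := z')]
  · obtain ⟨y, hy, hzy⟩ := h
    exact nb ⟨y, hy, seg_trans hbz2 hzy⟩
  · obtain ⟨y, hy, hya⟩ := h
    rw [mem_seg_iff] at hy
    have k1 := seg_dist_le hya
    have k2 := dist_triangle u y z2
    linarith [dist_nonneg (x := v) (y := y)]
  · obtain ⟨y, hy, hyz⟩ := h
    rcases seg_total hB hbz2 hyz with h | h
    · exact nb ⟨y, hy, h⟩
    · have : dist b a ≤ 2 * δ := cross_le hb.hu ha.hv ⟨y, hy, h⟩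
      rw [dist_comm] at this
      linarith

include hB φ in
theorem four_sets (S' : Set X) (hD : 2 * δ < dist u v) (hw : w ∈ seg v u)
    (hwd : dist v w = δ) (hS : ∀ a ∈ S', dist u a ≤ dist u v ∧ dist v a ≤ 2 * δ) :
    ∃ M : Fin 4 → Set X, S' ⊆ Metric.closedBall w δ ∪ ⋃ i, M i ∧ (∀ i, M i ⊆ S') ∧
      ∀ i, ∀ a ∈ M i, ∀ b ∈ M i, dist a b ≤ 2 * δ := by
  -- the two sides
  have main : ∀ R : Set X, (∀ a ∈ R, E0 u v w δ a) →
      (∀ a ∈ R, ∀ c ∈ R, sg hB φ u v a + sg hB φ u v c ≠ 0) →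
      ∃ M M' : Set X, R ⊆ M ∪ M' ∧ M ⊆ R ∧ M' ⊆ R ∧ (∀ a ∈ M, ∀ b ∈ M, dist a b ≤ 2 * δ) ∧
        (∀ a ∈ M', ∀ b ∈ M', dist a b ≤ 2 * δ) := by
    intro R hR hs
    have hcmp : ∀ a ∈ R, ∀ c ∈ R, ∀ x, sg hB φ u v x = sg hB φ u v c →
      Below u v a x ∨ Below u v x a ∨ Cross u v a x ∨ Cross u v x a := by
      intro a ha c hc x hx
      by_contra hcon
      push Not at hcon
      obtain ⟨h1, h2, h3, h4⟩ := hcon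
      have := sg_side hB φ h1 h2 h3 h4
      rw [hx] at this
      exact hs a ha c hc this
    have hfar : ∀ a ∈ R, ∀ b ∈ R, 2 * δ < dist a b → Far u v δ a b ∨ Far u v δ b a := by
      intro a ha b hb hd
      have hd' := hd
      rw [dist_comm] at hd'
      rcases hcmp a ha b hb b rfl with h | h | h | h
      · exact Or.inl ⟨hd, h⟩
      · exact Or.inr ⟨hd', h⟩
      · exact absurd (cross_le (hR a ha).hu (hR b hb).hv h) (not_le.2 hd)
      · exact absurd (cross_le (hR b hb).hu (hR a ha).hv h) (not_le.2 hd')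
    refine ⟨{a | a ∈ R ∧ ∀ c ∈ R, ¬ Far u v δ a c}, {a | a ∈ R ∧ ∃ c ∈ R, Far u v δ a c},
      ?_, fun a h => h.1, fun a h => h.1, ?_, ?_⟩
    · intro a ha
      by_cases h : ∃ c ∈ R, Far u v δ a c
      · exact Or.inr ⟨ha, h⟩
      · push Not at h
        exact Or.inl ⟨ha, h⟩
    · rintro a ⟨ha, ha'⟩ b ⟨hb, hb'⟩
      by_contra hcon
      rcases hfar a ha b hb (not_le.1 hcon) with h | h
      · exact ha' b hb h
      · exact hb' a ha h
    · rintro a ⟨ha, c, hc, hac⟩ b ⟨hb, c', hc', hbc⟩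
      by_contra hcon
      rcases hfar a ha b hb (not_le.1 hcon) with h | h
      · exact no_chain hB φ hD hw hwd (hR a ha) (hR b hb) (hR c' hc') (hcmp a ha c' hc') h hbc
      · exact no_chain hB φ hD hw hwd (hR b hb) (hR a ha) (hR c hc) (hcmp b hb c hc) h hac
  obtain ⟨M1, M2, h1, s1, s2, d1, d2⟩ := main
    {a | a ∈ S' ∧ E0 u v w δ a ∧ 0 < (sg hB φ u v a).im} (fun a h => h.2.1) (by
      rintro a ⟨-, -, ha⟩ c ⟨-, -, hc⟩ h0
      have := congrArg Complex.im h0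
      simp at this
      linarith)
  obtain ⟨M3, M4, h3, s3, s4, d3, d4⟩ := main
    {a | a ∈ S' ∧ E0 u v w δ a ∧ (sg hB φ u v a).im < 0} (fun a h => h.2.1) (by
      rintro a ⟨-, -, ha⟩ c ⟨-, -, hc⟩ h0
      have := congrArg Complex.im h0
      simp at this
      linarith)
  refine ⟨![M1, M2, M3, M4], ?_, ?_, ?_⟩
  · intro a ha
    by_cases hw' : dist w a ≤ δ
    · left; rw [mem_closedBall, dist_comm]; exact hw'
    · right
      have hE : E0 u v w δ a := ⟨(hS a ha).1, (hS a ha).2, not_le.1 hw'⟩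
      have := exp_neg_one_im (sg_exp hB φ (hE.not1 hB hw hwd) (hE.not2 hD) (hE.not3 hwd))
      rw [Set.mem_iUnion]
      rcases lt_or_gt_of_ne this with h | h
      · rcases h3 ⟨ha, hE, h⟩ with h | h
        · exact ⟨2, h⟩
        · exact ⟨3, h⟩
      · rcases h1 ⟨ha, hE, h⟩ with h | h
        · exact ⟨0, h⟩
        · exact ⟨1, h⟩
  · intro i
    fin_cases i
    · exact fun a h => (s1 h).1
    · exact fun a h => (s2 h).1
    · exact fun a h => (s3 h).1
    · exact fun a h => (s4 h).1
  · intro i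
    fin_cases i
    · exact d1
    · exact d2
    · exact d3
    · exact d4

end Chains


section Mid

variable {X : Type*} [MetricSpace X] (hB : IsBusemannSpace X) (φ : X ≃ₜ ℂ)

/-- midpoints -/
noncomputable def mid (x y : X) : X := gpt hB x y (1 / 2)

theorem mid_comm (x y : X) : mid hB x y = mid hB y x := by
  rw [mid, mid, gpt_symm]; norm_num

theorem mid_mem (x y : X) : mid hB x y ∈ seg x y := gpt_mem_seg hB _ _ _

theorem dist_mid_left (x y : X) : dist (mid hB x y) x = dist x y / 2 := by
  rw [dist_comm, mid, dist_left_gpt hB x y (by norm_num)]; ring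

theorem dist_mid_right (x y : X) : dist (mid hB x y) y = dist x y / 2 := by
  rw [mid_comm, dist_mid_left, dist_comm]

theorem mid_split {x y z : X} (h : z ∈ seg x y) :
    z ∈ seg x (mid hB x y) ∨ z ∈ seg (mid hB x y) y := by
  rcases seg_total hB h (mid_mem hB x y) with h1 | h1
  · exact Or.inl h1
  · exact Or.inr (seg_trans2 h1 h)

theorem mid_seg {x y z : X} (h : z ∈ seg x y) :
    dist (mid hB x y) z + dist z x ≤ dist x y / 2 ∨
      dist (mid hB x y) z + dist z y ≤ dist x y / 2 := by
  rcases mid_split hB h with h1 | h1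
  · left
    rw [mem_seg_iff, dist_comm x (mid hB x y), dist_mid_left] at h1
    rw [dist_comm _ z, dist_comm z x]; linarith
  · right
    rw [mem_seg_iff, dist_mid_right] at h1
    linarith

theorem mid_seg_le {x y z : X} (h : z ∈ seg x y) : dist (mid hB x y) z ≤ dist x y / 2 := by
  have := dist_nonneg (x := z) (y := x)
  have := dist_nonneg (x := z) (y := y)
  rcases mid_seg hB h with h | h <;> linarith

theorem mid_mid (a b c : X) : dist (mid hB a c) (mid hB a b) ≤ dist b c / 2 := by
  have := gpt_busemann hB a c a b (t := 1 / 2) (by norm_num)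
  rw [dist_self] at this
  rw [mid, mid, dist_comm b c]; linarith

/-- near estimate, crossing case -/
theorem near_cross {o a b q z : X} {e : ℝ} (hz : z ∈ seg a b) (hq : z ∈ seg o q)
    (h1 : dist o q ≤ dist o a + e) (h2 : dist o q ≤ dist o b + e) :
    dist (mid hB a b) q ≤ dist a b / 2 + e := by
  rw [mem_seg_iff] at hq
  have t := dist_triangle (mid hB a b) z q
  rcases mid_seg hB hz with h | h
  · have := dist_triangle o z a; linarith
  · have := dist_triangle o z b; linarith

include hB in
theorem near_cross' {o a b q z : X} {e : ℝ} (hz : z ∈ seg a b) (hq : q ∈ seg o z)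
    (h1 : dist o a ≤ dist o q + e) (h2 : dist o b ≤ dist o q + e) :
    dist z q ≤ e := by
  have h3 := seg_ball hB hz h1 h2
  rw [mem_seg_iff] at hq
  rw [dist_comm]; linarith

/-- all points of `F` are near the midpoint: the case of `b` radially comparable with `[a,x]` -/
theorem near_lim {a b x : X} (hle : dist a x ≤ dist a b)
    (h : ∀ ε > 0, ∃ z ∈ seg a x, dist z b ≤ dist z a + ε ∧ dist z b ≤ dist z x + ε) :
    dist (mid hB a b) x ≤ dist a b / 2 := by
  have hc : Continuous (fun t : ℝ => gpt hB a x t) :=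
    gpt_cont hB continuous_const continuous_const continuous_id
  have hcont : Continuous (fun t : ℝ => dist (gpt hB a x t) b -
      min (dist (gpt hB a x t) a) (dist (gpt hB a x t) x)) := by fun_prop
  obtain ⟨t, ht, hmin⟩ := (isCompact_Icc (a := (0 : ℝ)) (b := 1)).exists_isMinOn
    (by simp) hcont.continuousOn
  set z := gpt hB a x t with hzdef
  have hz : z ∈ seg a x := gpt_mem_seg hB a x t
  have hle0 : dist z b - min (dist z a) (dist z x) ≤ 0 := by
    apply le_of_forall_pos_le_add
    intro ε hε
    obtain ⟨z', hz', h1, h2⟩ := h ε hε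
    obtain ⟨t', ht', rfl⟩ := mem_seg_gpt hB hz'
    have := hmin ht'
    simp only [Set.mem_ofPred_eq] at this
    rw [← hzdef] at this
    have h3 : dist (gpt hB a x t') b - ε ≤
      min (dist (gpt hB a x t') a) (dist (gpt hB a x t') x) :=
      le_min (by linarith) (by linarith)
    linarith
  have h1 : dist z b ≤ dist z a := by linarith [min_le_left (dist z a) (dist z x)]
  have h2 : dist z b ≤ dist z x := by linarith [min_le_right (dist z a) (dist z x)]
  rw [mem_seg_iff] at hz
  have h3 := dist_triangle a z b
  have hzab : z ∈ seg a b := by rw [mem_seg_iff]; linarith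
  have h4 := dist_triangle (mid hB a b) z x
  rcases mid_seg hB hzab with h | h <;> linarith

/-- interior lemma -/
theorem int_lemma {o a b c q z : X} {R : ℝ} (hab : dist a b ≤ 2 * R) (hbc : dist b c ≤ 2 * R)
    (hca : dist c a ≤ 2 * R) (h1 : ∃ y ∈ seg a b, o ∈ seg c y) (h2 : ∃ y ∈ seg b c, o ∈ seg a y)
    (h3 : ∃ y ∈ seg c a, o ∈ seg b y) (hz : z ∈ seg a b) (hq : q ∈ seg o z) :
    dist (mid hB a b) q ≤ R ∨ dist (mid hB b c) q ≤ R ∨ dist (mid hB c a) q ≤ R := by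
  have cov : ∀ a b c : X, dist a b ≤ 2 * R → dist b c ≤ 2 * R → dist c a ≤ 2 * R →
      ∀ y ∈ seg a b, dist (mid hB c a) y ≤ R ∨ dist (mid hB b c) y ≤ R := by
    intro a b c hab hbc hca y hy
    rcases mid_split hB hy with h | h
    · left
      refine seg_ball hB h ?_ ?_
      · rw [dist_mid_right]; linarith
      · rw [mid_comm hB c a]
        exact (mid_mid hB a b c).trans (by linarith)
    · right
      refine seg_ball hB h ?_ ?_
      · rw [mid_comm hB a b]
        exact (mid_mid hB b a c).trans (by rw [dist_comm a c]; linarith)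
      · rw [dist_mid_left]; linarith
  have cone : ∀ a b c : X, dist a b ≤ 2 * R → dist b c ≤ 2 * R → dist c a ≤ 2 * R →
      (∃ y ∈ seg a b, o ∈ seg c y) → dist (mid hB c a) o ≤ R ∨ dist (mid hB b c) o ≤ R := by
    rintro a b c hab hbc hca ⟨y, hy, ho⟩
    rcases cov a b c hab hbc hca y hy with h | h
    · left
      exact seg_ball hB ho (by rw [dist_mid_left]; linarith) h
    · right
      exact seg_ball hB ho (by rw [dist_mid_right]; linarith) h
  by_cases hoab : dist (mid hB a b) o ≤ R
  · left
    exact seg_ball hB hq hoab ((mid_seg_le hB hz).trans (by linarith))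
  · right
    have k2 := (cone b c a hbc hca hab h2).resolve_left hoab
    have k3 := (cone c a b hca hab hbc h3).resolve_right hoab
    rcases cov a b c hab hbc hca z hz with h | h
    · exact Or.inr (seg_ball hB hq k2 h)
    · exact Or.inl (seg_ball hB hq k3 h)

end Mid


section ThreeBalls

variable {X : Type*} [MetricSpace X] (hB : IsBusemannSpace X) (φ : X ≃ₜ ℂ)

include φ in
theorem caseA (P : Finset X) (a b : X) (ha : a ∈ P) (hb : b ∈ P)
    (h : ∀ ε > 0, ∃ o : X, ∀ q ∈ P, dist o q ≤ dist a b / 2 + ε) :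
    ∀ q ∈ P, dist (mid hB a b) q ≤ dist a b / 2 := by
  intro q hq
  by_contra hcon
  push Not at hcon
  set m := mid hB a b with hm
  set R := dist a b / 2 with hR
  have : LocallyCompactSpace X := φ.isClosedEmbedding.locallyCompactSpace
  obtain ⟨η0, hη0, hcomp⟩ := exists_isCompact_closedBall m
  set η := min η0 ((dist m q - R) / 2) with hη
  have hηpos : 0 < η := lt_min hη0 (by linarith)
  have hK : IsCompact (sphere m η) :=
    hcomp.of_isClosed_subset isClosed_sphere
      ((sphere_subset_closedBall).trans (closedBall_subset_closedBall (min_le_left _ _)))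
  have hη2 : η ≤ (dist m q - R) / 2 := min_le_right _ _
  -- a point of the sphere obtained by moving towards `o`
  have key : ∀ ε > 0, ε ≤ η → ∃ x ∈ sphere m η, dist a x ≤ R + ε ∧ dist b x ≤ R + ε := by
    intro ε hε hεη
    obtain ⟨o, ho⟩ := h ε hε
    have h1 := ho q hq
    have h2 := dist_triangle m o q
    obtain ⟨x, hx, hd⟩ := seg_exists hB m o hηpos.le (by linarith)
    refine ⟨x, by rw [mem_sphere, dist_comm]; exact hd, ?_, ?_⟩
    · refine seg_ball hB hx ?_ (by rw [dist_comm]; exact ho a ha)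
      rw [dist_comm, hm, dist_mid_left]; linarith
    · refine seg_ball hB hx ?_ (by rw [dist_comm]; exact ho b hb)
      rw [dist_comm, hm, dist_mid_right]; linarith
  obtain ⟨x0, hx0, -⟩ := key η hηpos le_rfl
  have hcont : Continuous (fun x => max (dist a x) (dist b x)) := by fun_prop
  obtain ⟨x, hx, hmin⟩ := hK.exists_isMinOn ⟨x0, hx0⟩ hcont.continuousOn
  have hle : max (dist a x) (dist b x) ≤ R := by
    apply le_of_forall_pos_le_add
    intro ε hε
    obtain ⟨y, hy, h1, h2⟩ := key (min ε η) (lt_min hε hηpos) (min_le_right _ _)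
    have h3 := hmin hy
    simp only [Set.mem_ofPred_eq] at h3
    exact h3.trans (max_le (h1.trans (by linarith [min_le_left ε η]))
      (h2.trans (by linarith [min_le_left ε η])))
  have h1 := (le_max_left _ _).trans hle
  have h2 := (le_max_right _ _).trans hle
  have h3 := dist_triangle a x b
  rw [dist_comm x b] at h3
  have hxs : x ∈ seg a b := by rw [mem_seg_iff, dist_comm x b]; linarith
  have : x = m := seg_unique hB hxs (mid_mem hB a b) (by
    rw [dist_comm a (mid hB a b), dist_mid_left]; linarith)
  rw [this, mem_sphere, dist_self] at hx
  linarith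

open Filter Topology in
theorem move_lemma (P : Finset X) (ω : Filter X) [ω.NeBot] (ρ : X → ℝ)
    (hρ : ∀ q ∈ P, Tendsto (fun o => dist o q) ω (𝓝 (ρ q))) (rs R : ℝ) (hRr : R < rs)
    (hle : ∀ q ∈ P, ρ q ≤ rs) (hrs : ∀ o : X, ∃ q ∈ P, rs ≤ dist o q)
    (m : X) (hm : ∀ q ∈ P, ρ q = rs → dist m q ≤ R) (hB : IsBusemannSpace X) : False := by
  have h1 : ∀ q ∈ P, ∀ᶠ t in 𝓝[>] (0 : ℝ), (1 - t) * ρ q + t * dist m q < rs := by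
    intro q hq
    rcases (hle q hq).eq_or_lt with h | h
    · filter_upwards [self_mem_nhdsWithin] with t ht
      have := hm q hq h
      rw [h]
      have ht' : 0 < t := ht
      nlinarith
    · have hc : Continuous (fun t : ℝ => (1 - t) * ρ q + t * dist m q) := by fun_prop
      have := hc.tendsto 0
      simp only [sub_zero, one_mul, zero_mul, add_zero] at this
      exact (this.mono_left nhdsWithin_le_nhds).eventually (gt_mem_nhds h)
  have h2 := (Filter.eventually_all_finset P).2 h1
  have h3 : ∀ᶠ t in 𝓝[>] (0 : ℝ), t < 1 :=
    (nhdsWithin_le_nhds) (gt_mem_nhds (by norm_num))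
  have h4 : ∀ᶠ t in 𝓝[>] (0 : ℝ), 0 < t := self_mem_nhdsWithin
  obtain ⟨t, ht, ht1, ht0⟩ := (h2.and (h3.and h4)).exists
  have h5 : ∀ q ∈ P, ∀ᶠ o in ω, (1 - t) * dist o q + t * dist m q < rs := by
    intro q hq
    exact (((hρ q hq).const_mul (1 - t)).add_const (t * dist m q)).eventually
      (gt_mem_nhds (ht q hq))
  obtain ⟨o, ho⟩ := ((Filter.eventually_all_finset P).2 h5).exists
  obtain ⟨q, hq, hqr⟩ := hrs (gpt hB o m t)
  have := dist_gpt_le hB q o m ⟨ht0.le, ht1.le⟩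
  rw [dist_comm q, dist_comm q o, dist_comm q m] at this
  linarith [ho q hq]

open Filter Topology in
include φ in
theorem caseB (P : Finset X) (ω : Ultrafilter X) (ρ : X → ℝ)
    (hρ : ∀ q ∈ P, Tendsto (fun o => dist o q) ω (𝓝 (ρ q))) (rs R : ℝ) (hRr : R < rs)
    (hR : ∀ p ∈ P, ∀ q ∈ P, dist p q ≤ 2 * R)
    (hle : ∀ q ∈ P, ρ q ≤ rs) (hrs : ∀ o : X, ∃ q ∈ P, rs ≤ dist o q) :
    ∃ a ∈ P, ∃ b ∈ P, ∃ c ∈ P, ∀ q ∈ P, dist (mid hB a b) q ≤ R ∨ dist (mid hB b c) q ≤ R ∨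
      dist (mid hB c a) q ≤ R := by
  classical
  set F := P.filter (fun q => ρ q = rs) with hF
  have hFP : ∀ x ∈ F, x ∈ P := fun x hx => (Finset.mem_filter.1 hx).1
  have hFr : ∀ x ∈ F, ρ x = rs := fun x hx => (Finset.mem_filter.1 hx).2
  have hmv : ∀ m, (∀ x ∈ F, dist m x ≤ R) → False := fun m hm =>
    move_lemma P (ω : Filter X) ρ hρ rs R hRr hle hrs m
      (fun q hq h => hm q (Finset.mem_filter.2 ⟨hq, h⟩)) hB
  -- the set `F` is nonempty
  have hFne : F.Nonempty := by
    by_contra h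
    rw [Finset.not_nonempty_iff_eq_empty] at h
    obtain ⟨o, -⟩ := ω.nonempty_of_mem Filter.univ_mem
    exact hmv o (by rw [h]; simp)
  have hFlim : ∀ x ∈ F, Tendsto (fun o => dist o x) ω (𝓝 rs) := fun x hx => by
    have := hρ x (hFP x hx)
    rwa [hFr x hx] at this
  -- comparison of distances
  have hcomp : ∀ q ∈ P, ∀ x ∈ F, ∀ ε > 0, ∀ᶠ o in (ω : Filter X), dist o q ≤ dist o x + ε := by
    intro q hq x hx ε hε
    have h1 := (hρ q hq).eventually (gt_mem_nhds (show ρ q < rs + ε / 2 by linarith [hle q hq]))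
    have h2 := (hFlim x hx).eventually (lt_mem_nhds (show rs - ε / 2 < rs by linarith))
    filter_upwards [h1, h2] with o h1 h2
    linarith
  have hout : ∀ x ∈ F, ∀ y ∈ F, ∀ᶠ o in (ω : Filter X), o ∉ seg x y := by
    intro x hx y hy
    have h1 := (hFlim x hx).eventually (lt_mem_nhds hRr)
    have h2 := (hFlim y hy).eventually (lt_mem_nhds hRr)
    filter_upwards [h1, h2] with o h1 h2 h3
    rw [mem_seg_iff, dist_comm x o] at h3
    linarith [hR x (hFP x hx) y (hFP y hy)]
  obtain ⟨⟨a, b⟩, hab, hmax⟩ := (F ×ˢ F).exists_max_image (fun p => dist p.1 p.2)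
    (hFne.product hFne)
  rw [Finset.mem_product] at hab
  obtain ⟨ha, hb⟩ := hab
  simp only at ha hb hmax
  have hmax' : ∀ x ∈ F, ∀ y ∈ F, dist x y ≤ dist a b := fun x hx y hy =>
    hmax (x, y) (Finset.mem_product.2 ⟨hx, hy⟩)
  have habR := hR a (hFP a ha) b (hFP b hb)
  -- wr-points
  have hwr : ∀ x ∈ F, ∀ y ∈ F, ∀ w ∈ F, (∀ᶠ o in (ω : Filter X), Wr o x y w) →
      ∀ ε > 0, ∃ z ∈ seg x y, dist z w ≤ dist z x + ε ∧ dist z w ≤ dist z y + ε := by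
    intro x hx y hy w hw h ε hε
    obtain ⟨o, ⟨z, hz, ho⟩, h1, h2, h3, h4⟩ := (h.and ((hcomp w (hFP w hw) x hx ε hε).and
      ((hcomp w (hFP w hw) y hy ε hε).and ((hcomp x (hFP x hx) w hw ε hε).and
      (hcomp y (hFP y hy) w hw ε hε))))).exists
    refine ⟨z, hz, ?_⟩
    rcases ho with ho | ho
    · rw [mem_seg_iff] at ho
      have t1 := dist_triangle o z x
      have t2 := dist_triangle o z y
      constructor <;> linarith
    · have := near_cross' hB hz ho h3 h4
      constructor
      · linarith [dist_nonneg (x := z) (y := x)]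
      · linarith [dist_nonneg (x := z) (y := y)]
  have hex : ∃ c ∈ F, ∀ᶠ o in (ω : Filter X), tau hB φ o a b c ≠ 0 := by
    by_contra hcon
    push Not at hcon
    apply hmv (mid hB a b)
    intro x hx
    have h0 : ∀ᶠ o in (ω : Filter X), tau hB φ o a b x = 0 := hcon x hx
    have h1 : ∀ᶠ o in (ω : Filter X), Wr o a b x ∨ Wr o b x a ∨ Wr o x a b :=
      h0.mono (fun o h => tau_rad hB φ h)
    rw [Ultrafilter.eventually_or, Ultrafilter.eventually_or] at h1
    have goal : dist (mid hB a b) x ≤ dist a b / 2 := by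
      rcases h1 with h1 | h1 | h1
      · apply le_of_forall_pos_le_add
        intro ε hε
        obtain ⟨z, hz, h2, h3⟩ := hwr a ha b hb x hx h1 ε hε
        have t := dist_triangle (mid hB a b) z x
        rcases mid_seg hB hz with h | h <;> linarith
      · rw [mid_comm, dist_comm a b]
        refine near_lim hB (by rw [dist_comm b a]; exact hmax' b hb x hx) ?_
        exact hwr b hb x hx a ha h1
      · refine near_lim hB (hmax' a ha x hx) ?_
        intro ε hε
        obtain ⟨z, hz, h2, h3⟩ := hwr x hx a ha b hb h1 ε hε
        exact ⟨z, seg_comm' hz, h3, h2⟩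
    linarith
  obtain ⟨c, hc, htau⟩ := hex
  refine ⟨a, hFP a ha, b, hFP b hb, c, hFP c hc, ?_⟩
  intro q hq
  have hbcR := hR b (hFP b hb) c (hFP c hc)
  have hcaR := hR c (hFP c hc) a (hFP a ha)
  -- the crossing case
  have hcr : ∀ x ∈ F, ∀ y ∈ F, (∀ᶠ o in (ω : Filter X), ∃ z ∈ seg x y, z ∈ seg o q) →
      dist (mid hB x y) q ≤ R := by
    intro x hx y hy h
    apply le_of_forall_pos_le_add
    intro ε hε
    obtain ⟨o, ⟨z, hz, ho⟩, h1, h2⟩ := (h.and ((hcomp q hq x hx ε hε).and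
      (hcomp q hq y hy ε hε))).exists
    have := near_cross hB hz ho h1 h2
    linarith [hR x (hFP x hx) y (hFP y hy)]
  have hall : ∀ᶠ o in (ω : Filter X),
      ((∃ z ∈ seg a b, z ∈ seg o q) ∨ (∃ z ∈ seg b c, z ∈ seg o q) ∨
        (∃ z ∈ seg c a, z ∈ seg o q)) ∨
      (dist (mid hB a b) q ≤ R ∨ dist (mid hB b c) q ≤ R ∨ dist (mid hB c a) q ≤ R) := by
    filter_upwards [htau, hout a ha b hb, hout b hb c hc, hout c hc a ha] with o ht n1 n2 n3
    have i1 : ∃ y ∈ seg a b, o ∈ seg c y := tau_in hB φ ht n2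
    have i2 : ∃ y ∈ seg b c, o ∈ seg a y :=
      tau_in hB φ (by rw [tau_cyc]; exact ht) n3
    have i3 : ∃ y ∈ seg c a, o ∈ seg b y :=
      tau_in hB φ (by rw [tau_cyc, tau_cyc]; exact ht) n1
    rcases tau_sur hB φ ht q with ⟨z, hz, h | h⟩ | ⟨z, hz, h | h⟩ | ⟨z, hz, h | h⟩
    · exact Or.inl (Or.inl ⟨z, hz, h⟩)
    · exact Or.inr (int_lemma hB habR hbcR hcaR i1 i2 i3 hz h)
    · exact Or.inl (Or.inr (Or.inl ⟨z, hz, h⟩))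
    · rcases int_lemma hB hbcR hcaR habR i2 i3 i1 hz h with h | h | h
      · exact Or.inr (Or.inr (Or.inl h))
      · exact Or.inr (Or.inr (Or.inr h))
      · exact Or.inr (Or.inl h)
    · exact Or.inl (Or.inr (Or.inr ⟨z, hz, h⟩))
    · rcases int_lemma hB hcaR habR hbcR i3 i1 i2 hz h with h | h | h
      · exact Or.inr (Or.inr (Or.inr h))
      · exact Or.inr (Or.inl h)
      · exact Or.inr (Or.inr (Or.inl h))
  rw [Ultrafilter.eventually_or, Ultrafilter.eventually_or, Ultrafilter.eventually_or] at hall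
  rcases hall with (h | h | h) | h
  · exact Or.inl (hcr a ha b hb h)
  · exact Or.inr (Or.inl (hcr b hb c hc h))
  · exact Or.inr (Or.inr (hcr c hc a ha h))
  · exact h.exists.choose_spec

open Filter Topology in
include φ in
theorem three_balls_finite (P : Finset X) (hne : P.Nonempty) (R : ℝ)
    (hR : ∀ p ∈ P, ∀ q ∈ P, dist p q ≤ 2 * R) :
    ∃ a ∈ P, ∃ b ∈ P, ∃ c ∈ P, ∀ q ∈ P, dist (mid hB a b) q ≤ R ∨ dist (mid hB b c) q ≤ R ∨
      dist (mid hB c a) q ≤ R := by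
  classical
  obtain ⟨⟨a, b⟩, hab, hmax⟩ := (P ×ˢ P).exists_max_image (fun p => dist p.1 p.2)
    (hne.product hne)
  rw [Finset.mem_product] at hab
  obtain ⟨ha, hb⟩ := hab
  simp only at ha hb hmax
  have hmax' : ∀ x ∈ P, ∀ y ∈ P, dist x y ≤ 2 * (dist a b / 2) := fun x hx y hy => by
    have := hmax (x, y) (Finset.mem_product.2 ⟨hx, hy⟩)
    simp only at this
    linarith
  have hR0 : dist a b / 2 ≤ R := by linarith [hR a ha b hb]
  set r : X → ℝ := fun o => P.sup' hne (fun q => dist o q) with hr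
  have hrle : ∀ o, ∀ q ∈ P, dist o q ≤ r o := fun o q hq =>
    Finset.le_sup' (fun q => dist o q) hq
  have hrex : ∀ o, ∃ q ∈ P, r o = dist o q := fun o => by
    obtain ⟨q, hq, h⟩ := Finset.exists_mem_eq_sup' hne (fun q => dist o q)
    exact ⟨q, hq, h⟩
  have hbdd : BddBelow (Set.range r) := ⟨0, by
    rintro _ ⟨o, rfl⟩
    obtain ⟨q, -, h⟩ := hrex o
    rw [h]; exact dist_nonneg⟩
  have : Nonempty X := ⟨a⟩
  set rs := ⨅ o, r o with hrs
  have hrsle : ∀ o, rs ≤ r o := fun o => ciInf_le hbdd o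
  have happ : ∀ c, rs < c → ∃ o, r o < c := fun c hc => exists_lt_of_ciInf_lt hc
  rcases le_or_gt rs (dist a b / 2) with h | h
  · refine ⟨a, ha, b, hb, a, ha, fun q hq => Or.inl ?_⟩
    refine (caseA hB φ P a b ha hb ?_ q hq).trans hR0
    intro ε hε
    obtain ⟨o, ho⟩ := happ (dist a b / 2 + ε) (by linarith)
    exact ⟨o, fun q hq => (hrle o q hq).trans ho.le⟩
  · -- minimizing ultrafilter
    have hnb : (comap r (𝓝 rs)).NeBot := by
      rw [comap_neBot_iff]
      intro t ht
      obtain ⟨c, hc, hsub⟩ := exists_Ico_subset_of_mem_nhds ht ⟨rs + 1, by linarith⟩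
      obtain ⟨o, ho⟩ := happ c hc
      exact ⟨o, hsub ⟨hrsle o, ho⟩⟩
    set ω : Ultrafilter X := Ultrafilter.of (comap r (𝓝 rs)) with hω
    have hωr : Tendsto r ω (𝓝 rs) := tendsto_comap.mono_left (Ultrafilter.of_le _)
    have hev : ∀ᶠ o in (ω : Filter X), r o < rs + 1 :=
      hωr.eventually (gt_mem_nhds (by linarith))
    have hlim : ∀ q, ∃ l, q ∈ P → Tendsto (fun o => dist o q) ω (𝓝 l) := by
      intro q
      by_cases hq : q ∈ P
      · have hmem : Set.Icc (0 : ℝ) (rs + 1) ∈ ω.map (fun o => dist o q) := by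
          rw [Ultrafilter.mem_map]
          filter_upwards [hev] with o ho
          exact ⟨dist_nonneg, (hrle o q hq).trans ho.le⟩
        obtain ⟨l, -, hl⟩ := isCompact_Icc.ultrafilter_le_nhds' _ hmem
        exact ⟨l, fun _ => hl⟩
      · exact ⟨0, fun h => absurd h hq⟩
    choose ρ hρ using hlim
    obtain ⟨a', ha', b', hb', c', hc', hfin⟩ := caseB hB φ P ω ρ (fun q hq => hρ q hq) rs
      (dist a b / 2) h hmax'
      (fun q hq => le_of_tendsto_of_tendsto (hρ q hq) hωr
        (Eventually.of_forall (fun o => hrle o q hq)))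
      (fun o => by
        obtain ⟨q, hq, h⟩ := hrex o
        exact ⟨q, hq, h ▸ hrsle o⟩)
    refine ⟨a', ha', b', hb', c', hc', fun q hq => ?_⟩
    rcases hfin q hq with h | h | h
    · exact Or.inl (h.trans hR0)
    · exact Or.inr (Or.inl (h.trans hR0))
    · exact Or.inr (Or.inr (h.trans hR0))

include hB φ in
theorem three_balls (K M : Set X) (hK : IsCompact K) (hKne : K.Nonempty) (hMK : M ⊆ K) (R : ℝ)
    (hR : ∀ p ∈ M, ∀ q ∈ M, dist p q ≤ 2 * R) :
    ∃ c : Fin 3 → X, M ⊆ ⋃ i, closedBall (c i) R := by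
  classical
  have hmc : Continuous (fun p : X × X => mid hB p.1 p.2) :=
    gpt_cont hB continuous_fst continuous_snd continuous_const
  set T : M → Set (X × X × X) := fun q => {p | dist (mid hB p.1 p.2.1) q ≤ R ∨
    dist (mid hB p.2.1 p.2.2) q ≤ R ∨ dist (mid hB p.2.2 p.1) q ≤ R} with hT
  have hclosed : ∀ q, IsClosed (T q) := by
    intro q
    have c1 : Continuous (fun p : X × X × X => dist (mid hB p.1 p.2.1) q) :=
      (hmc.comp (continuous_fst.prodMk (continuous_fst.comp continuous_snd))).dist continuous_const
    have c2 : Continuous (fun p : X × X × X => dist (mid hB p.2.1 p.2.2) q) :=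
      (hmc.comp continuous_snd).dist continuous_const
    have c3 : Continuous (fun p : X × X × X => dist (mid hB p.2.2 p.1) q) :=
      (hmc.comp ((continuous_snd.comp continuous_snd).prodMk continuous_fst)).dist continuous_const
    exact (isClosed_le c1 continuous_const).union ((isClosed_le c2 continuous_const).union
      (isClosed_le c3 continuous_const))
  obtain ⟨p, -, hp⟩ := (hK.prod (hK.prod hK)).inter_iInter_nonempty T hclosed (by
    intro U
    rcases U.eq_empty_or_nonempty with rfl | hU
    · obtain ⟨k, hk⟩ := hKne
      exact ⟨(k, k, k), ⟨hk, hk, hk⟩, by simp⟩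
    · obtain ⟨a, ha, b, hb, c, hc, h⟩ := three_balls_finite hB φ (U.image Subtype.val)
        (hU.image _) R (by
          intro p hp q hq
          obtain ⟨p, -, rfl⟩ := Finset.mem_image.1 hp
          obtain ⟨q, -, rfl⟩ := Finset.mem_image.1 hq
          exact hR _ p.2 _ q.2)
      have hmem : ∀ x ∈ U.image Subtype.val, x ∈ K := by
        intro x hx
        obtain ⟨p, -, rfl⟩ := Finset.mem_image.1 hx
        exact hMK p.2
      refine ⟨(a, b, c), ⟨hmem a ha, hmem b hb, hmem c hc⟩, ?_⟩
      simp only [Set.mem_iInter]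
      intro q hq
      exact h q (Finset.mem_image_of_mem _ hq))
  refine ⟨![mid hB p.1 p.2.1, mid hB p.2.1 p.2.2, mid hB p.2.2 p.1], ?_⟩
  intro q hq
  have := Set.mem_iInter.1 hp ⟨q, hq⟩
  rw [Set.mem_iUnion]
  simp only [mem_closedBall]
  rcases this with h | h | h
  · exact ⟨0, by rw [dist_comm]; exact h⟩
  · exact ⟨1, by rw [dist_comm]; exact h⟩
  · exact ⟨2, by rw [dist_comm]; exact h⟩

end ThreeBalls


section Final

theorem covNum_le_of_range {X : Type*} [MetricSpace X] {ι : Type*} [Fintype ι] (δ : ℝ) (A : Set X)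
    (c : ι → X) (h : A ⊆ ⋃ i, closedBall (c i) δ) : covNum δ A ≤ Fintype.card ι := by
  have h1 : covNum δ A ≤ (Set.range c).encard := by
    refine sInf_le ⟨Set.range c, rfl, ?_⟩
    simpa using h
  refine h1.trans ?_
  rw [← Set.image_univ]
  refine (Set.encard_image_le _ _).trans ?_
  rw [Set.encard_univ, ENat.card_eq_coe_fintype_card]

end Final

/-- for a diametral pair `u,v` of a compact set `S` on a Busemann
surface, `B_{2δ}(v) ∩ S` is covered by 19 balls of radius `δ`. -/
theorem covNum_ball_inter_le_nineteen {X : Type*} [MetricSpace X]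
    (hX : IsBusemannSurface X) (δ : ℝ) (hδ : 0 < δ) (S : Set X)
    (hS : IsCompact S) (hne : S.Nonempty) (u v : X) (hu : u ∈ S) (hv : v ∈ S)
    (hdiam : dist u v = Metric.diam S) :
    covNum δ (Metric.closedBall v (2 * δ) ∩ S) ≤ 19 := by
  obtain ⟨hB, ⟨ψ⟩⟩ := hX
  let φ : X ≃ₜ ℂ := ψ.trans Complex.orthonormalBasisOneI.repr.symm.toHomeomorph
  have hd : ∀ x ∈ S, ∀ y ∈ S, dist x y ≤ dist u v := fun x hx y hy =>
    hdiam ▸ Metric.dist_le_diam_of_mem hS.isBounded hx hy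
  rcases le_or_gt (dist u v) (2 * δ) with hD | hD
  · obtain ⟨c, hc⟩ := three_balls hB φ S (closedBall v (2 * δ) ∩ S) hS hne inter_subset_right δ
      (fun p hp q hq => (hd p hp.2 q hq.2).trans hD)
    refine (covNum_le_of_range δ _ c hc).trans ?_
    rw [Fintype.card_fin]
    norm_num
  · obtain ⟨w, hw, hwd⟩ := seg_exists hB v u hδ.le (by rw [dist_comm v u]; linarith)
    obtain ⟨M, hM, hMS, hMd⟩ := four_sets hB φ (closedBall v (2 * δ) ∩ S) hD hw hwd (by
      rintro a ⟨h1, h2⟩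
      refine ⟨hd u hu a h2, ?_⟩
      rw [dist_comm]; exact h1)
    choose c hc using fun i => three_balls hB φ S (M i) hS hne
      ((hMS i).trans inter_subset_right) δ (hMd i)
    refine (covNum_le_of_range (ι := Option (Fin 4 × Fin 3)) δ _
      (fun o => o.elim w (fun p => c p.1 p.2)) ?_).trans ?_
    · intro a ha
      rw [Set.mem_iUnion]
      rcases hM ha with h | h
      · exact ⟨none, h⟩
      · obtain ⟨i, hi⟩ := Set.mem_iUnion.1 h
        obtain ⟨j, hj⟩ := Set.mem_iUnion.1 (hc i hi)
        exact ⟨some (i, j), hj⟩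
    · simp only [Fintype.card_option, Fintype.card_prod, Fintype.card_fin]
      norm_num
end

section
/- Let (𝒮,d) be a Busemann surface, let x,y,z ∈ 𝒮, and let t ∈ [y,z]. Then the triangle Δ(x,y,z) is divided into the two triangles Δ(x,y,t) and Δ(x,t,z): namely, Δ(x,y,z) = Δ(x,y,t) ∪ Δ(x,t,z) and Δ(x,y,t) ∩ Δ(x,t,z) = [x,t]. -/
open Metric Set

namespace TriCev

open Topology unitInterval

variable {X : Type*} [MetricSpace X]

lemma mem_seg {x y z : X} : z ∈ seg x y ↔ dist x z + dist z y = dist x y := Iff.rfl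

lemma seg_comm (x y : X) : seg x y = seg y x := by
  ext z
  simp only [mem_seg, dist_comm y z, dist_comm z x, dist_comm y x]
  constructor <;> intro h <;> linarith

lemma left_mem (x y : X) : x ∈ seg x y := by simp [mem_seg]
lemma right_mem (x y : X) : y ∈ seg x y := by simp [mem_seg]

lemma seg_self {x z : X} (h : z ∈ seg x x) : z = x := by
  rw [mem_seg, dist_comm z x, dist_self] at h
  have := dist_nonneg (x := x) (y := z)
  exact (dist_eq_zero.1 (by linarith)).symm

/-- order `x, v, u, y` : first conclusion. -/
lemma seg_trans {x y u v : X} (hu : u ∈ seg x y) (hv : v ∈ seg x u) : v ∈ seg x y := by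
  rw [mem_seg] at *
  have h1 := dist_triangle x v y
  have h2 := dist_triangle v u y
  linarith

lemma seg_trans' {x y u v : X} (hu : u ∈ seg x y) (hv : v ∈ seg x u) : u ∈ seg v y := by
  rw [mem_seg] at *
  have h1 := dist_triangle x v y
  have h2 := dist_triangle v u y
  linarith

lemma seg_transr {x y u v : X} (hu : u ∈ seg x y) (hv : v ∈ seg u y) : v ∈ seg x y := by
  rw [seg_comm] at *; exact seg_trans hu hv

lemma seg_transr' {x y u v : X} (hu : u ∈ seg x y) (hv : v ∈ seg u y) : u ∈ seg x v := by
  rw [seg_comm] at *; exact seg_trans' hu hv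

lemma geod_trans {x z y : X} (hz : z ∈ seg x y) {α β : ℝ → X}
    (hα : IsGeodesicMap α (dist x z)) (α0 : α 0 = x) (α1 : α (dist x z) = z)
    (hβ : IsGeodesicMap β (dist z y)) (β0 : β 0 = z) (β1 : β (dist z y) = y) :
    IsGeodesicMap (fun s => if s ≤ dist x z then α s else β (s - dist x z)) (dist x y) := by
  rw [mem_seg] at hz
  set l := dist x z with hl
  set m := dist z y with hm
  have l0 : 0 ≤ l := dist_nonneg
  have m0 : 0 ≤ m := dist_nonneg
  have key : ∀ s t, 0 ≤ s → s ≤ l → l < t → t ≤ dist x y → dist (α s) (β (t - l)) = t - s := by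
    intro s t hs hsl hlt ht
    have e1 := hα 0 ⟨le_rfl, l0⟩ s ⟨hs, hsl⟩
    have e2 := hα s ⟨hs, hsl⟩ l ⟨l0, le_rfl⟩
    have e3 := hβ 0 ⟨le_rfl, m0⟩ (t - l) ⟨by linarith, by linarith⟩
    have e4 := hβ (t - l) ⟨by linarith, by linarith⟩ m ⟨m0, le_rfl⟩
    rw [α0, abs_of_nonpos (by linarith)] at e1
    rw [α1, abs_of_nonpos (by linarith)] at e2
    rw [β0, abs_of_nonpos (by linarith)] at e3
    rw [β1, abs_of_nonpos (by linarith)] at e4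
    have t1 := dist_triangle (α s) z (β (t - l))
    have t2 := dist_triangle4 x (α s) (β (t - l)) y
    apply le_antisymm <;> linarith
  intro s hs t ht
  have := hs.1; have := hs.2; have := ht.1; have := ht.2
  by_cases h1 : s ≤ l <;> by_cases h2 : t ≤ l
  · simp only [h1, h2, if_true]; exact hα s ⟨hs.1, h1⟩ t ⟨ht.1, h2⟩
  · simp only [h1, h2, if_true, if_false]
    push Not at h2
    rw [key s t hs.1 h1 h2 ht.2, abs_of_nonpos (by linarith)]; ring
  · simp only [h1, h2, if_true, if_false]
    push Not at h1
    rw [dist_comm, key t s ht.1 h2 h1 hs.2, abs_of_nonneg (by linarith)]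
  · simp only [h1, h2, if_false]
    push Not at h1 h2
    rw [hβ (s - l) ⟨by linarith, by linarith⟩ (t - l) ⟨by linarith, by linarith⟩]
    congr 1; ring

/-- Continuous geodesic parametrization and uniqueness. -/
structure Geo (X : Type*) [MetricSpace X] where
  P : X → X → I → X
  cont : Continuous (fun q : X × X × I => P q.1 q.2.1 q.2.2)
  zero : ∀ x y, P x y 0 = x
  one : ∀ x y, P x y 1 = y
  mem : ∀ x y s, P x y s ∈ seg x y
  surj : ∀ x y, ∀ z ∈ seg x y, ∃ s, P x y s = z
  uniq : ∀ x y : X, ∀ u ∈ seg x y, ∀ v ∈ seg x y, dist x u = dist x v → u = v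

lemma exists_geo (hB : IsBusemannSpace X) : Nonempty (Geo X) := by
  obtain ⟨hG, hB⟩ := hB
  choose γ hγ γ0 γ1 using hG
  let P : X → X → I → X := fun x y s => γ x y (s * dist x y)
  have hin : ∀ (x y : X) (s : I), (s : ℝ) * dist x y ∈ Set.Icc 0 (dist x y) := fun x y s =>
    ⟨mul_nonneg s.2.1 dist_nonneg, mul_le_of_le_one_left dist_nonneg s.2.2⟩
  have dl : ∀ x y s, dist x (P x y s) = s * dist x y := by
    intro x y s
    have := hγ x y 0 ⟨le_rfl, dist_nonneg⟩ _ (hin x y s)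
    rw [γ0, zero_sub, abs_neg, abs_of_nonneg (hin x y s).1] at this
    exact this
  have dr : ∀ x y s, dist (P x y s) y = dist x y - s * dist x y := by
    intro x y s
    have := hγ x y _ (hin x y s) _ ⟨dist_nonneg, le_rfl⟩
    rw [γ1, abs_of_nonpos (by linarith [(hin x y s).2])] at this
    rw [this]; ring
  have hmem : ∀ x y s, P x y s ∈ seg x y := by
    intro x y s; rw [mem_seg, dl, dr]; ring
  have huniq : ∀ x y : X, ∀ u ∈ seg x y, u = γ x y (dist x u) := by
    intro x y u hu
    have hg := geod_trans hu (hγ x u) (γ0 x u) (γ1 x u) (hγ u y) (γ0 u y) (γ1 u y)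
    rcases eq_or_lt_of_le (dist_nonneg (x := x) (y := y)) with h0 | h0
    · have : x = y := dist_eq_zero.1 h0.symm
      subst this
      rw [seg_self hu, dist_self, γ0]
    have hule : dist x u ≤ dist x y := by
      have := mem_seg.1 hu; linarith [dist_nonneg (x := u) (y := y)]
    have := hB _ _ _ _ dist_nonneg dist_nonneg hg (hγ x y) (dist x u / dist x y)
      ⟨by positivity, (div_le_one h0).2 hule⟩
    rw [div_mul_cancel₀ _ h0.ne'] at this
    simp only [le_refl, if_true, γ1, γ0, dist_nonneg, dist_self] at this
    have e : (if dist x y ≤ dist x u then γ x u (dist x y) else γ u y (dist x y - dist x u)) = y := by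
      have h := mem_seg.1 hu
      split_ifs with hh
      · have h1 : dist x u = dist x y := le_antisymm hule hh
        have h2 : u = y := dist_eq_zero.1 (by linarith)
        subst h2; exact γ1 _ _
      · have : dist x y - dist x u = dist u y := by linarith
        rw [this, γ1]
    rw [e] at this
    simp only [dist_self, mul_zero, add_zero] at this
    exact dist_le_zero.1 this
  refine ⟨⟨P, ?_, ?_, ?_, hmem, ?_, ?_⟩⟩
  · rw [continuous_iff_continuousAt]
    rintro ⟨x, y, s⟩
    have hb : ∀ q : X × X × I, dist (P q.1 q.2.1 q.2.2) (P x y s) ≤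
        dist q.1 x + dist q.2.1 y + |(q.2.2 : ℝ) - s| * dist x y := by
      rintro ⟨x', y', s'⟩
      have h1 := hB _ _ _ _ dist_nonneg dist_nonneg (hγ x' y') (hγ x y) s' s'.2
      have h2 := hγ x y _ (hin x y s') _ (hin x y s)
      rw [γ0, γ0, γ1, γ1] at h1
      have h3 := dist_triangle (P x' y' s') (P x y s') (P x y s)
      rw [← sub_mul, abs_mul, abs_of_nonneg (dist_nonneg (x := x) (y := y))] at h2
      have h4 : (1 - (s' : ℝ)) * dist x' x ≤ dist x' x :=
        mul_le_of_le_one_left dist_nonneg (by linarith [s'.2.1])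
      have h5 : (s' : ℝ) * dist y' y ≤ dist y' y := mul_le_of_le_one_left dist_nonneg s'.2.2
      change dist (P x' y' s') (P x y s') ≤ _ at h1
      change dist (P x y s') (P x y s) = _ at h2
      simp only
      linarith
    rw [ContinuousAt, tendsto_iff_dist_tendsto_zero]
    refine squeeze_zero (fun _ => dist_nonneg) hb ?_
    have : Continuous (fun q : X × X × I => dist q.1 x + dist q.2.1 y +
      |(q.2.2 : ℝ) - s| * dist x y) := by fun_prop
    have h := this.tendsto (x, y, s)
    simpa using h
  · intro x y; simp [P, γ0]
  · intro x y; simp [P, γ1]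
  · intro x y z hz
    rcases eq_or_lt_of_le (dist_nonneg (x := x) (y := y)) with h0 | h0
    · have : x = y := dist_eq_zero.1 h0.symm
      subst this
      exact ⟨0, by simp [P, seg_self hz, γ0]⟩
    have hule : dist x z ≤ dist x y := by
      have := mem_seg.1 hz; linarith [dist_nonneg (x := z) (y := y)]
    refine ⟨⟨dist x z / dist x y, by positivity, (div_le_one h0).2 hule⟩, ?_⟩
    simp only [P]
    rw [div_mul_cancel₀ _ h0.ne']
    exact (huniq x y z hz).symm
  · intro x y u hu v hv h
    rw [huniq x y u hu, huniq x y v hv, h]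

namespace Geo

/-- two points of a segment are comparable -/
lemma comp (S : Geo X) {x y u v : X} (hu : u ∈ seg x y) (hv : v ∈ seg x y) (h : dist x u ≤ dist x v) :
    u ∈ seg x v := by
  have hc : Continuous (fun s => dist x (S.P x v s)) :=
    continuous_const.dist (S.cont.comp (by fun_prop : Continuous fun s : I => (x, v, s)))
  have := intermediate_value_univ (0 : I) 1 hc
  simp only [S.zero, S.one, dist_self] at this
  obtain ⟨s, hs⟩ := this ⟨dist_nonneg, h⟩
  have hm := S.mem x v s
  have := S.uniq x y _ (seg_trans hv hm) u hu hs
  rwa [← this]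

lemma conv (S : Geo X) {x y u v : X} (hu : u ∈ seg x y) (hv : v ∈ seg x y) : seg u v ⊆ seg x y := by
  intro w hw
  rcases le_total (dist x u) (dist x v) with h | h
  · exact seg_trans hv (seg_transr (S.comp hu hv h) hw)
  · rw [seg_comm] at hw
    exact seg_trans hu (seg_transr (S.comp hv hu h) hw)

lemma seg_preconnected (S : Geo X) (x y : X) : IsPreconnected (seg x y) := by
  have : seg x y = Set.range (S.P x y) := by
    ext z; exact ⟨fun h => S.surj x y z h, by rintro ⟨s, rfl⟩; exact S.mem x y s⟩
  rw [this]
  exact isPreconnected_range (S.cont.comp (by fun_prop : Continuous fun s : I => (x, y, s)))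

end Geo

lemma isClosed_seg (x y : X) : IsClosed (seg x y) :=
  isClosed_eq (by fun_prop) (by fun_prop)

/-- Geodesic data with chart and a continuous logarithm along segments. -/
structure Surf (X : Type*) [MetricSpace X] extends Geo X where
  φ : X ≃ₜ ℂ
  L : X → X → X → ℂ
  hexp : ∀ p q a, a ∉ seg p q → Complex.exp (L p q a) = (φ q - φ a) / (φ p - φ a)
  contL : ∀ p q a, a ∉ seg p q →
    ContinuousAt (fun r : X × X × X => L r.1 r.2.1 r.2.2) (p, q, a)
  self : ∀ p a, L p p a = 0

/-- triples `(p, q, a)` with `a` off the segment `[p, q]` -/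
abbrev OffT (X : Type*) [MetricSpace X] := {r : X × X × X // r.2.2 ∉ seg r.1 r.2.1}

lemma isOpen_off : IsOpen {r : X × X × X | r.2.2 ∉ seg r.1 r.2.1} := by
  have : IsClosed {r : X × X × X | r.2.2 ∈ seg r.1 r.2.1} :=
    isClosed_eq (by fun_prop) (by fun_prop)
  exact this.isOpen_compl

lemma exists_surf (hX : IsBusemannSurface X) : Nonempty (Surf X) := by
  obtain ⟨S⟩ := exists_geo hX.1
  obtain ⟨e⟩ := hX.2
  let φ : X ≃ₜ ℂ := e.trans Complex.orthonormalBasisOneI.repr.symm.toHomeomorph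
  have hne : ∀ (s : I) (r : OffT X), φ (S.P r.1.1 r.1.2.1 s) - φ r.1.2.2 ≠ 0 := by
    rintro s ⟨⟨p, q, a⟩, h⟩ h0
    rw [sub_eq_zero] at h0
    have := φ.injective h0
    exact h (this ▸ S.mem p q s)
  have hne0 : ∀ (r : OffT X), φ r.1.1 - φ r.1.2.2 ≠ 0 := by
    intro r; have := hne 0 r; rwa [S.zero] at this
  let H : C(I × OffT X, {z : ℂ // z ≠ 0}) :=
    ⟨fun w => ⟨(φ (S.P w.2.1.1 w.2.1.2.1 w.1) - φ w.2.1.2.2) / (φ w.2.1.1 - φ w.2.1.2.2),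
      div_ne_zero (hne w.1 w.2) (hne0 w.2)⟩, by
      refine Continuous.subtype_mk ?_ _
      refine Continuous.div ?_ ?_ (fun w => hne0 w.2)
      · refine Continuous.sub ?_ (by fun_prop)
        exact φ.continuous.comp (S.cont.comp
          (by fun_prop : Continuous fun w : I × OffT X => (w.2.1.1, w.2.1.2.1, w.1)))
      · fun_prop⟩
  let f : C(OffT X, ℂ) := ContinuousMap.const _ 0
  have H0 : ∀ r : OffT X, H (0, r) = (⟨Complex.exp (f r), Complex.exp_ne_zero _⟩ : {z : ℂ // z ≠ 0}) := by
    intro r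
    apply Subtype.ext
    simp only [H, f, ContinuousMap.coe_mk, S.zero, ContinuousMap.const_apply, Complex.exp_zero]
    exact div_self (hne0 r)
  let G := Complex.isCoveringMap_exp.liftHomotopy H f H0
  have hG := Complex.isCoveringMap_exp.liftHomotopy_lifts H f H0
  have hG' : ∀ r : OffT X, Complex.exp (G (1, r)) = (φ r.1.2.1 - φ r.1.2.2) / (φ r.1.1 - φ r.1.2.2) := by
    intro r
    have := congrArg Subtype.val (congrFun hG (1, r))
    simp only [Function.comp, H, ContinuousMap.coe_mk, S.one] at this
    exact this
  classical
  let L0 : X × X × X → ℂ := fun r => if h : r.2.2 ∉ seg r.1 r.2.1 then G (1, ⟨r, h⟩) else 0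
  have hL0 : ContinuousOn L0 {r : X × X × X | r.2.2 ∉ seg r.1 r.2.1} := by
    rw [continuousOn_iff_continuous_domRestrict]
    have : Set.domRestrict {r : X × X × X | r.2.2 ∉ seg r.1 r.2.1} L0 = fun r => G (1, r) := by
      ext ⟨r, h⟩
      exact dif_pos h
    rw [this]
    exact G.continuous.comp (by fun_prop)
  have hself : ∀ p a : X, a ≠ p → a ∉ seg p p := fun p a h h' => h (seg_self h')
  have hne' : ∀ {p q a : X}, a ∉ seg p q → a ≠ p := by
    rintro p q a h rfl; exact h (left_mem _ _)
  refine ⟨⟨S, φ, fun p q a => L0 (p, q, a) - L0 (p, p, a), ?_, ?_, ?_⟩⟩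
  · intro p q a h
    have h2 := hself p a (hne' h)
    rw [Complex.exp_sub]
    simp only [L0]
    rw [dif_pos h, dif_pos h2, hG', hG']
    simp only
    rw [div_self (hne0 ⟨(p, q, a), h⟩), div_one]
  · intro p q a h
    have h2 := hself p a (hne' h)
    refine ContinuousAt.sub ?_ ?_
    · exact hL0.continuousAt (isOpen_off.mem_nhds h)
    · exact ContinuousAt.comp (f := fun r : X × X × X => (r.1, r.1, r.2.2)) (x := (p, q, a))
        (hL0.continuousAt (isOpen_off.mem_nhds h2)) (by fun_prop)
  · intro p a; simp

/-- a continuous function with values in `2πiℤ` is constant on preconnected sets -/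
lemma const_of_exp {Y : Type*} [TopologicalSpace Y] {K : Set Y} (hK : IsPreconnected K)
    {f : Y → ℂ} (hf : ContinuousOn f K) (he : ∀ y ∈ K, Complex.exp (f y) = 1) {u v : Y}
    (hu : u ∈ K) (hv : v ∈ K) : f u = f v := by
  have hg : ContinuousOn (fun y => (f y).im / (2 * Real.pi)) K :=
    (Complex.continuous_im.comp_continuousOn hf).div_const _
  have hint : ∀ y ∈ K, ∃ n : ℤ, f y = n * (2 * Real.pi * Complex.I) := fun y hy =>
    Complex.exp_eq_one_iff.1 (he y hy)
  have hpi : (2 * Real.pi) ≠ 0 := by positivity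
  have hint' : ∀ y, ∀ n : ℤ, f y = n * (2 * Real.pi * Complex.I) → (f y).im / (2 * Real.pi) = n := by
    intro y n hn
    rw [hn]; simp
  have him := hK.image _ hg
  have hsub : ((fun y => (f y).im / (2 * Real.pi)) '' K) ⊆ Set.range ((↑) : ℤ → ℝ) := by
    rintro _ ⟨y, hy, rfl⟩
    obtain ⟨n, hn⟩ := hint y hy
    exact ⟨n, (hint' y n hn).symm⟩
  have hss : ((fun y => (f y).im / (2 * Real.pi)) '' K).Subsingleton := by
    by_contra hns
    rw [Set.not_subsingleton_iff] at hns
    have hcard := him.infinite_of_nontrivial hns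
    obtain ⟨a, ha, b, hb, hab⟩ := hns
    wlog hlt : a < b generalizing a b
    · exact this b hb a ha hab.symm (lt_of_le_of_ne (not_lt.1 hlt) hab.symm)
    obtain ⟨n, rfl⟩ := hsub ha
    obtain ⟨m, rfl⟩ := hsub hb
    have h1 : n + 1 ≤ m := by exact_mod_cast hlt
    have h1' : (n : ℝ) + 1 ≤ m := by exact_mod_cast h1
    have := him.Icc_subset ha hb
      (show (n : ℝ) + 1 / 2 ∈ Set.Icc (n : ℝ) m from ⟨by linarith, by linarith⟩)
    obtain ⟨k, hk⟩ := hsub this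
    have h2 : (n : ℝ) < k := by linarith
    have h3 : (k : ℝ) < n + 1 := by linarith
    have h2' : n < k := by exact_mod_cast h2
    have h3' : k < n + 1 := by exact_mod_cast h3
    omega
  obtain ⟨n, hn⟩ := hint u hu
  obtain ⟨m, hm⟩ := hint v hv
  have := hss ⟨u, hu, rfl⟩ ⟨v, hv, rfl⟩
  simp only [hint' u n hn, hint' v m hm] at this
  rw [hn, hm]
  have : n = m := by exact_mod_cast this
  rw [this]

namespace Surf
variable (S : Surf X)

lemma sub_ne {p q : X} (h : q ≠ p) : S.φ p - S.φ q ≠ 0 := by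
  rw [sub_ne_zero]; exact fun h' => h (S.φ.injective h').symm

lemma contA {p q a : X} (h : a ∉ seg p q) : ContinuousAt (fun b => S.L p q b) a :=
  ContinuousAt.comp (f := fun b => (p, q, b)) (S.contL p q a h) (by fun_prop)

lemma contR {p q a : X} (h : a ∉ seg p q) : ContinuousAt (fun b => S.L p b a) q :=
  ContinuousAt.comp (f := fun b => (p, b, a)) (S.contL p q a h) (by fun_prop)

lemma contLf {p q a : X} (h : a ∉ seg p q) : ContinuousAt (fun b => S.L b q a) p :=
  ContinuousAt.comp (f := fun b => (b, q, a)) (S.contL p q a h) (by fun_prop)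

lemma off_left {p q a : X} (h : a ∉ seg p q) : a ≠ p := by
  rintro rfl; exact h (left_mem _ _)
lemma off_right {p q a : X} (h : a ∉ seg p q) : a ≠ q := by
  rintro rfl; exact h (right_mem _ _)

lemma anti {p q a : X} (h : a ∉ seg p q) : S.L q p a = - S.L p q a := by
  have hk : ∀ u ∈ seg p q, a ∉ seg p u := fun u hu h' => h (seg_trans hu h')
  have hk' : ∀ u ∈ seg p q, a ∉ seg u p := fun u hu => by rw [seg_comm]; exact hk u hu
  have := const_of_exp (S.seg_preconnected p q) (f := fun u => S.L p u a + S.L u p a)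
    (fun u hu => ((S.contR (hk u hu)).add (S.contLf (hk' u hu))).continuousWithinAt)
    (by
      intro u hu
      rw [Complex.exp_add, S.hexp _ _ _ (hk u hu), S.hexp _ _ _ (hk' u hu)]
      have h1 := S.sub_ne (off_left (hk u hu))
      have h2 := S.sub_ne (off_right (hk u hu))
      field_simp) (left_mem p q) (right_mem p q)
  simp only [S.self, add_zero] at this
  linear_combination -this

lemma add {p q r a : X} (hq : q ∈ seg p r) (h : a ∉ seg p r) :
    S.L p r a = S.L p q a + S.L q r a := by
  have hk : ∀ u ∈ seg p r, a ∉ seg p u := fun u hu h' => h (seg_trans hu h')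
  have hk' : ∀ u ∈ seg p r, a ∉ seg u r := fun u hu h' => h (seg_transr hu h')
  have := const_of_exp (S.seg_preconnected p r)
    (f := fun u => S.L p u a + S.L u r a - S.L p r a)
    (fun u hu => (((S.contR (hk u hu)).add (S.contLf (hk' u hu))).sub
      continuousAt_const).continuousWithinAt)
    (by
      intro u hu
      rw [Complex.exp_sub, Complex.exp_add, S.hexp _ _ _ (hk u hu), S.hexp _ _ _ (hk' u hu),
        S.hexp _ _ _ h]
      have h1 := S.sub_ne (off_left h)
      have h2 := S.sub_ne (off_right h)
      have h3 := S.sub_ne (off_right (hk u hu))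
      field_simp) (left_mem p r) hq
  simp only [S.self, zero_add, sub_self] at this
  linear_combination this

/-- the (2πi times) winding number of the triangle around `a` -/
def n (x y z a : X) : ℂ := S.L x y a + S.L y z a + S.L z x a

/-- off the boundary -/
def Off (x y z a : X) : Prop := a ∉ seg x y ∧ a ∉ seg y z ∧ a ∉ seg z x

lemma Off.rot {x y z a : X} (h : Off x y z a) : Off y z x a := ⟨h.2.1, h.2.2, h.1⟩

lemma n_rot (x y z a : X) : S.n y z x a = S.n x y z a := by simp only [n]; ring

lemma n_exp {x y z a : X} (h : Off x y z a) : Complex.exp (S.n x y z a) = 1 := by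
  simp only [n]
  rw [Complex.exp_add, Complex.exp_add, S.hexp _ _ _ h.1, S.hexp _ _ _ h.2.1, S.hexp _ _ _ h.2.2]
  have h1 := S.sub_ne (off_left h.1)
  have h2 := S.sub_ne (off_left h.2.1)
  have h3 := S.sub_ne (off_left h.2.2)
  field_simp

lemma n_cont {x y z a : X} (h : Off x y z a) : ContinuousAt (S.n x y z) a :=
  ((S.contA h.1).add (S.contA h.2.1)).add (S.contA h.2.2)

lemma off_nhds {x y z a : X} (h : Off x y z a) : ∀ᶠ b in 𝓝 a, Off x y z b := by
  filter_upwards [(isClosed_seg x y).isOpen_compl.mem_nhds h.1,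
    (isClosed_seg y z).isOpen_compl.mem_nhds h.2.1,
    (isClosed_seg z x).isOpen_compl.mem_nhds h.2.2] with b h1 h2 h3 using ⟨h1, h2, h3⟩

/-- The winding number is locally constant. -/
lemma n_loc {x y z a : X} (h : Off x y z a) : ∀ᶠ b in 𝓝 a, S.n x y z b = S.n x y z a := by
  have hc : ContinuousAt (fun b => S.φ.symm b) (S.φ a) := S.φ.symm.continuous.continuousAt
  have h1 : ∀ᶠ w in 𝓝 (S.φ a), Off x y z (S.φ.symm w) := by
    refine hc.eventually ?_
    simpa using off_nhds h
  obtain ⟨r, hr, hb⟩ := Metric.eventually_nhds_iff_ball.1 h1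
  have h2 : ∀ᶠ b in 𝓝 a, S.φ b ∈ Metric.ball (S.φ a) r :=
    S.φ.continuous.continuousAt.eventually (Metric.ball_mem_nhds _ hr)
  filter_upwards [h2] with b hbb
  have := const_of_exp (convex_ball (S.φ a) r).isPreconnected
    (f := fun w => S.n x y z (S.φ.symm w))
    (fun w hw => (ContinuousAt.comp (f := fun w => S.φ.symm w) (S.n_cont (hb w hw))
      S.φ.symm.continuous.continuousAt).continuousWithinAt)
    (fun w hw => S.n_exp (hb w hw)) hbb (Metric.mem_ball_self hr)
  simpa using this

/-- points with nonzero winding number lie in the cone -/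
lemma cone {x y z a : X} (h : Off x y z a) (hn : S.n x y z a ≠ 0) :
    ∃ u ∈ seg y z, a ∈ seg x u := by
  by_contra hc
  push Not at hc
  have hyu : ∀ u ∈ seg y z, a ∉ seg y u := fun u hu h' => h.2.1 (seg_trans hu h')
  have hux : ∀ u ∈ seg y z, a ∉ seg u x := fun u hu => by rw [seg_comm]; exact hc u hu
  have := const_of_exp (S.seg_preconnected y z) (f := fun u => S.n x y u a)
    (fun u hu => ((continuousAt_const.add (S.contR (hyu u hu))).add
      (S.contLf (hux u hu))).continuousWithinAt)
    (fun u hu => S.n_exp ⟨h.1, hyu u hu, hux u hu⟩) (left_mem y z) (right_mem y z)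
  apply hn
  rw [← this]
  simp only [n, S.self, S.anti h.1]
  ring

/-- the same along a path of observation points -/
lemma n_path {x y z a b : X} (h : ∀ c ∈ seg a b, Off x y z c) : S.n x y z a = S.n x y z b :=
  const_of_exp (S.seg_preconnected a b) (fun c hc => (S.n_cont (h c hc)).continuousWithinAt)
    (fun c hc => S.n_exp (h c hc)) (left_mem a b) (right_mem a b)

/-- there is no continuous logarithm on a punctured neighborhood -/
lemma no_log {p : X} {g : X → ℂ} (hg : ∀ᶠ a in 𝓝 p, a ≠ p →
    ContinuousAt g a ∧ Complex.exp (g a) = S.φ a - S.φ p) : False := by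
  have h1 : ∀ᶠ w in 𝓝 (S.φ p), S.φ.symm w ≠ p →
      ContinuousAt g (S.φ.symm w) ∧ Complex.exp (g (S.φ.symm w)) = S.φ (S.φ.symm w) - S.φ p := by
    have ht : Filter.Tendsto S.φ.symm (𝓝 (S.φ p)) (𝓝 p) := by
      simpa using S.φ.symm.continuous.tendsto (S.φ p)
    exact ht.eventually hg
  obtain ⟨r, hr, hb⟩ := Metric.eventually_nhds_iff_ball.1 h1
  let c : ℝ → ℂ := fun θ => S.φ p + ((r / 2 : ℝ) : ℂ) * Complex.exp (θ * Complex.I)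
  have hc : Continuous c := by fun_prop
  have hr2 : ((r / 2 : ℝ) : ℂ) ≠ 0 := by
    exact_mod_cast (half_pos hr).ne'
  have hcb : ∀ θ, c θ ∈ Metric.ball (S.φ p) r := by
    intro θ
    simp only [c, Metric.mem_ball, dist_self_add_left, norm_mul, Complex.norm_exp_ofReal_mul_I,
      mul_one, Complex.norm_real, Real.norm_eq_abs]
    rw [abs_of_pos (by linarith)]; linarith
  have hcp : ∀ θ, S.φ.symm (c θ) ≠ p := by
    intro θ h
    have : c θ = S.φ p := by rw [← h]; simp
    simp only [c, add_eq_left, mul_eq_zero, Complex.exp_ne_zero, or_false] at this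
    exact hr2 this
  have key := const_of_exp (isPreconnected_univ (α := ℝ))
    (f := fun θ : ℝ => g (S.φ.symm (c θ)) - Complex.log ((r / 2 : ℝ) : ℂ) - θ * Complex.I)
    (by
      intro θ _
      refine ContinuousAt.continuousWithinAt ?_
      refine ContinuousAt.sub (ContinuousAt.sub ?_ continuousAt_const) (by fun_prop)
      exact ContinuousAt.comp (f := fun θ => S.φ.symm (c θ)) (hb _ (hcb θ) (hcp θ)).1
        (S.φ.symm.continuous.comp hc).continuousAt)
    (by
      intro θ _
      rw [Complex.exp_sub, Complex.exp_sub, (hb _ (hcb θ) (hcp θ)).2, Complex.exp_log hr2]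
      simp only [Homeomorph.apply_symm_apply, c, add_sub_cancel_left]
      have := Complex.exp_ne_zero (θ * Complex.I)
      field_simp) (Set.mem_univ 0) (Set.mem_univ (2 * Real.pi))
  have hc2 : c (2 * Real.pi) = c 0 := by
    simp only [c]
    push_cast
    rw [Complex.exp_two_pi_mul_I]; simp
  rw [hc2] at key
  simp [Complex.ext_iff] at key
  linarith [Real.pi_pos]

/-- gluing lemma -/
lemma glue {p w : X} (hpw : p ≠ w) (G : X → ℂ) (hG : ∀ᶠ a in 𝓝 p, a ≠ p →
    ContinuousAt G a ∧ Complex.exp (G a) = (S.φ w - S.φ a) / (S.φ p - S.φ a)) : False := by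
  have hd : S.φ p - S.φ w ≠ 0 := S.sub_ne hpw.symm
  have hcont : ContinuousAt (fun a => (S.φ a - S.φ w) / (S.φ p - S.φ w)) p :=
    (S.φ.continuous.continuousAt.sub continuousAt_const).div_const _
  have hs : ∀ᶠ a in 𝓝 p, (S.φ a - S.φ w) / (S.φ p - S.φ w) ∈ Complex.slitPlane := by
    refine hcont.eventually ?_
    simp only [div_self hd]
    exact Complex.isOpen_slitPlane.mem_nhds (by simp)
  refine S.no_log (p := p) (g := fun a => Complex.log ((S.φ a - S.φ w) / (S.φ p - S.φ w)) +
    Complex.log (S.φ p - S.φ w) - G a) ?_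
  filter_upwards [hG, hs] with a ha hs hap
  obtain ⟨h1, h2⟩ := ha hap
  constructor
  · refine ContinuousAt.sub (ContinuousAt.add ?_ continuousAt_const) h1
    exact ContinuousAt.clog
      ((S.φ.continuous.continuousAt.sub continuousAt_const).div_const _) hs
  · have h3 : (S.φ a - S.φ w) / (S.φ p - S.φ w) ≠ 0 := Complex.slitPlane_ne_zero hs
    have h4 : S.φ a - S.φ w ≠ 0 := fun h => h3 (by rw [h, zero_div])
    have h5 : S.φ w - S.φ a ≠ 0 := fun h => h4 (by rw [← neg_sub, h, neg_zero])
    have h6 := S.sub_ne hap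
    rw [Complex.exp_sub, Complex.exp_add, Complex.exp_log h3, Complex.exp_log hd, h2]
    field_simp
    ring

lemma ev {p q a : X} (h : a ∉ seg p q) : ∀ᶠ b in 𝓝 a, b ∉ seg p q :=
  (isClosed_seg p q).isOpen_compl.mem_nhds h

lemma antisymm {s p w : X} (h1 : p ∈ seg s w) (h2 : s ∈ seg p w) : s = p := by
  rw [mem_seg] at h1 h2
  rw [dist_comm p s] at h2
  exact dist_eq_zero.1 (by linarith [dist_nonneg (x := s) (y := p)])

lemma split (S : Surf X) {y z v b : X} (hv : v ∈ seg y z) (hb : b ∈ seg y z) : b ∈ seg y v ∨ b ∈ seg v z := by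
  rcases le_total (dist y b) (dist y v) with h | h
  · exact Or.inl (S.comp hb hv h)
  · exact Or.inr (seg_trans' hb (S.comp hv hb h))

lemma n_swap {x y z a : X} (h : Off x y z a) : S.n x z y a = - S.n x y z a := by
  simp only [n]
  have h1 : a ∉ seg x z := by rw [seg_comm]; exact h.2.2
  rw [S.anti h.1, S.anti h.2.1, S.anti (p := z) (q := x) h.2.2]
  ring

/-- Near an interior point of a side there are points with nonzero winding number. -/
lemma jump {x y z v : X} (hv : v ∈ seg y z) (h1 : v ∉ seg x y) (h2 : v ∉ seg z x)
    {Q : X → Prop} (hQ : ∀ᶠ a in 𝓝 v, Q a) : ∃ a, Q a ∧ Off x y z a ∧ S.n x y z a ≠ 0 := by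
  by_contra hcon
  push Not at hcon
  have hvz : v ≠ z := by rintro rfl; exact h2 (left_mem _ _)
  classical
  let h : X → ℂ := fun a => - S.L z x a - S.L x y a - S.L y v a
  let G : X → ℂ := fun a => if a ∈ seg v z then h a else S.L v z a
  refine S.glue hvz G ?_
  filter_upwards [hQ.eventually_nhds, ev h1, ev h2] with a haQ ha1 ha2 hav
  by_cases ha : a ∈ seg v z
  · have ha3 : a ∉ seg y v := by
      intro h'
      have := seg_transr' hv ha
      rw [seg_comm] at this h'
      exact hav (antisymm this h')
    have hc : ContinuousAt h a :=
      ((S.contA ha2).neg.sub (S.contA ha1)).sub (S.contA ha3)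
    have he : G =ᶠ[𝓝 a] h := by
      filter_upwards [haQ, ev ha1, ev ha2, ev ha3] with b hbQ hb1 hb2 hb3
      by_cases hb : b ∈ seg v z
      · exact if_pos hb
      · simp only [G, if_neg hb]
        have hyz : b ∉ seg y z := fun h' => (S.split hv h').elim hb3 hb
        have := hcon b hbQ ⟨hb1, hyz, hb2⟩
        simp only [n] at this
        rw [S.add hv hyz] at this
        simp only [h]
        linear_combination this
    refine ⟨hc.congr he.symm, ?_⟩
    rw [he.self_of_nhds]
    simp only [h]
    rw [Complex.exp_sub, Complex.exp_sub, Complex.exp_neg, S.hexp _ _ _ ha1, S.hexp _ _ _ ha2,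
      S.hexp _ _ _ ha3]
    have e1 := S.sub_ne (off_left ha1)
    have e2 := S.sub_ne (off_right ha1)
    have e3 := S.sub_ne (off_left ha2)
    have e4 := S.sub_ne hav
    field_simp
  · have he : G =ᶠ[𝓝 a] S.L v z := by
      filter_upwards [ev ha] with b hb using if_neg hb
    refine ⟨(S.contA ha).congr he.symm, ?_⟩
    rw [he.self_of_nhds, S.hexp _ _ _ ha]

lemma side {x w w' t p : X} (hpw : p ∈ seg x w) (ht : t ∈ seg w w') (hp : p ∉ seg x t)
    (hmax : ∀ u ∈ seg x w, u ∈ seg x w' → dist x u ≤ dist x p) {q : X} (hq : q ∈ seg p w)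
    (hqp : q ≠ p) : Off x t w' q ∧ S.n x t w' q = 0 := by
  have hoff : ∀ q ∈ seg p w, q ≠ p → Off x t w' q := by
    intro q hq hqp
    have hqx : q ∈ seg x w := seg_transr hpw hq
    have hpq : p ∈ seg x q := seg_transr' hpw hq
    have h1 : q ∉ seg x t := fun h => hp (seg_trans h hpq)
    refine ⟨h1, ?_, ?_⟩
    · intro h
      have h2 : t ∈ seg w q := seg_transr' ht h
      rw [seg_comm] at h2
      exact h1 (seg_transr' hqx h2)
    · intro h
      rw [seg_comm] at h
      have h2 := hmax q hqx h
      rw [mem_seg] at hpq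
      exact hqp (dist_eq_zero.1 (by
        rw [dist_comm]; linarith [dist_nonneg (x := p) (y := q)]))
  refine ⟨hoff q hq hqp, ?_⟩
  have hpath : S.n x t w' q = S.n x t w' w := by
    refine S.n_path fun c hc => hoff c (seg_transr hq hc) ?_
    rintro rfl
    exact hqp (seg_self (seg_transr' hq hc))
  have hwp : w ≠ p := by
    rintro rfl
    exact hqp (seg_self hq)
  rw [hpath]
  by_contra hn
  rw [S.n_rot w' x t] at hn
  obtain ⟨u, hu, hwu⟩ := S.cone (hoff w (right_mem _ _) hwp).rot.rot hn
  rw [seg_comm] at ht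
  have h1 : w ∈ seg t u := seg_trans' hwu ht
  have h2 : w ∈ seg x t := S.conv (right_mem x t) hu h1
  exact hp (seg_trans h2 hpw)

lemma back {x w w' p s : X} (hpw : p ∈ seg x w) (hpw' : p ∈ seg x w') (hs : s ∈ seg x p)
    (hsp : s ≠ p) (hsw : s ∉ seg w w') : Off p w w' s ∧ S.n p w w' s = 0 := by
  have h1 : p ∈ seg s w := seg_trans' hpw hs
  have h2 : p ∈ seg s w' := seg_trans' hpw' hs
  have hoff : Off p w w' s := ⟨fun h => hsp (antisymm h1 h), hsw, fun h => by
    rw [seg_comm] at h; exact hsp (antisymm h2 h)⟩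
  refine ⟨hoff, ?_⟩
  by_contra hn
  rw [← S.n_rot p w w'] at hn
  obtain ⟨u, hu, hsu⟩ := S.cone hoff.rot hn
  rw [seg_comm] at h1 hu
  have h3 : s ∈ seg p u := seg_trans' hsu h1
  have h4 : p ∈ seg s u := seg_transr' h2 hu
  exact hsp (antisymm h4 h3)

lemma pinch_core (S : Surf X) {x w w' t p : X} (hpw : p ∈ seg x w) (hpw' : p ∈ seg x w') (ht : t ∈ seg w w')
    (hmax : ∀ u ∈ seg x w, u ∈ seg x w' → dist x u ≤ dist x p) : p ∈ seg x t := by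
  by_contra hp
  have hpww : p ∉ seg w w' := by
    intro h
    rcases S.split h ht with h1 | h1
    · rw [seg_comm] at h1
      exact hp (seg_transr' hpw h1)
    · exact hp (seg_transr' hpw' h1)
  have hpw_ne : p ≠ w := by rintro rfl; exact hpww (left_mem _ _)
  have hmax' : ∀ u ∈ seg x w', u ∈ seg x w → dist x u ≤ dist x p := fun u h1 h2 => hmax u h2 h1
  have ht' : t ∈ seg w' w := by rw [seg_comm]; exact ht
  classical
  let c : X → ℂ := fun a => if a ∈ seg x w ∨ a ∈ seg x w' then 0 else
    if S.n x t w' a = 0 then S.n x w t a else 0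
  let h : X → ℂ := fun a => - S.L w t a - S.L t x a - S.L x p a
  let G : X → ℂ := fun a => if a ∈ seg p w then h a else S.L p w a - c a
  refine S.glue hpw_ne G ?_
  filter_upwards [ev hp, ev hpww] with a hat haww hap
  have hwt : ∀ b, b ∉ seg w w' → b ∉ seg w t := fun b hb h' => hb (seg_trans ht h')
  have htw' : ∀ b, b ∉ seg w w' → b ∉ seg t w' := fun b hb h' => hb (seg_transr ht h')
  have htx : ∀ b, b ∉ seg x t → b ∉ seg t x := fun b hb => by rw [seg_comm]; exact hb
  by_cases ha : a ∈ seg p w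
  · have hs := S.side hpw ht hp hmax ha hap
    have haxp : a ∉ seg x p := by
      intro h'
      exact hap (antisymm (seg_trans' hpw h') ha)
    have hc : ContinuousAt h a :=
      ((S.contA (hwt a haww)).neg.sub (S.contA (htx a hat))).sub (S.contA haxp)
    have he : G =ᶠ[𝓝 a] h := by
      filter_upwards [S.n_loc hs.1, ev haxp, ev hs.1.2.2, ev hat, ev haww] with b hb1 hb2 hb3 hb4 hb5
      by_cases hb : b ∈ seg p w
      · exact if_pos hb
      · have hbxw : b ∉ seg x w := fun h' => (S.split hpw h').elim hb2 hb
        rw [seg_comm] at hb3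
        have hcb : c b = S.n x w t b := by
          simp only [c]
          rw [if_neg (by tauto), if_pos (by rw [hb1, hs.2])]
        simp only [G, if_neg hb, hcb, h, n]
        rw [S.add hpw hbxw]
        ring
    refine ⟨hc.congr he.symm, ?_⟩
    rw [he.self_of_nhds]
    simp only [h]
    rw [Complex.exp_sub, Complex.exp_sub, Complex.exp_neg, S.hexp _ _ _ (hwt a haww),
      S.hexp _ _ _ (htx a hat), S.hexp _ _ _ haxp]
    have e1 := S.sub_ne (off_left (hwt a haww))
    have e2 := S.sub_ne (off_left (htx a hat))
    have e3 := S.sub_ne (off_left haxp)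
    have e4 := S.sub_ne hap
    field_simp
  · obtain ⟨k, hk1, hk⟩ : ∃ k, Complex.exp k = 1 ∧ ∀ᶠ b in 𝓝 a, c b = k := by
      by_cases hxp : a ∈ seg x p
      · refine ⟨0, Complex.exp_zero, ?_⟩
        have hs := S.back hpw hpw' hxp hap haww
        filter_upwards [S.n_loc hs.1, ev hat, ev haww] with b hb1 hb2 hb3
        simp only [c]
        split_ifs with i1 i2
        · rfl
        · rw [hs.2] at hb1
          push Not at i1
          have hbp : b ∉ seg x p := fun h' => i1.1 (seg_trans hpw h')
          have hbpw' : b ∉ seg p w' := fun h' => i1.2 (seg_transr hpw' h')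
          simp only [n] at hb1 i2 ⊢
          rw [S.add hpw i1.1]
          rw [S.anti i1.2, S.add hpw' i1.2] at i2
          rw [S.anti hbpw', S.add ht hb3] at hb1
          rw [S.anti hb2]
          linear_combination hb1 - i2
        · rfl
      · by_cases hpw'2 : a ∈ seg p w'
        · refine ⟨0, Complex.exp_zero, ?_⟩
          have hs := S.side hpw' ht' hp hmax' hpw'2 hap
          filter_upwards [S.n_loc hs.1, off_nhds hs.1] with b hb1 hb2
          have : S.n x w t b = 0 := by
            rw [S.n_swap hb2, hb1, hs.2, neg_zero]
          simp only [c]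
          split_ifs <;> first | rfl | exact this
        · have haw : a ∉ seg x w := fun h' => (S.split hpw h').elim hxp ha
          have haw' : a ∉ seg x w' := fun h' => (S.split hpw' h').elim hxp hpw'2
          have o1 : Off x w t a := ⟨haw, hwt a haww, htx a hat⟩
          have o2 : Off x t w' a := ⟨hat, htw' a haww, by rw [seg_comm]; exact haw'⟩
          refine ⟨c a, ?_, ?_⟩
          · simp only [c]
            split_ifs
            · exact Complex.exp_zero
            · exact S.n_exp o1
            · exact Complex.exp_zero
          · filter_upwards [S.n_loc o1, S.n_loc o2, ev haw, ev haw'] with b h1 h2 h3 h4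
            simp only [c, h1, h2, h3, h4, haw, haw']
    have he : G =ᶠ[𝓝 a] fun b => S.L p w b - k := by
      filter_upwards [ev ha, hk] with b hb hb2
      simp only [G, if_neg hb, hb2]
    refine ⟨((S.contA ha).sub continuousAt_const).congr he.symm, ?_⟩
    rw [he.self_of_nhds, Complex.exp_sub, hk1, div_one, S.hexp _ _ _ ha]

lemma isCompact_seg (S : Surf X) (x y : X) : IsCompact (seg x y) := by
  have : seg x y = Set.range (S.P x y) := by
    ext z; exact ⟨fun h => S.surj x y z h, by rintro ⟨s, rfl⟩; exact S.mem x y s⟩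
  rw [this]
  exact isCompact_range (S.cont.comp (by fun_prop : Continuous fun s : I => (x, y, s)))

lemma pinch (S : Surf X) {x w w' t p : X} (hpw : p ∈ seg x w) (hpw' : p ∈ seg x w') (ht : t ∈ seg w w') :
    p ∈ seg x t := by
  have hK : IsCompact (seg x w ∩ seg x w') := (S.isCompact_seg x w).inter_right (isClosed_seg x w')
  obtain ⟨p0, ⟨h1, h2⟩, hm⟩ := hK.exists_isMaxOn ⟨p, hpw, hpw'⟩
    (f := fun u => dist x u) (by fun_prop)
  have hm' : ∀ u ∈ seg x w, u ∈ seg x w' → dist x u ≤ dist x p0 := fun u hu hu' => hm ⟨hu, hu'⟩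
  have h3 := S.pinch_core h1 h2 ht hm'
  exact seg_trans h3 (S.comp hpw h1 (hm' p hpw hpw'))

lemma pasch (S : Surf X) {x y z p v : X} (hp : p ∈ seg x y) (hv : v ∈ seg p z) :
    ∃ u ∈ seg y z, v ∈ seg x u := by
  by_contra hc
  have hoff : Off x y z v := by
    refine ⟨fun h => hc ⟨y, left_mem _ _, h⟩, fun h => hc ⟨v, h, right_mem _ _⟩, fun h => ?_⟩
    rw [seg_comm] at h
    exact hc ⟨z, right_mem _ _, h⟩
  have hn : S.n x y z v = 0 := by
    by_contra hn; exact hc (S.cone hoff hn)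
  have hxp : v ∉ seg x p := fun h => hoff.1 (seg_trans hp h)
  obtain ⟨a, ⟨ha0, haoff⟩, hao, han⟩ := S.jump hv hxp hoff.2.2 ((S.n_loc hoff).and (off_nhds hoff))
  rw [hn] at ha0
  have hazp : a ∉ seg z p := by rw [seg_comm]; exact hao.2.1
  have hao2 : Off p y z a := ⟨fun h => haoff.1 (seg_transr hp h), haoff.2.1, hazp⟩
  have han2 : S.n p y z a ≠ 0 := by
    intro h0
    apply han
    simp only [n] at *
    rw [S.add hp haoff.1] at ha0
    rw [S.anti hazp]
    linear_combination ha0 - h0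
  rw [S.n_rot z x p] at han
  rw [S.n_rot z p y] at han2
  obtain ⟨u1, hu1, ha1⟩ := S.cone hao.rot.rot han
  obtain ⟨u2, hu2, ha2⟩ := S.cone hao2.rot.rot han2
  exact hazp (S.pinch ha1 ha2 (seg_transr' (seg_trans' hp hu1) hu2))

lemma triangle_eq (S : Surf X) (x y z : X) : triangleG x y z = {v | ∃ u ∈ seg y z, v ∈ seg x u} := by
  apply Set.Subset.antisymm
  · refine Set.sInter_subset_of_mem ⟨?_, ?_⟩
    · rintro p ⟨u, hu, hp⟩ q ⟨u', hu', hq⟩ v hv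
      rw [seg_comm] at hv
      obtain ⟨r, hr, hvr⟩ := S.pasch hq hv
      rw [seg_comm] at hr
      obtain ⟨r', hr', hrr⟩ := S.pasch hp hr
      exact ⟨r', S.conv hu hu' hr', seg_trans hrr hvr⟩
    · rintro v (rfl | rfl | rfl)
      · exact ⟨y, left_mem _ _, left_mem _ _⟩
      · exact ⟨v, left_mem _ _, right_mem _ _⟩
      · exact ⟨v, right_mem _ _, right_mem _ _⟩
  · rintro v ⟨u, hu, hv⟩ C ⟨hC, hsub⟩
    exact hC x (hsub (by simp)) u (hC y (hsub (by simp)) z (hsub (by simp)) hu) hv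

end Surf

end TriCev

/-- a point `t` on the side `[y,z]` divides the triangle `Δ(x,y,z)`
into the two triangles `Δ(x,y,t)` and `Δ(x,t,z)`. -/
theorem triangle_divided_by_cevian {X : Type*} [MetricSpace X]
    (hX : IsBusemannSurface X) (x y z t : X) (ht : t ∈ seg y z) :
    triangleG x y z = triangleG x y t ∪ triangleG x t z ∧
      triangleG x y t ∩ triangleG x t z = seg x t := by
  obtain ⟨S⟩ := TriCev.exists_surf hX
  simp only [S.triangle_eq]
  constructor
  · ext v
    constructor
    · rintro ⟨u, hu, hv⟩
      exact (S.split ht hu).imp (fun h => ⟨u, h, hv⟩) (fun h => ⟨u, h, hv⟩)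
    · rintro (⟨u, hu, hv⟩ | ⟨u, hu, hv⟩)
      · exact ⟨u, TriCev.seg_trans ht hu, hv⟩
      · exact ⟨u, TriCev.seg_transr ht hu, hv⟩
  · ext v
    constructor
    · rintro ⟨⟨u, hu, hv⟩, ⟨u', hu', hv'⟩⟩
      exact S.pinch hv hv' (TriCev.seg_transr' (TriCev.seg_trans' ht hu) hu')
    · intro hv
      exact ⟨⟨t, TriCev.right_mem _ _, hv⟩, ⟨t, TriCev.left_mem _ _, hv⟩⟩
end

section
/- Let (𝒮,d) be a Busemann surface, let δ > 0, and let x,y,z ∈ 𝒮 be a critical triplet: d(x,y) ≤ 2δ, d(y,z) ≤ 2δ, d(z,x) ≤ 2δ, and B_δ(x) ∩ B_δ(y) ∩ B_δ(z) = ∅. Set A_x := Δ(x,y,z) ∩ B_δ(y) ∩ B_δ(z), A_y := Δ(x,y,z) ∩ B_δ(x) ∩ B_δ(z), and A_z := Δ(x,y,z) ∩ B_δ(x) ∩ B_δ(y), and suppose (x',y',z') ∈ A_x × A_y × A_z minimizes the perimeter π(x',y',z') = d(x',y')+d(y',z')+d(z',x') over A_x × A_y × A_z. Let x*, y*, z*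 be the midpoints of the geodesic segments [y,z], [x,z], [x,y], respectively. Then Δ(x',y',z') ⊆ Δ(x*,y*,z*); in particular d(x',y') ≤ δ, d(y',z') ≤ δ, and d(z',x') ≤ δ. -/
open Metric Set

namespace Crit

open unitInterval

variable {X : Type*} [MetricSpace X]

lemma seg_comm (a b : X) : seg a b = seg b a := by
  ext z
  simp only [seg, Set.mem_ofPred_eq]
  constructor <;> intro h <;> linarith [dist_comm a b, dist_comm a z, dist_comm b z]

lemma left_mem (a b : X) : a ∈ seg a b := by simp [seg]
lemma right_mem (a b : X) : b ∈ seg a b := by simp [seg]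

/-- If `t ∈ [x,r]` and `k ∈ [t,r]` then `t ∈ [x,k]`. -/
lemma btw_left {x t k r : X} (h1 : t ∈ seg x r) (h2 : k ∈ seg t r) : t ∈ seg x k := by
  simp only [seg, Set.mem_ofPred_eq] at *
  linarith [dist_triangle x t k, dist_triangle x k r]

/-- If `t ∈ [x,r]` and `k ∈ [t,r]` then `k ∈ [x,r]`. -/
lemma btw_trans {x t k r : X} (h1 : t ∈ seg x r) (h2 : k ∈ seg t r) : k ∈ seg x r := by
  simp only [seg, Set.mem_ofPred_eq] at *
  linarith [dist_triangle x t k, dist_triangle x k r]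

/-- If `k ∈ [x,r]` and `t ∈ [x,k]` then `t ∈ [x,r]`. -/
lemma btw_trans' {x t k r : X} (h1 : k ∈ seg x r) (h2 : t ∈ seg x k) : t ∈ seg x r := by
  simp only [seg, Set.mem_ofPred_eq] at *
  linarith [dist_triangle x t r, dist_triangle t k r]

lemma btw_mid {q m q' r k : X} (h : m ∈ seg q q') (hr : r ∈ seg q m) (hk : k ∈ seg m q') :
    m ∈ seg r k := by
  simp only [seg, Set.mem_ofPred_eq] at *
  linarith [dist_triangle q r q', dist_triangle r k q', dist_triangle r m k]

lemma seg_inter {c m e s : X} (h : m ∈ seg c e) (h1 : s ∈ seg c m) (h2 : s ∈ seg m e) : s = m := by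
  have h3 := btw_mid h h1 h2
  simp only [seg, Set.mem_ofPred_eq, dist_self] at h3
  have := dist_nonneg (x := s) (y := m)
  have h4 := dist_comm s m
  exact dist_le_zero.1 (by linarith)

lemma seg_self {a p : X} (h : p ∈ seg a a) : p = a := by
  simp only [seg, Set.mem_ofPred_eq, dist_self] at h
  have := dist_nonneg (x := a) (y := p)
  have h4 := dist_comm a p
  exact dist_le_zero.1 (by linarith)

lemma isClosed_seg (a b : X) : IsClosed (seg a b) := by
  apply isClosed_eq <;> fun_prop

lemma isOpen_D : IsOpen {q : X × X × X | q.1 ∉ seg q.2.1 q.2.2} := by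
  have : IsClosed {q : X × X × X | q.1 ∈ seg q.2.1 q.2.2} := by
    apply isClosed_eq (f := fun q : X × X × X => dist q.2.1 q.1 + dist q.1 q.2.2)
      (g := fun q : X × X × X => dist q.2.1 q.2.2) <;> fun_prop
  exact this.isOpen_compl

/-- concatenation of geodesics -/
lemma concat_geod (hX : IsBusemannSpace X) {a z b : X} (hz : z ∈ seg a b) :
    ∃ γ : ℝ → X, IsGeodesicMap γ (dist a b) ∧ γ 0 = a ∧ γ (dist a b) = b ∧ γ (dist a z) = z := by
  obtain ⟨γ₁, h1, h10, h11⟩ := hX.1 a z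
  obtain ⟨γ₂, h2, h20, h21⟩ := hX.1 z b
  have hz' : dist a z + dist z b = dist a b := hz
  have hn1 := dist_nonneg (x := a) (y := z)
  have hn2 := dist_nonneg (x := z) (y := b)
  set f : ℝ → X := fun s => if s ≤ dist a z then γ₁ s else γ₂ (s - dist a z) with hf
  have key : ∀ s ∈ Set.Icc (0 : ℝ) (dist a b), ∀ t ∈ Set.Icc (0 : ℝ) (dist a b), s ≤ t →
      dist (f s) (f t) = t - s := by
    intro s hs t ht hst
    by_cases hsz : s ≤ dist a z
    · by_cases htz : t ≤ dist a z
      · simp only [hf, hsz, htz, if_true]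
        rw [h1 s ⟨hs.1, hsz⟩ t ⟨ht.1, htz⟩, abs_sub_comm, abs_of_nonneg (by linarith)]
      · push Not at htz
        have htz' : ¬ t ≤ dist a z := by linarith
        simp only [hf, hsz, htz', if_true, if_false]
        have e1 := h1 s ⟨hs.1, hsz⟩ (dist a z) ⟨hn1, le_rfl⟩
        have e2 := h2 0 ⟨le_rfl, hn2⟩ (t - dist a z) ⟨by linarith, by linarith [ht.2]⟩
        have e3 := h1 0 ⟨le_rfl, hn1⟩ s ⟨hs.1, hsz⟩
        have e4 := h2 (t - dist a z) ⟨by linarith, by linarith [ht.2]⟩ (dist z b) ⟨hn2, le_rfl⟩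
        rw [h11, abs_sub_comm, abs_of_nonneg (by linarith)] at e1
        rw [h20, abs_sub_comm, abs_of_nonneg (by linarith)] at e2
        rw [h10, abs_sub_comm, abs_of_nonneg (by linarith [hs.1])] at e3
        rw [h21, abs_sub_comm, abs_of_nonneg (by linarith [ht.2])] at e4
        have t1 := dist_triangle (γ₁ s) z (γ₂ (t - dist a z))
        have t2 := dist_triangle a (γ₁ s) b
        have t3 := dist_triangle (γ₁ s) (γ₂ (t - dist a z)) b
        linarith
    · have htz : ¬ t ≤ dist a z := by linarith
      push Not at hsz
      have hsz' : ¬ s ≤ dist a z := by linarith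
      simp only [hf, hsz', htz, if_false]
      push Not at htz
      rw [h2 _ ⟨by linarith, by linarith [hs.2]⟩ _ ⟨by linarith, by linarith [ht.2]⟩,
        abs_sub_comm, abs_of_nonneg (by linarith)]
      ring
  refine ⟨f, ?_, ?_, ?_, ?_⟩
  · intro s hs t ht
    rcases le_total s t with h | h
    · rw [key s hs t ht h, abs_sub_comm, abs_of_nonneg (by linarith)]
    · rw [dist_comm, key t ht s hs h, abs_of_nonneg (by linarith)]
  · simp [hf, hn1, h10]
  · by_cases h : dist a b ≤ dist a z
    · have h0 : dist z b = 0 := by linarith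
      have h1' : z = b := dist_eq_zero.1 h0
      have : dist a b = dist a z := by linarith
      simp only [hf, h, if_true]
      rw [this, h11, h1']
    · simp only [hf, h, if_false]
      rw [show dist a b - dist a z = dist z b by linarith, h21]
  · simp [hf, h11]

/-- the point of `[a,b]` at ratio `t` -/
noncomputable def G (hX : IsBusemannSpace X) (a b : X) (t : ℝ) : X :=
  (hX.1 a b).choose (t * dist a b)


lemma G_zero (hX : IsBusemannSpace X) (a b : X) : G hX a b 0 = a := by
  have := (hX.1 a b).choose_spec.2.1
  simpa [G] using this

lemma G_one (hX : IsBusemannSpace X) (a b : X) : G hX a b 1 = b := by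
  have := (hX.1 a b).choose_spec.2.2
  simpa [G] using this

lemma mul_mem_Icc {t l : ℝ} (ht : t ∈ Set.Icc (0 : ℝ) 1) (hl : 0 ≤ l) :
    t * l ∈ Set.Icc (0 : ℝ) l :=
  ⟨mul_nonneg ht.1 hl, by nlinarith [ht.2]⟩

lemma G_dist (hX : IsBusemannSpace X) (a b : X) {s t : ℝ} (hs : s ∈ Set.Icc (0 : ℝ) 1) (ht : t ∈ Set.Icc (0 : ℝ) 1) :
    dist (G hX a b s) (G hX a b t) = |s - t| * dist a b := by
  have := (hX.1 a b).choose_spec.1 _ (mul_mem_Icc hs dist_nonneg) _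
    (mul_mem_Icc ht dist_nonneg)
  rw [G, G, this, ← sub_mul, abs_mul, abs_of_nonneg (dist_nonneg (x := a) (y := b))]

lemma G_dist_left (hX : IsBusemannSpace X) (a b : X) {t : ℝ} (ht : t ∈ Set.Icc (0 : ℝ) 1) :
    dist a (G hX a b t) = t * dist a b := by
  have := G_dist hX a b (s := 0) (by simp) ht
  rw [G_zero, zero_sub, abs_neg, abs_of_nonneg ht.1] at this
  exact this

lemma G_dist_right (hX : IsBusemannSpace X) (a b : X) {t : ℝ} (ht : t ∈ Set.Icc (0 : ℝ) 1) :
    dist (G hX a b t) b = (1 - t) * dist a b := by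
  have := G_dist hX a b (t := 1) ht (by simp)
  rw [G_one, abs_sub_comm, abs_of_nonneg (by linarith [ht.2])] at this
  exact this

lemma G_conv (hX : IsBusemannSpace X) (a b a' b' : X) {t : ℝ} (ht : t ∈ Set.Icc (0 : ℝ) 1) :
    dist (G hX a b t) (G hX a' b' t) ≤ (1 - t) * dist a a' + t * dist b b' := by
  have h1 := (hX.1 a b).choose_spec
  have h2 := (hX.1 a' b').choose_spec
  have := hX.2 _ _ _ _ dist_nonneg dist_nonneg h1.1 h2.1 t ht
  rw [h1.2.1, h1.2.2, h2.2.1, h2.2.2] at this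
  exact this

lemma G_self (hX : IsBusemannSpace X) (a : X) {t : ℝ} (ht : t ∈ Set.Icc (0 : ℝ) 1) : G hX a a t = a := by
  have := G_dist_left hX a a ht
  rw [dist_self, mul_zero] at this
  exact (dist_eq_zero.1 this).symm

lemma G_mem (hX : IsBusemannSpace X) (a b : X) {t : ℝ} (ht : t ∈ Set.Icc (0 : ℝ) 1) : G hX a b t ∈ seg a b := by
  simp only [seg, Set.mem_ofPred_eq]
  rw [G_dist_left hX a b ht, G_dist_right hX a b ht]; ring

lemma mem_seg_iff (hX : IsBusemannSpace X) (a b z : X) : z ∈ seg a b ↔ ∃ t ∈ Set.Icc (0 : ℝ) 1, z = G hX a b t := by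
  constructor
  · intro hz
    obtain ⟨γ, h, h0, h1, h2⟩ := concat_geod hX hz
    have hz' : dist a z + dist z b = dist a b := hz
    have hn1 := dist_nonneg (x := a) (y := z)
    have hn2 := dist_nonneg (x := z) (y := b)
    by_cases hab : dist a b = 0
    · refine ⟨0, by simp, ?_⟩
      rw [G_zero]
      exact (dist_eq_zero.1 (by linarith)).symm
    · have hpos : 0 < dist a b := lt_of_le_of_ne dist_nonneg (Ne.symm hab)
      have ht : dist a z / dist a b ∈ Set.Icc (0 : ℝ) 1 :=
        ⟨by positivity, by rw [div_le_one hpos]; linarith⟩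
      refine ⟨dist a z / dist a b, ht, ?_⟩
      have g := (hX.1 a b).choose_spec
      have := hX.2 _ _ _ _ dist_nonneg dist_nonneg h g.1 _ ht
      rw [h0, h1, g.2.1, g.2.2, dist_self, dist_self, mul_zero, mul_zero, add_zero,
        div_mul_cancel₀ _ hab, h2] at this
      have h3 := dist_le_zero.1 this
      rw [G, div_mul_cancel₀ _ hab]
      exact h3
  · rintro ⟨t, ht, rfl⟩
    exact G_mem hX a b ht

lemma eq_G_of_dist (hX : IsBusemannSpace X) {a b z : X} (h : dist a z = dist a b / 2 ∧ dist z b = dist a b / 2) :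
    z = G hX a b (1 / 2) := by
  have hz : z ∈ seg a b := by
    simp only [seg, Set.mem_ofPred_eq]; linarith [h.1, h.2]
  obtain ⟨t, ht, rfl⟩ := (mem_seg_iff hX a b z).1 hz
  by_cases hab : dist a b = 0
  · have := dist_eq_zero.1 hab
    subst this
    rw [G_self hX a ht, G_self hX a (by norm_num)]
  · have := h.1
    rw [G_dist_left hX a b ht] at this
    have : t = 1 / 2 := by
      field_simp at this ⊢
      linarith
    rw [this]

lemma seg_conv (hX : IsBusemannSpace X) {a b u v : X} (hu : u ∈ seg a b) (hv : v ∈ seg a b) : seg u v ⊆ seg a b := by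
  have key : ∀ s ∈ Set.Icc (0 : ℝ) 1, ∀ t ∈ Set.Icc (0 : ℝ) 1, s ≤ t →
      seg (G hX a b s) (G hX a b t) ⊆ seg a b := by
    intro s hs t ht hst
    have h1 : G hX a b s ∈ seg a (G hX a b t) := by
      simp only [seg, Set.mem_ofPred_eq]
      rw [G_dist_left hX a b hs, G_dist_left hX a b ht, G_dist hX a b hs ht, abs_sub_comm,
        abs_of_nonneg (by linarith)]
      ring
    intro w hw
    exact btw_trans' (G_mem hX a b ht) (btw_trans h1 hw)
  obtain ⟨s, hs, rfl⟩ := (mem_seg_iff hX a b u).1 hu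
  obtain ⟨t, ht, rfl⟩ := (mem_seg_iff hX a b v).1 hv
  rcases le_total s t with h | h
  · exact key s hs t ht h
  · rw [seg_comm]; exact key t ht s hs h

lemma seg_split (hX : IsBusemannSpace X) {a b m p : X} (hm : m ∈ seg a b) (hp : p ∈ seg a b) :
    p ∈ seg a m ∨ p ∈ seg m b := by
  obtain ⟨s, hs, rfl⟩ := (mem_seg_iff hX a b m).1 hm
  obtain ⟨t, ht, rfl⟩ := (mem_seg_iff hX a b p).1 hp
  rcases le_total s t with h | h
  · right
    simp only [seg, Set.mem_ofPred_eq]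
    rw [G_dist hX a b hs ht, G_dist_right hX a b hs, G_dist_right hX a b ht, abs_sub_comm,
        abs_of_nonneg (by linarith)]
    ring
  · left
    simp only [seg, Set.mem_ofPred_eq]
    rw [G_dist hX a b ht hs, G_dist_left hX a b hs, G_dist_left hX a b ht, abs_sub_comm,
        abs_of_nonneg (by linarith)]
    ring

/-- points of a segment with equal distance to the origin coincide -/
lemma seg_inj (hX : IsBusemannSpace X) {a b p q : X} (hp : p ∈ seg a b) (hq : q ∈ seg a b) (h : dist a p = dist a q) :
    p = q := by
  rcases seg_split hX hp hq with h1 | h1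
  · simp only [seg, Set.mem_ofPred_eq] at h1
    exact (dist_le_zero.1 (by linarith)).symm
  · have := btw_left hp h1
    simp only [seg, Set.mem_ofPred_eq] at this
    exact dist_le_zero.1 (by linarith)

lemma ball_conv (hX : IsBusemannSpace X) (p : X) (r : ℝ) : GConvex (Metric.closedBall p r) := by
  intro u hu v hv w hw
  obtain ⟨t, ht, rfl⟩ := (mem_seg_iff hX u v w).1 hw
  rw [Metric.mem_closedBall] at *
  have := G_conv hX u v p p ht
  rw [G_self hX p ht] at this
  nlinarith [ht.1, ht.2]

lemma G_cont (hX : IsBusemannSpace X) : Continuous fun q : (X × X) × I => G hX q.1.1 q.1.2 q.2 := by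
  rw [continuous_iff_continuousAt]
  rintro ⟨⟨a, b⟩, t⟩
  rw [ContinuousAt, tendsto_iff_dist_tendsto_zero]
  have hb : ∀ q : (X × X) × I, dist (G hX q.1.1 q.1.2 q.2) (G hX a b t) ≤
      dist q.1.1 a + dist q.1.2 b + |(q.2 : ℝ) - t| * dist a b := by
    intro q
    have h1 := G_conv hX q.1.1 q.1.2 a b q.2.2
    have h2 := G_dist hX a b q.2.2 t.2
    have h3 := dist_triangle (G hX q.1.1 q.1.2 q.2) (G hX a b q.2) (G hX a b t)
    have := q.2.2.1
    have := q.2.2.2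
    nlinarith [dist_nonneg (x := q.1.1) (y := a), dist_nonneg (x := q.1.2) (y := b)]
  refine squeeze_zero (fun _ => dist_nonneg) hb ?_
  have : Continuous fun q : (X × X) × I =>
      dist q.1.1 a + dist q.1.2 b + |(q.2 : ℝ) - t| * dist a b := by fun_prop
  have h := this.tendsto ((a, b), t)
  simpa using h

lemma seg_preconn (hX : IsBusemannSpace X) (a b : X) : IsPreconnected (seg a b) := by
  have : seg a b = (fun t : I => G hX a b t) '' Set.univ := by
    ext z
    rw [mem_seg_iff hX]
    constructor
    · rintro ⟨t, ht, rfl⟩; exact ⟨⟨t, ht⟩, trivial, rfl⟩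
    · rintro ⟨t, -, rfl⟩; exact ⟨t, t.2, rfl⟩
  rw [this]
  refine isPreconnected_univ.image _ (Continuous.continuousOn ?_)
  exact (G_cont hX).comp (f := fun t : I => ((a, b), t)) (by fun_prop)

/-- Data of a continuous angle function along geodesic segments. -/
structure TH (φ : X ≃ₜ ℂ) (Θ : X → X → X → ℂ) : Prop where
  cont : ContinuousOn (fun q : X × X × X => Θ q.1 q.2.1 q.2.2) {q | q.1 ∉ seg q.2.1 q.2.2}
  exp : ∀ p a b, p ∉ seg a b → Complex.exp (Θ p a b) = (φ b - φ p) / (φ a - φ p)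
  refl : ∀ p a, p ≠ a → Θ p a a = 0

lemma ne_left {p a b : X} (h : p ∉ seg a b) : p ≠ a := fun e => h (e ▸ left_mem a b)
lemma ne_right {p a b : X} (h : p ∉ seg a b) : p ≠ b := fun e => h (e ▸ right_mem a b)

lemma exists_TH (hX : IsBusemannSpace X) (φ : X ≃ₜ ℂ) : ∃ Θ, TH φ Θ := by
  classical
  let D := {q : X × X × X // q.1 ∉ seg q.2.1 q.2.2}
  have hne : ∀ {p q : X}, p ≠ q → φ q - φ p ≠ 0 := fun h e =>
    h (φ.injective (sub_eq_zero.1 e)).symm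
  have hmem : ∀ (d : D) (t : I), d.1.1 ≠ G hX d.1.2.1 d.1.2.2 t := fun d t e =>
    d.2 (e ▸ G_mem hX _ _ t.2)
  let R : I × D → ℂ := fun u =>
    (φ (G hX u.2.1.2.1 u.2.1.2.2 u.1) - φ u.2.1.1) / (φ u.2.1.2.1 - φ u.2.1.1)
  have hR : ∀ u, R u ≠ 0 := fun u => div_ne_zero (hne (hmem u.2 u.1)) (hne (ne_left u.2.2))
  have hRc : Continuous R := by
    have hG : Continuous fun u : I × D => G hX u.2.1.2.1 u.2.1.2.2 u.1 :=
      (G_cont hX).comp (f := fun u : I × D => ((u.2.1.2.1, u.2.1.2.2), u.1))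
        (((continuous_snd.comp (continuous_subtype_val.comp continuous_snd))).prodMk
          continuous_fst)
    have h2 : Continuous fun u : I × D => u.2.1 := continuous_subtype_val.comp continuous_snd
    have h3 : Continuous fun u : I × D => φ u.2.1.1 := φ.continuous.comp (continuous_fst.comp h2)
    have h4 : Continuous fun u : I × D => φ u.2.1.2.1 :=
      φ.continuous.comp (continuous_fst.comp (continuous_snd.comp h2))
    exact Continuous.div ((φ.continuous.comp hG).sub h3) (h4.sub h3) fun u => hne (ne_left u.2.2)
  let H : C(I × D, {z : ℂ // z ≠ 0}) := ⟨fun u => ⟨R u, hR u⟩, by fun_prop⟩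
  have H0 : ∀ d, H (0, d) = (⟨_, (ContinuousMap.const D (0 : ℂ) d).exp_ne_zero⟩ : {z : ℂ // z ≠ 0}) := by
    intro d
    apply Subtype.ext
    change R (0, d) = Complex.exp 0
    simp only [R, Set.Icc.coe_zero, G_zero, Complex.exp_zero]
    exact div_self (hne (ne_left d.2))
  let L := Complex.isCoveringMap_exp.liftHomotopy H (ContinuousMap.const D (0 : ℂ)) H0
  have hL := Complex.isCoveringMap_exp.liftHomotopy_lifts H (ContinuousMap.const D (0 : ℂ)) H0
  have hL0 := Complex.isCoveringMap_exp.liftHomotopy_zero H (ContinuousMap.const D (0 : ℂ)) H0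
  have hLe : ∀ u, Complex.exp (L u) = R u := fun u => congrArg Subtype.val (congrFun hL u)
  refine ⟨fun p a b => if h : p ∉ seg a b then L (1, ⟨(p, a, b), h⟩) else 0, ?_, ?_, ?_⟩
  · rw [continuousOn_iff_continuous_domRestrict]
    have : Continuous fun d : D => L (1, d) := by fun_prop
    refine this.congr fun d => ?_
    simp only [Set.domRestrict_apply]
    rw [dif_pos d.2]
  · intro p a b h
    rw [dif_pos h, hLe]
    simp only [R, Set.Icc.coe_one, G_one]
  · intro p a h
    have h' : p ∉ seg a a := fun e => h (seg_self e)
    rw [dif_pos h']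
    have hc : ∀ t : I, L (t, ⟨(p, a, a), h'⟩) = 0 := by
      have := Complex.isCoveringMap_exp.eq_of_comp_eq
        (g₁ := fun t : I => L (t, ⟨(p, a, a), h'⟩)) (g₂ := fun _ : I => (0 : ℂ))
        (by fun_prop) continuous_const ?_ 0 (hL0 _)
      · exact fun t => congrFun this t
      · funext t
        apply Subtype.ext
        simp only [Function.comp]
        rw [hLe]
        simp only [R, G_self hX a t.2, Complex.exp_zero]
        exact div_self (hne h)
    exact hc 1

lemma const_of_exp {Y : Type*} [TopologicalSpace Y] {S : Set Y} (hS : IsPreconnected S)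
    {f : Y → ℂ} (hf : ContinuousOn f S) {k : ℂ} (he : ∀ y ∈ S, Complex.exp (f y) = k)
    {y y' : Y} (hy : y ∈ S) (hy' : y' ∈ S) : f y = f y' := by
  have := Complex.isCoveringMap_exp.eqOn_of_comp_eqOn hS hf
    (continuousOn_const (c := f y')) (fun z hz => Subtype.ext ?_) hy' rfl
  · exact this hy
  · simp only [Function.comp]
    rw [he z hz, he y' hy']

/-- There is no continuous logarithm of `(z₀ - z)/(e₀ - z)` around `z₀`. -/
lemma no_log {z₀ e₀ : ℂ} (hne : e₀ ≠ z₀) {Z : Set ℂ} (hZ : Z ∈ nhds z₀) {F : ℂ → ℂ}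
    (hF : ContinuousOn F (Z \ {z₀}))
    (he : ∀ z ∈ Z \ {z₀}, Complex.exp (F z) = (z₀ - z) / (e₀ - z)) : False := by
  obtain ⟨ε, hε, hb⟩ := Metric.mem_nhds_iff.1 hZ
  have hn : 0 < ‖e₀ - z₀‖ := norm_pos_iff.2 (sub_ne_zero.2 hne)
  obtain ⟨r, hr0, hr⟩ := exists_between (lt_min hε hn)
  have hr1 : r < ε := lt_of_lt_of_le hr (min_le_left _ _)
  have hr2 : r < ‖e₀ - z₀‖ := lt_of_lt_of_le hr (min_le_right _ _)
  have hrc : (r : ℂ) ≠ 0 := by exact_mod_cast hr0.ne'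
  let u : ℝ → ℂ := fun t => r * Complex.exp (t * Complex.I)
  have hu : ∀ t, ‖u t‖ = r := by
    intro t
    simp [u, Complex.norm_exp_ofReal_mul_I, abs_of_pos hr0]
  have hu0 : ∀ t, u t ≠ 0 := fun t => mul_ne_zero hrc (Complex.exp_ne_zero _)
  have huc : Continuous u := by fun_prop
  have hmem : ∀ t, z₀ + u t ∈ Z \ {z₀} := by
    intro t
    refine ⟨hb ?_, ?_⟩
    · simp [Metric.mem_ball, dist_eq_norm, hu, hr1]
    · simp [hu0 t]
  have hd : e₀ - z₀ ≠ 0 := sub_ne_zero.2 hne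
  have hsl : ∀ t, 1 - u t / (e₀ - z₀) ∈ Complex.slitPlane := by
    intro t
    left
    have h1 : ‖u t / (e₀ - z₀)‖ < 1 := by
      rw [norm_div, hu, div_lt_one hn]; exact hr2
    have h2 := Complex.re_le_norm (u t / (e₀ - z₀))
    simp only [Complex.sub_re, Complex.one_re]
    linarith
  let f : ℝ → ℂ := fun t => F (z₀ + u t) + Complex.log (1 - u t / (e₀ - z₀)) - t * Complex.I
  have hfc : Continuous f := by
    have h1 : Continuous fun t => F (z₀ + u t) :=
      hF.comp_continuous (by fun_prop) hmem
    have h2 : Continuous fun t => Complex.log (1 - u t / (e₀ - z₀)) :=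
      Continuous.clog (by fun_prop) hsl
    exact (h1.add h2).sub (by fun_prop)
  have hfe : ∀ t ∈ (Set.univ : Set ℝ), Complex.exp (f t) = -r / (e₀ - z₀) := by
    intro t _
    have h0 : (1 - u t / (e₀ - z₀)) ≠ 0 := Complex.slitPlane_ne_zero (hsl t)
    have h0' : e₀ - z₀ - u t ≠ 0 := by
      intro h
      apply h0
      field_simp
      simpa using h
    simp only [f]
    rw [Complex.exp_sub, Complex.exp_add, Complex.exp_log h0, he _ (hmem t)]
    have h3 : e₀ - (z₀ + u t) ≠ 0 := by rwa [← sub_sub]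
    have h4 := Complex.exp_ne_zero (t * Complex.I)
    rw [show z₀ - (z₀ + u t) = - u t by ring, show (1 - u t / (e₀ - z₀)) =
      (e₀ - (z₀ + u t)) / (e₀ - z₀) by field_simp; ring]
    rw [div_mul_div_cancel₀ h3]
    simp only [u]
    field_simp
  have := const_of_exp isPreconnected_univ hfc.continuousOn hfe (Set.mem_univ 0)
    (Set.mem_univ (2 * Real.pi))
  have hu2 : u (2 * Real.pi) = u 0 := by
    simp only [u]
    push_cast
    rw [Complex.exp_two_pi_mul_I]
    simp
  simp only [f, hu2] at this
  have h5 : ((2 * Real.pi : ℝ) : ℂ) * Complex.I = 0 := by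
    push_cast at this ⊢
    linear_combination this
  simp [Real.pi_ne_zero] at h5

lemma seg_no_interior (hX : IsBusemannSpace X) (φ : X ≃ₜ ℂ) {a b s : X} {V : Set X}
    (hV : V ∈ nhds s) (h : V ⊆ seg a b) : False := by
  have hV' : φ.symm ⁻¹' V ∈ nhds (φ s) :=
    φ.symm.continuous.continuousAt.preimage_mem_nhds (by simpa using hV)
  obtain ⟨ε, hε, hb⟩ := Metric.mem_nhds_iff.1 hV'
  let u : ℝ → ℂ := fun t => (ε / 2 : ℝ) * Complex.exp (t * Complex.I)
  have huc : Continuous u := by fun_prop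
  have hu : ∀ t, ‖u t‖ = ε / 2 := by
    intro t
    simp only [u, norm_mul, Complex.norm_exp_ofReal_mul_I, Complex.norm_real, mul_one]
    exact abs_of_pos (by linarith)
  have hmem : ∀ t, φ.symm (φ s + u t) ∈ seg a b := by
    intro t
    apply h
    apply hb
    simp only [Metric.mem_ball, dist_eq_norm, add_sub_cancel_left, hu]
    linarith
  have hup : ∀ t : ℝ, u (t + Real.pi) = - u t := by
    intro t
    simp only [u]
    push_cast
    rw [add_mul, Complex.exp_add, Complex.exp_pi_mul_I]
    ring
  let f : ℝ → ℝ := fun t => dist a (φ.symm (φ s + u t))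
  have hfc : Continuous f := by
    have : Continuous fun t => φ.symm (φ s + u t) := φ.symm.continuous.comp (by fun_prop)
    fun_prop
  let g : ℝ → ℝ := fun t => f (t + Real.pi) - f t
  have hgc : Continuous g := by fun_prop
  have hg : g Real.pi = - g 0 := by
    simp only [g, f, hup, zero_add, neg_neg]
    have : u Real.pi = - u 0 := by simpa using hup 0
    rw [this]
    simp
  have h0 : ∃ t, g t = 0 := by
    rcases le_total 0 (g 0) with h0 | h0
    · have := intermediate_value_univ Real.pi 0 hgc
      exact this ⟨by linarith, h0⟩
    · have := intermediate_value_univ 0 Real.pi hgc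
      exact this ⟨h0, by linarith⟩
  obtain ⟨t, ht⟩ := h0
  have h1 := seg_inj hX (hmem (t + Real.pi)) (hmem t) (sub_eq_zero.1 ht)
  have h2 := φ.symm.injective h1
  rw [hup] at h2
  have h3 : u t = 0 := by
    have : u t + u t = 0 := by linear_combination -h2
    simpa using this
  have := hu t
  rw [h3, norm_zero] at this
  linarith

variable {φ : X ≃ₜ ℂ} {Θ : X → X → X → ℂ}

lemma TH.contOn (H : TH φ Θ) {Y : Type*} [TopologicalSpace Y] {S : Set Y} {p a b : Y → X}
    (hp : ContinuousOn p S) (ha : ContinuousOn a S) (hb : ContinuousOn b S)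
    (h : ∀ y ∈ S, p y ∉ seg (a y) (b y)) : ContinuousOn (fun y => Θ (p y) (a y) (b y)) S :=
  H.cont.comp (hp.prodMk (ha.prodMk hb)) h

lemma phi_ne (φ : X ≃ₜ ℂ) {p q : X} (h : p ≠ q) : φ q - φ p ≠ 0 := fun e =>
    h (φ.injective (sub_eq_zero.1 e)).symm

lemma TH.symm (H : TH φ Θ) (hX : IsBusemannSpace X) {p a b : X} (h : p ∉ seg a b) :
    Θ p b a = - Θ p a b := by
  have h1 : ∀ q ∈ seg a b, p ∉ seg a q := fun q hq hp =>
    h (seg_conv hX (left_mem a b) hq hp)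
  have h2 : ∀ q ∈ seg a b, p ∉ seg q a := fun q hq => by rw [seg_comm]; exact h1 q hq
  have := const_of_exp (f := fun q => Θ p a q + Θ p q a) (k := 1) (seg_preconn hX a b)
    ((H.contOn (by fun_prop) (by fun_prop) (by fun_prop) h1).add
      (H.contOn (by fun_prop) (by fun_prop) (by fun_prop) h2)) ?_ (right_mem a b) (left_mem a b)
  · rw [H.refl p a (ne_left h)] at this
    linear_combination this
  · intro q hq
    rw [Complex.exp_add, H.exp _ _ _ (h1 q hq), H.exp _ _ _ (h2 q hq)]
    have e1 := phi_ne φ (ne_left (h1 q hq))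
    have e2 := phi_ne φ (ne_right (h1 q hq))
    field_simp

lemma TH.add (H : TH φ Θ) (hX : IsBusemannSpace X) {p a b m : X} (h : p ∉ seg a b)
    (hm : m ∈ seg a b) : Θ p a b = Θ p a m + Θ p m b := by
  have h1 : ∀ q ∈ seg m b, p ∉ seg a q := fun q hq hp =>
    h (seg_conv hX (left_mem a b) (btw_trans hm hq) hp)
  have h2 : ∀ q ∈ seg m b, p ∉ seg m q := fun q hq hp =>
    h (seg_conv hX hm (btw_trans hm hq) hp)
  have h3 := h1 m (left_mem m b)
  have := const_of_exp (f := fun q => Θ p a m + Θ p m q - Θ p a q) (k := 1) (seg_preconn hX m b)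
    ((continuousOn_const.add
      (H.contOn (by fun_prop) (by fun_prop) (by fun_prop) h2)).sub
      (H.contOn (by fun_prop) (by fun_prop) (by fun_prop) h1)) ?_ (right_mem m b) (left_mem m b)
  · simp only [H.refl p m (ne_right h3)] at this
    linear_combination -this
  · intro q hq
    rw [Complex.exp_sub, Complex.exp_add, H.exp _ _ _ (h1 q hq), H.exp _ _ _ (h2 q hq),
      H.exp _ _ _ h3]
    have e1 := phi_ne φ (ne_left h3)
    have e2 := phi_ne φ (ne_right h3)
    have e3 := phi_ne φ (ne_right (h2 q hq))
    field_simp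

/-- winding number (times `2πi`) of a geodesic triangle -/
def W (Θ : X → X → X → ℂ) (p a b c : X) : ℂ := Θ p a b + Θ p b c + Θ p c a

/-- `p` is off the boundary of the triangle -/
def Off (p a b c : X) : Prop := p ∉ seg a b ∧ p ∉ seg b c ∧ p ∉ seg c a

lemma Off.rot {p a b c : X} (h : Off p a b c) : Off p b c a := ⟨h.2.1, h.2.2, h.1⟩
lemma Off.swap {p a b c : X} (h : Off p a b c) : Off p b a c :=
  ⟨by rw [seg_comm]; exact h.1, by rw [seg_comm]; exact h.2.2, by rw [seg_comm]; exact h.2.1⟩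

lemma W_rot (p a b c : X) : W Θ p b c a = W Θ p a b c := by simp only [W]; ring

lemma TH.W_swap (H : TH φ Θ) (hX : IsBusemannSpace X) {p a b c : X} (h : Off p a b c) :
    W Θ p b a c = - W Θ p a b c := by
  simp only [W]
  rw [H.symm hX h.1, H.symm hX h.2.1, H.symm hX h.2.2]; ring

lemma TH.exp_W (H : TH φ Θ) {p a b c : X} (h : Off p a b c) : Complex.exp (W Θ p a b c) = 1 := by
  simp only [W]
  rw [Complex.exp_add, Complex.exp_add, H.exp _ _ _ h.1, H.exp _ _ _ h.2.1, H.exp _ _ _ h.2.2]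
  have e1 := phi_ne φ (ne_left h.1)
  have e2 := phi_ne φ (ne_left h.2.1)
  have e3 := phi_ne φ (ne_left h.2.2)
  field_simp

lemma isOpen_off (a b c : X) : IsOpen {p | Off p a b c} :=
  (isClosed_seg a b).isOpen_compl.inter
    ((isClosed_seg b c).isOpen_compl.inter (isClosed_seg c a).isOpen_compl)

lemma TH.cont_W (H : TH φ Θ) (a b c : X) :
    ContinuousOn (fun p => W Θ p a b c) {p | Off p a b c} := by
  refine ((H.contOn (by fun_prop) (by fun_prop) (by fun_prop) fun y hy => hy.1).add
    (H.contOn (by fun_prop) (by fun_prop) (by fun_prop) fun y hy => hy.2.1)).add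
    (H.contOn (by fun_prop) (by fun_prop) (by fun_prop) fun y hy => hy.2.2)

/-- `W` is locally constant off the boundary. -/
lemma TH.loc_W (H : TH φ Θ) {p a b c : X} (h : Off p a b c) :
    ∀ᶠ s in nhds p, Off s a b c ∧ W Θ s a b c = W Θ p a b c := by
  have h1 : {p | Off p a b c} ∈ nhds p := (isOpen_off a b c).mem_nhds h
  have h2 := (H.cont_W a b c).continuousAt h1
  have h3 := Metric.tendsto_nhds.1 h2 1 one_pos
  filter_upwards [h1, h3] with s hs hd
  refine ⟨hs, ?_⟩
  have e1 : Complex.exp (W Θ s a b c - W Θ p a b c) = 1 := by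
    rw [Complex.exp_sub, H.exp_W hs, H.exp_W h, div_one]
  obtain ⟨n, hn⟩ := Complex.exp_eq_one_iff.1 e1
  rw [dist_eq_norm, hn] at hd
  have : ‖(n : ℂ) * (2 * Real.pi * Complex.I)‖ = |(n : ℝ)| * (2 * Real.pi) := by
    simp [abs_of_pos Real.pi_pos]
  rw [this] at hd
  have hn0 : n = 0 := by
    by_contra hne
    have h1 : (1 : ℝ) ≤ |(n : ℝ)| := by exact_mod_cast Int.one_le_abs hne
    nlinarith [Real.pi_gt_three]
  rw [hn0] at hn
  simp at hn
  exact sub_eq_zero.1 hn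

/-- cone lemma -/
lemma TH.cone (H : TH φ Θ) (hX : IsBusemannSpace X) {p a b c : X} (h : Off p a b c)
    (hW : W Θ p a b c ≠ 0) : ∃ q ∈ seg b c, p ∈ seg a q := by
  by_contra hcon
  push Not at hcon
  have h1 : ∀ q ∈ seg b c, p ∉ seg b q := fun q hq hp =>
    h.2.1 (seg_conv hX (left_mem b c) hq hp)
  have h2 : ∀ q ∈ seg b c, p ∉ seg q a := fun q hq => by rw [seg_comm]; exact hcon q hq
  have := const_of_exp (f := fun q => W Θ p a b q) (k := 1) (seg_preconn hX b c)
    ((continuousOn_const.add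
      (H.contOn (by fun_prop) (by fun_prop) (by fun_prop) h1)).add
      (H.contOn (by fun_prop) (by fun_prop) (by fun_prop) h2))
    (fun q hq => H.exp_W ⟨h.1, h1 q hq, h2 q hq⟩) (right_mem b c) (left_mem b c)
  apply hW
  rw [this, W, H.refl p b (ne_right h.1), H.symm hX h.1]
  ring

lemma TH.W_conn (H : TH φ Θ) {S : Set X} (hS : IsPreconnected S) {a b c : X}
    (h : ∀ s ∈ S, Off s a b c) {s t : X} (hs : s ∈ S) (ht : t ∈ S) : W Θ s a b c = W Θ t a b c :=
  const_of_exp hS ((H.cont_W a b c).mono h) (fun y hy => H.exp_W (h y hy)) hs ht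

/-- splitting at a point of the side opposite to `x` -/
lemma TH.W_split (H : TH φ Θ) (hX : IsBusemannSpace X) {t x q m q' : X} (hm : m ∈ seg q q')
    (h1 : t ∉ seg x m) (h2 : t ∉ seg q q') :
    W Θ t x q q' = W Θ t x q m + W Θ t x m q' := by
  simp only [W]
  rw [H.add hX h2 hm, H.symm hX h1]; ring

/-- the two parts cannot both wind around `t` -/
lemma TH.not_both (H : TH φ Θ) (hX : IsBusemannSpace X) {t x q m q' : X} (hm : m ∈ seg q q')
    (h1 : t ∉ seg x q) (h2 : t ∉ seg x m) (h3 : t ∉ seg x q') (h4 : t ∉ seg q q')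
    (hf : W Θ t x q m ≠ 0) (hg : W Θ t x m q' ≠ 0) : False := by
  have hqm : seg q m ⊆ seg q q' := seg_conv hX (left_mem _ _) hm
  have hmq : seg m q' ⊆ seg q q' := seg_conv hX hm (right_mem _ _)
  obtain ⟨r, hr, htr⟩ := H.cone hX ⟨h1, fun h => h4 (hqm h), by rw [seg_comm]; exact h2⟩ hf
  have hoff : ∀ k ∈ seg t r, Off k x m q' := by
    intro k hk
    have htk : t ∈ seg x k := btw_left htr hk
    refine ⟨fun hk' => h2 (btw_trans' hk' htk), fun hk' => ?_, fun hk' => ?_⟩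
    · have hm' : m ∈ seg k r := by rw [seg_comm]; exact btw_mid hm hr hk'
      have hkx : k ∈ seg x r := btw_trans htr hk
      exact h2 (btw_trans' (btw_left hkx hm') htk)
    · rw [seg_comm] at hk'
      exact h3 (btw_trans' hk' htk)
  have hgr : W Θ r x m q' ≠ 0 := by
    rw [H.W_conn (seg_preconn hX t r) hoff (right_mem t r) (left_mem t r)]; exact hg
  obtain ⟨r', hr', hrr⟩ := H.cone hX (hoff r (right_mem t r)) hgr
  exact (hoff r (right_mem t r)).1 (btw_left hrr (btw_mid hm hr hr'))

/-- jump lemma -/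
lemma TH.jump (H : TH φ Θ) (hX : IsBusemannSpace X) {m x c e : X} (hm : m ∈ seg c e)
    (h1 : m ∉ seg x c) (h2 : m ∉ seg x e) {U : Set X} (hU : U ∈ nhds m)
    (h : ∀ s ∈ U, s ∉ seg c e → Off s x c e → W Θ s x c e = 0) : False := by
  classical
  have hcm : seg c m ⊆ seg c e := seg_conv hX (left_mem _ _) hm
  have hme : seg m e ⊆ seg c e := seg_conv hX hm (right_mem _ _)
  let V : Set X := interior U ∩ ((seg x c)ᶜ ∩ (seg e x)ᶜ)
  have hVo : IsOpen V := isOpen_interior.inter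
    ((isClosed_seg x c).isOpen_compl.inter (isClosed_seg e x).isOpen_compl)
  have hmV : m ∈ V := ⟨mem_interior_iff_mem_nhds.2 hU, h1, by rw [seg_comm]; exact h2⟩
  let F : X → ℂ := fun s => if s ∈ seg c m then - Θ s m e else Θ s e x + Θ s x c + Θ s c m
  have hF1 : ∀ s ∈ V, s ∉ seg c m → F s = Θ s e x + Θ s x c + Θ s c m :=
    fun s _ hs => if_neg hs
  have hF2 : ∀ s ∈ V, s ∉ seg m e → F s = - Θ s m e := by
    intro s hs hse
    by_cases hsc : s ∈ seg c m
    · exact if_pos hsc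
    · rw [hF1 s hs hsc]
      have hce : s ∉ seg c e := fun h => (seg_split hX hm h).elim hsc hse
      have hw := h s (interior_subset hs.1) hce ⟨hs.2.1, hce, hs.2.2⟩
      rw [W, H.add hX hce hm] at hw
      linear_combination hw
  have hVm : ∀ s ∈ V \ {m}, s ∉ seg c m ∨ s ∉ seg m e := by
    intro s hs
    by_contra hcon
    push Not at hcon
    exact hs.2 (seg_inter hm hcon.1 hcon.2)
  have hFc : ContinuousOn F (V \ {m}) := by
    intro s hs
    apply ContinuousAt.continuousWithinAt
    rcases hVm s hs with hs' | hs'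
    · have hO : V ∩ (seg c m)ᶜ ∈ nhds s :=
        (hVo.inter (isClosed_seg c m).isOpen_compl).mem_nhds ⟨hs.1, hs'⟩
      have hc : ContinuousOn (fun s => Θ s e x + Θ s x c + Θ s c m) (V ∩ (seg c m)ᶜ) :=
        ((H.contOn (by fun_prop) (by fun_prop) (by fun_prop) fun y hy => hy.1.2.2).add
          (H.contOn (by fun_prop) (by fun_prop) (by fun_prop) fun y hy => hy.1.2.1)).add
          (H.contOn (by fun_prop) (by fun_prop) (by fun_prop) fun y hy => hy.2)
      exact (hc.congr fun y hy => hF1 y hy.1 hy.2).continuousAt hO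
    · have hO : V ∩ (seg m e)ᶜ ∈ nhds s :=
        (hVo.inter (isClosed_seg m e).isOpen_compl).mem_nhds ⟨hs.1, hs'⟩
      have hc : ContinuousOn (fun s => - Θ s m e) (V ∩ (seg m e)ᶜ) :=
        (H.contOn (by fun_prop) (by fun_prop) (by fun_prop) fun y hy => hy.2).neg
      exact (hc.congr fun y hy => hF2 y hy.1 hy.2).continuousAt hO
  have hFe : ∀ s ∈ V \ {m}, Complex.exp (F s) = (φ m - φ s) / (φ e - φ s) := by
    intro s hs
    rcases hVm s hs with hs' | hs'
    · rw [hF1 s hs.1 hs', Complex.exp_add, Complex.exp_add, H.exp _ _ _ hs.1.2.2,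
        H.exp _ _ _ hs.1.2.1, H.exp _ _ _ hs']
      have e1 := phi_ne φ (ne_left hs.1.2.2)
      have e2 := phi_ne φ (ne_left hs.1.2.1)
      have e3 := phi_ne φ (ne_left hs')
      field_simp
    · rw [hF2 s hs.1 hs', Complex.exp_neg, H.exp _ _ _ hs', inv_div]
  have hne : e ≠ m := fun he => h2 (he ▸ right_mem x e)
  refine no_log (z₀ := φ m) (e₀ := φ e) (fun h => hne (φ.injective h)) (Z := φ.symm ⁻¹' V)
    (φ.symm.continuous.continuousAt.preimage_mem_nhds (by simpa using hVo.mem_nhds hmV))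
    (F := fun z => F (φ.symm z)) ?_ ?_
  · refine hFc.comp φ.symm.continuous.continuousOn ?_
    intro z hz
    refine ⟨hz.1, fun hzm => hz.2 ?_⟩
    have : φ.symm z = m := hzm
    rw [Set.mem_singleton_iff, ← this, φ.apply_symm_apply]
  · intro z hz
    have := hFe (φ.symm z) ⟨hz.1, fun hzm => hz.2 ?_⟩
    · simpa using this
    · have : φ.symm z = m := hzm
      rw [Set.mem_singleton_iff, ← this, φ.apply_symm_apply]


lemma exists_near (hX : IsBusemannSpace X) {x p : X} (h : p ≠ x) {U : Set X} (hU : U ∈ nhds p) :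
    ∃ p1 ∈ seg x p, p1 ≠ p ∧ p1 ∈ U := by
  obtain ⟨ε, hε, hb⟩ := Metric.mem_nhds_iff.1 hU
  have hD : 0 < dist x p := dist_pos.2 h.symm
  have hm : 0 < min 1 (ε / (2 * dist x p)) := lt_min one_pos (by positivity)
  have hm1 : min 1 (ε / (2 * dist x p)) ≤ 1 := min_le_left _ _
  have ht : 1 - min 1 (ε / (2 * dist x p)) ∈ Set.Icc (0 : ℝ) 1 := ⟨by linarith, by linarith⟩
  have hd := G_dist_right hX x p ht
  refine ⟨_, G_mem hX x p ht, ?_, hb ?_⟩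
  · rw [← dist_pos, hd]
    apply mul_pos _ hD
    linarith
  · rw [Metric.mem_ball, hd]
    have : min 1 (ε / (2 * dist x p)) * dist x p ≤ ε / (2 * dist x p) * dist x p :=
      mul_le_mul_of_nonneg_right (min_le_right _ _) hD.le
    have e : ε / (2 * dist x p) * dist x p = ε / 2 := by field_simp
    rw [sub_sub_cancel]
    linarith

/-- convexity of the set of points behind `p` as seen from `x` -/
lemma TH.shadow (H : TH φ Θ) (hX : IsBusemannSpace X) {p x q q' m : X} (h : p ∈ seg x q)
    (h' : p ∈ seg x q') (hm : m ∈ seg q q') : p ∈ seg x m := by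
  by_contra hc
  have hpx : p ≠ x := fun e => hc (e ▸ left_mem _ _)
  have hpqq : p ∉ seg q q' := by
    intro hp
    rcases seg_split hX hm hp with h1 | h1
    · exact hc (btw_left h' (btw_mid hm h1 (right_mem _ _)))
    · have := btw_mid hm (left_mem _ _) h1
      rw [seg_comm] at this
      exact hc (btw_left h this)
  obtain ⟨p1, hp1, hne, hpm, hpq⟩ := exists_near hX hpx
    (((isClosed_seg x m).isOpen_compl.inter (isClosed_seg q q').isOpen_compl).mem_nhds ⟨hc, hpqq⟩)
  have hpm : p1 ∉ seg x m := hpm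
  have hpq : p1 ∉ seg q q' := hpq
  have h1 : p1 ∉ seg p q := fun e => hne (seg_inter h hp1 e)
  have h2 : p1 ∉ seg q' p := fun e => hne (seg_inter h' hp1 (by rwa [seg_comm]))
  have hoff : Off p1 p q q' := ⟨h1, hpq, h2⟩
  have h0 : W Θ p1 p q q' = 0 := by
    by_contra hW
    rw [← W_rot] at hW
    obtain ⟨r, hr, hpr⟩ := H.cone hX hoff.rot hW
    have hb : p ∈ seg q p1 := by
      rw [seg_comm]; exact btw_mid h hp1 (right_mem _ _)
    have hb2 := btw_mid hpr hb (right_mem _ _)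
    exact h2 (seg_conv hX (right_mem _ _) hr hb2)
  have hxp : seg x p ⊆ seg x q := seg_conv hX (left_mem _ _) h
  refine H.jump hX (m := p1) (x := m) (c := x) (e := q) (hxp hp1)
    (by rwa [seg_comm]) (fun e => hpq (seg_conv hX hm (left_mem _ _) e))
    (U := {s | (Off s p q q' ∧ W Θ s p q q' = W Θ p1 p q q') ∧ s ∈ (seg x m)ᶜ})
    (Filter.inter_mem (H.loc_W hoff) ((isClosed_seg x m).isOpen_compl.mem_nhds hpm)) ?_
  rintro s ⟨⟨hso, hsW⟩, hsm⟩ hsq hs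
  have hsm : s ∉ seg x m := hsm
  rw [h0] at hsW
  have hsxp : s ∉ seg x p := fun e => hsq (hxp e)
  have hsq' : s ∉ seg x q' := by
    intro e
    rcases seg_split hX h' e with e | e
    · exact hsxp e
    · exact hso.2.2 (by rwa [seg_comm])
  have hT : W Θ s x q q' = 0 := by
    rw [← hsW]
    simp only [W]
    rw [H.add hX hsq h, H.add hX (a := q') (b := x) (m := p) (by rwa [seg_comm])
      (by rwa [seg_comm]), H.symm hX hsxp]
    ring
  rw [H.W_split hX hm hsm hso.2.1] at hT
  rw [← W_rot]
  by_contra hf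
  refine H.not_both hX hm hsq hsm hsq' hso.2.1 hf ?_
  intro hg
  rw [hg, add_zero] at hT
  exact hf hT

/-- concrete triangle -/
def T (Θ : X → X → X → ℂ) (a b c : X) : Set X :=
  {p | p ∈ seg a b ∨ p ∈ seg b c ∨ p ∈ seg c a ∨ W Θ p a b c ≠ 0}

lemma off_or {p a b c : X} : Off p a b c ∨ (p ∈ seg a b ∨ p ∈ seg b c ∨ p ∈ seg c a) := by
  unfold Off; tauto

lemma T_rot (a b c : X) : T Θ b c a = T Θ a b c := by
  ext p
  simp only [T, Set.mem_ofPred_eq, W_rot]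
  tauto

lemma TH.T_swap (H : TH φ Θ) (hX : IsBusemannSpace X) (a b c : X) : T Θ b a c = T Θ a b c := by
  ext p
  simp only [T, Set.mem_ofPred_eq]
  rw [seg_comm b a, seg_comm a c, seg_comm c b]
  rcases off_or (p := p) (a := a) (b := b) (c := c) with h | h
  · rw [H.W_swap hX h, neg_ne_zero]; tauto
  · tauto

lemma TH.T_closed (H : TH φ Θ) (a b c : X) : IsClosed (T Θ a b c) := by
  rw [← isOpen_compl_iff, isOpen_iff_mem_nhds]
  intro p hp
  simp only [T, Set.mem_compl_iff, Set.mem_ofPred_eq, not_or, not_not] at hp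
  have hoff : Off p a b c := ⟨hp.1, hp.2.1, hp.2.2.1⟩
  filter_upwards [H.loc_W hoff] with s hs
  simp only [T, Set.mem_compl_iff, Set.mem_ofPred_eq, not_or, not_not]
  exact ⟨hs.1.1, hs.1.2.1, hs.1.2.2, by rw [hs.2]; exact hp.2.2.2⟩

lemma TH.T_cone (H : TH φ Θ) (hX : IsBusemannSpace X) {p a b c : X} (h : p ∈ T Θ a b c) :
    ∃ q ∈ seg b c, p ∈ seg a q := by
  rcases off_or (p := p) (a := a) (b := b) (c := c) with ho | h1 | h1 | h1
  · rcases h with h | h | h | h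
    · exact absurd h ho.1
    · exact absurd h ho.2.1
    · exact absurd h ho.2.2
    · exact H.cone hX ho h
  · exact ⟨b, left_mem _ _, h1⟩
  · exact ⟨p, h1, right_mem _ _⟩
  · exact ⟨c, right_mem _ _, by rwa [seg_comm]⟩

lemma TH.T_inter (H : TH φ Θ) (hX : IsBusemannSpace X) {p x q m q' : X} (hm : m ∈ seg q q')
    (h : p ∈ T Θ x q m) (h' : p ∈ T Θ x m q') : p ∈ seg x m := by
  obtain ⟨r, hr, hpr⟩ := H.T_cone hX h
  obtain ⟨k, hk, hpk⟩ := H.T_cone hX h'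
  exact H.shadow hX hpr hpk (btw_mid hm hr hk)

lemma TH.T_split (H : TH φ Θ) (hX : IsBusemannSpace X) {p x q m q' : X} (hm : m ∈ seg q q')
    (h : p ∈ T Θ x q q') : p ∈ T Θ x q m ∨ p ∈ T Θ x m q' := by
  by_cases h1 : p ∈ seg x m
  · exact Or.inr (Or.inl h1)
  rcases off_or (p := p) (a := x) (b := q) (c := q') with ho | h2 | h2 | h2
  · have hs := H.W_split hX hm h1 ho.2.1
    rcases h with h | h | h | h
    · exact absurd h ho.1
    · exact absurd h ho.2.1
    · exact absurd h ho.2.2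
    · by_cases hf : W Θ p x q m = 0
      · right; right; right; right
        intro hg; apply h; rw [hs, hf, hg, add_zero]
      · left; right; right; right; exact hf
  · left; left; exact h2
  · rcases seg_split hX hm h2 with h3 | h3
    · left; right; left; exact h3
    · right; right; left; exact h3
  · right; right; right; left; exact h2

lemma TH.conv_core (H : TH φ Θ) (hX : IsBusemannSpace X) {x y z c e m : X} (hc : c ∈ seg x y)
    (he : e ∈ seg x z) (hm : m ∈ seg c e) (hT : m ∉ T Θ x y z) : False := by
  simp only [T, Set.mem_ofPred_eq, not_or, not_not] at hT
  have hoff : Off m x y z := ⟨hT.1, hT.2.1, hT.2.2.1⟩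
  obtain ⟨U, hU, hUo, hmU⟩ := _root_.mem_nhds_iff.1 (H.loc_W hoff)
  have hxe : seg x e ⊆ seg x z := seg_conv hX (left_mem _ _) he
  have hxc : seg x c ⊆ seg x y := seg_conv hX (left_mem _ _) hc
  have key : ∀ s ∈ U, s ∉ seg c e → s ∉ seg y e → W Θ s x c e = 0 := by
    intro s hs hce hye
    obtain ⟨hso, hsW⟩ := hU hs
    rw [hT.2.2.2] at hsW
    have hxz : s ∉ seg x z := by rw [seg_comm]; exact hso.2.2
    have hyx : s ∉ seg y x := by rw [seg_comm]; exact hso.1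
    have h1 : W Θ s y x e = 0 := by
      have hs1 := H.W_split hX he hye hxz
      rw [H.W_swap hX hso, hsW, neg_zero] at hs1
      by_contra hf
      refine H.not_both hX he hyx hye hso.2.1 hxz hf ?_
      intro hg
      rw [hg, add_zero] at hs1
      exact hf hs1.symm
    have hoe : Off s y x e := ⟨hyx, fun h => hxz (hxe h), by rwa [seg_comm]⟩
    have h2 : W Θ s e x y = 0 := by
      have := H.W_swap hX hoe
      rw [h1, neg_zero] at this
      rw [← this, ← W_rot]
    have hec : s ∉ seg e c := by rwa [seg_comm]
    have hs2 := H.W_split hX hc hec hso.1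
    rw [h2] at hs2
    have h3 : W Θ s e x c = 0 := by
      by_contra hf
      refine H.not_both hX hc (fun h => hxz (hxe (by rwa [seg_comm]))) hec hoe.2.2 hso.1 hf ?_
      intro hg
      rw [hg, add_zero] at hs2
      exact hf hs2.symm
    rw [W_rot]; exact h3
  refine H.jump hX hm (fun h => hT.1 (hxc h)) (fun h => hT.2.2.1 (by rw [seg_comm]; exact hxe h))
    (hUo.mem_nhds hmU) ?_
  intro s hs hsce hso
  by_contra hW
  refine seg_no_interior hX φ (a := y) (b := e) (s := s) (Filter.inter_mem (H.loc_W hso)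
    (Filter.inter_mem (hUo.mem_nhds hs) ((isClosed_seg c e).isOpen_compl.mem_nhds hsce))) ?_
  rintro t ⟨⟨hto, htW⟩, htU, htc⟩
  by_contra hn
  exact hW (htW ▸ key t htU htc hn)

lemma TH.exits (H : TH φ Θ) (hX : IsBusemannSpace X) {x y z a u : X} (ha : a ∈ T Θ x y z)
    (hu : u ∉ T Θ x y z) : ∃ c ∈ seg a u, c ∈ seg x y ∨ c ∈ seg y z ∨ c ∈ seg z x := by
  by_contra hcon
  push Not at hcon
  have ho : ∀ c ∈ seg a u, Off c x y z := fun c hc => hcon c hc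
  have h1 := H.W_conn (seg_preconn hX a u) ho (left_mem _ _) (right_mem _ _)
  have h2 := ho a (left_mem _ _)
  simp only [T, Set.mem_ofPred_eq, not_or, not_not] at hu ha
  rw [hu.2.2.2] at h1
  rcases ha with h | h | h | h
  · exact h2.1 h
  · exact h2.2.1 h
  · exact h2.2.2 h
  · exact h h1

lemma TH.T_conv (H : TH φ Θ) (hX : IsBusemannSpace X) (x y z : X) : GConvex (T Θ x y z) := by
  intro a ha b hb u hu
  by_contra hn
  obtain ⟨c, hc, hc'⟩ := H.exits hX ha hn
  obtain ⟨e, he, he'⟩ := H.exits hX hb hn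
  have hm : u ∈ seg c e := btw_mid hu hc (by rwa [seg_comm])
  have hm' : u ∈ seg e c := by rwa [seg_comm]
  have r1 : u ∉ T Θ y z x := by rwa [T_rot]
  have r2 : u ∉ T Θ z x y := by rwa [T_rot, T_rot]
  have hxy : u ∉ seg x y := fun h => hn (Or.inl h)
  have hyz : u ∉ seg y z := fun h => hn (Or.inr (Or.inl h))
  have hzx : u ∉ seg z x := fun h => hn (Or.inr (Or.inr (Or.inl h)))
  rcases hc' with h | h | h <;> rcases he' with h' | h' | h'
  · exact hxy (seg_conv hX h h' hm)
  · exact H.conv_core hX h' (by rwa [seg_comm] : c ∈ seg y x) hm' r1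
  · exact H.conv_core hX h (by rwa [seg_comm]) hm hn
  · exact H.conv_core hX h (by rwa [seg_comm]) hm r1
  · exact hyz (seg_conv hX h h' hm)
  · exact H.conv_core hX h' (by rwa [seg_comm]) hm' r2
  · exact H.conv_core hX h' (by rwa [seg_comm]) hm' hn
  · exact H.conv_core hX h (by rwa [seg_comm]) hm r2
  · exact hzx (seg_conv hX h h' hm)

lemma T_left (a b c : X) : a ∈ T Θ a b c := Or.inl (left_mem _ _)
lemma T_mid (a b c : X) : b ∈ T Θ a b c := Or.inl (right_mem _ _)
lemma T_right (a b c : X) : c ∈ T Θ a b c := Or.inr (Or.inl (right_mem _ _))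

lemma TH.T_min (H : TH φ Θ) (hX : IsBusemannSpace X) {a b c : X} {C : Set X} (hC : GConvex C)
    (ha : a ∈ C) (hb : b ∈ C) (hc : c ∈ C) : T Θ a b c ⊆ C := by
  intro p hp
  obtain ⟨q, hq, hpq⟩ := H.T_cone hX hp
  exact hC a ha q (hC b hb c hc hq) hpq

lemma tri_min {a b c : X} {C : Set X} (hC : GConvex C)
    (ha : a ∈ C) (hb : b ∈ C) (hc : c ∈ C) : triangleG a b c ⊆ C := by
  intro p hp
  apply hp C ⟨hC, ?_⟩
  rintro q (rfl | rfl | rfl) <;> assumption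

lemma TH.tri_eq (H : TH φ Θ) (hX : IsBusemannSpace X) (a b c : X) :
    triangleG a b c = T Θ a b c := by
  apply Set.Subset.antisymm
  · exact tri_min (H.T_conv hX a b c) (T_left _ _ _) (T_mid _ _ _) (T_right _ _ _)
  · rintro p hp C ⟨hC, hQ⟩
    exact H.T_min hX hC (hQ (by simp)) (hQ (by simp)) (hQ (by simp)) hp

lemma tri_conv (a b c : X) : GConvex (triangleG a b c) := by
  intro u hu v hv w hw C hC
  exact hC.1 u (hu C hC) v (hv C hC) hw

lemma tri_rot (a b c : X) : triangleG b c a = triangleG a b c := by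
  unfold triangleG; congr 1; ext; simp; tauto

lemma tri_swap (a b c : X) : triangleG b a c = triangleG a b c := by
  unfold triangleG; congr 1; ext; simp; tauto

lemma tri_left (a b c : X) : a ∈ triangleG a b c := fun C hC => hC.2 (by simp)
lemma tri_mid (a b c : X) : b ∈ triangleG a b c := fun C hC => hC.2 (by simp)
lemma tri_right (a b c : X) : c ∈ triangleG a b c := fun C hC => hC.2 (by simp)

lemma TH.tri_inter (H : TH φ Θ) (hX : IsBusemannSpace X) {p x q m q' : X} (hm : m ∈ seg q q')
    (h : p ∈ triangleG x q m) (h' : p ∈ triangleG x m q') : p ∈ seg x m := by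
  rw [H.tri_eq hX] at h h'
  exact H.T_inter hX hm h h'

lemma TH.tri_split (H : TH φ Θ) (hX : IsBusemannSpace X) {p x q m q' : X} (hm : m ∈ seg q q')
    (h : p ∈ triangleG x q q') : p ∈ triangleG x q m ∨ p ∈ triangleG x m q' := by
  rw [H.tri_eq hX] at h ⊢
  rw [H.tri_eq hX]
  exact H.T_split hX hm h

lemma TH.tri_closed (H : TH φ Θ) (hX : IsBusemannSpace X) (a b c : X) :
    IsClosed (triangleG a b c) := by
  rw [H.tri_eq hX]; exact H.T_closed a b c

lemma tri_swap' (a b c : X) : triangleG a c b = triangleG a b c := by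
  rw [tri_swap, tri_rot, tri_rot]

lemma TH.tri_four (H : TH φ Θ) (hX : IsBusemannSpace X) {x y z xs ys zs p : X}
    (hxs : xs ∈ seg y z) (hys : ys ∈ seg z x) (hzs : zs ∈ seg x y) (hp : p ∈ triangleG x y z) :
    p ∈ triangleG x zs ys ∨ p ∈ triangleG y xs zs ∨ p ∈ triangleG z ys xs ∨
      p ∈ triangleG xs ys zs := by
  simp only [H.tri_eq hX] at hp ⊢
  by_cases h1 : p ∈ seg xs ys
  · exact Or.inr (Or.inr (Or.inr (Or.inl h1)))
  by_cases h2 : p ∈ seg ys zs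
  · exact Or.inr (Or.inr (Or.inr (Or.inr (Or.inl h2))))
  by_cases h3 : p ∈ seg zs xs
  · exact Or.inr (Or.inr (Or.inr (Or.inr (Or.inr (Or.inl h3)))))
  rcases off_or (p := p) (a := x) (b := y) (c := z) with ho | h | h | h
  · have hW : W Θ p x y z ≠ 0 := by
      rcases hp with h | h | h | h
      · exact absurd h ho.1
      · exact absurd h ho.2.1
      · exact absurd h ho.2.2
      · exact h
    by_contra hcon
    simp only [T, Set.mem_ofPred_eq, not_or, not_not] at hcon
    obtain ⟨⟨-, -, -, e1⟩, ⟨-, -, -, e2⟩, ⟨-, -, -, e3⟩, ⟨-, -, -, e4⟩⟩ := hcon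
    apply hW
    have a1 := H.add hX ho.1 hzs
    have a2 := H.add hX ho.2.1 hxs
    have a3 := H.add hX ho.2.2 hys
    have s1 := H.symm hX h1
    have s2 := H.symm hX h2
    have s3 := H.symm hX h3
    simp only [W] at *
    linear_combination a1 + a2 + a3 + e1 + e2 + e3 + e4 - s1 - s2 - s3
  · rcases seg_split hX hzs h with h | h
    · left; left; exact h
    · right; left; right; right; left; exact h
  · rcases seg_split hX hxs h with h | h
    · right; left; left; exact h
    · right; right; left; right; right; left; exact h
  · rcases seg_split hX hys h with h | h
    · right; right; left; left; exact h
    · left; right; right; left; exact h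

lemma TH.crossing (H : TH φ Θ) (hX : IsBusemannSpace X) {x y z xs zs a b : X}
    (hxs : xs ∈ seg y z) (hzs : zs ∈ seg x y) (ha : a ∈ triangleG y xs zs)
    (hb : b ∈ triangleG x y z) (hb' : b ∉ triangleG y xs zs) :
    ∃ p ∈ seg a b, p ∈ seg xs zs := by
  have hxsT : xs ∈ triangleG x y z := tri_conv x y z _ (tri_mid _ _ _) _ (tri_right _ _ _) hxs
  have hzsT : zs ∈ triangleG x y z := tri_conv x y z _ (tri_left _ _ _) _ (tri_mid _ _ _) hzs
  have haT : a ∈ triangleG x y z :=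
    tri_min (tri_conv x y z) (tri_mid _ _ _) hxsT hzsT ha
  have cover : ∀ p ∈ triangleG x y z, p ∈ triangleG y xs zs ∨
      p ∈ triangleG xs x zs ∪ triangleG x xs z := by
    intro p hp
    rcases H.tri_split hX hxs hp with h | h
    · rw [← tri_rot, ← tri_rot] at h
      rcases H.tri_split hX hzs h with h | h
      · right; left; exact h
      · left; rwa [tri_rot] at h
    · right; right; exact h
  have hs : seg a b ⊆ triangleG y xs zs ∪ (triangleG xs x zs ∪ triangleG x xs z) :=
    fun p hp => cover p (tri_conv x y z _ haT _ hb hp)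
  obtain ⟨p, hp, hp1, hp2⟩ := isPreconnected_closed_iff.1 (seg_preconn hX a b) _ _
    (H.tri_closed hX _ _ _) ((H.tri_closed hX _ _ _).union (H.tri_closed hX _ _ _)) hs
    ⟨a, left_mem _ _, ha⟩ ⟨b, right_mem _ _, (cover b hb).resolve_left hb'⟩
  refine ⟨p, hp, ?_⟩
  have hp1' : p ∈ triangleG xs zs y := by rwa [← tri_rot] at hp1
  have key : p ∈ triangleG xs x zs → p ∈ seg xs zs := fun h => H.tri_inter hX hzs h hp1'
  rcases hp2 with h | h
  · exact key h
  · have h2 : p ∈ triangleG x y xs :=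
      tri_min (tri_conv x y xs) (tri_mid _ _ _) (tri_right _ _ _)
        (tri_conv x y xs _ (tri_left _ _ _) _ (tri_mid _ _ _) hzs) hp1
    have h3 := H.tri_inter hX hxs h2 h
    apply key
    exact tri_conv _ _ _ _ (tri_mid _ _ _) _ (tri_left _ _ _) h3

/-- the configuration of the theorem -/
structure Cfg (δ : ℝ) (x y z x' y' z' xs ys zs : X) : Prop where
  mx : xs ∈ seg y z
  my : ys ∈ seg z x
  mz : zs ∈ seg x y
  dxy : dist xs y ≤ δ
  dxz : dist xs z ≤ δ
  dyz : dist ys z ≤ δ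
  dyx : dist ys x ≤ δ
  dzx : dist zs x ≤ δ
  dzy : dist zs y ≤ δ
  crit : ∀ p, dist p x ≤ δ → dist p y ≤ δ → dist p z ≤ δ → False
  tx : x' ∈ triangleG x y z
  ty : y' ∈ triangleG x y z
  tz : z' ∈ triangleG x y z
  exy : dist x' y ≤ δ
  exz : dist x' z ≤ δ
  eyz : dist y' z ≤ δ
  eyx : dist y' x ≤ δ
  ezx : dist z' x ≤ δ
  ezy : dist z' y ≤ δ
  hmin : ∀ a ∈ triangleG x y z, ∀ b ∈ triangleG x y z, ∀ c ∈ triangleG x y z,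
    dist a y ≤ δ → dist a z ≤ δ → dist b z ≤ δ → dist b x ≤ δ → dist c x ≤ δ → dist c y ≤ δ →
    dist x' y' + dist y' z' + dist z' x' ≤ dist a b + dist b c + dist c a

variable {δ : ℝ} {x y z x' y' z' xs ys zs : X}

lemma Cfg.rot (h : Cfg δ x y z x' y' z' xs ys zs) : Cfg δ y z x y' z' x' ys zs xs where
  mx := h.my
  my := h.mz
  mz := h.mx
  dxy := h.dyz
  dxz := h.dyx
  dyz := h.dzx
  dyx := h.dzy
  dzx := h.dxy
  dzy := h.dxz
  crit := fun p h1 h2 h3 => h.crit p h3 h1 h2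
  tx := by rw [tri_rot]; exact h.ty
  ty := by rw [tri_rot]; exact h.tz
  tz := by rw [tri_rot]; exact h.tx
  exy := h.eyz
  exz := h.eyx
  eyz := h.ezx
  eyx := h.ezy
  ezx := h.exy
  ezy := h.exz
  hmin := by
    rw [tri_rot]
    intro a ha b hb c hc h1 h2 h3 h4 h5 h6
    linarith [h.hmin c hc a ha b hb h5 h6 h1 h2 h3 h4]

lemma Cfg.swap (h : Cfg δ x y z x' y' z' xs ys zs) : Cfg δ x z y x' z' y' xs zs ys where
  mx := by rw [seg_comm]; exact h.mx
  my := by rw [seg_comm]; exact h.mz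
  mz := by rw [seg_comm]; exact h.my
  dxy := h.dxz
  dxz := h.dxy
  dyz := h.dzy
  dyx := h.dzx
  dzx := h.dyx
  dzy := h.dyz
  crit := fun p h1 h2 h3 => h.crit p h1 h3 h2
  tx := by rw [tri_swap']; exact h.tx
  ty := by rw [tri_swap']; exact h.tz
  tz := by rw [tri_swap']; exact h.ty
  exy := h.exz
  exz := h.exy
  eyz := h.ezy
  eyx := h.ezx
  ezx := h.eyx
  ezy := h.eyz
  hmin := by
    have e : triangleG x z y = triangleG x y z := by rw [tri_swap, tri_rot, tri_rot]
    rw [e]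
    intro a ha b hb c hc h1 h2 h3 h4 h5 h6
    have := h.hmin a ha c hc b hb h2 h1 h6 h5 h4 h3
    linarith [dist_comm a b, dist_comm b c, dist_comm c a, dist_comm x' y', dist_comm y' z',
      dist_comm z' x']

lemma Cfg.core (C : Cfg δ x y z x' y' z' xs ys zs) (H : TH φ Θ) (hX : IsBusemannSpace X)
    (h0 : 0 ≤ δ) (hx : x' ∈ triangleG y xs zs) : x' ∈ seg xs zs := by
  have hball : triangleG y xs zs ⊆ Metric.closedBall y δ :=
    tri_min (ball_conv hX y δ) (by simpa using h0) C.dxy C.dzy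
  have hy' : y' ∉ triangleG y xs zs := fun h => C.crit y' C.eyx (hball h) C.eyz
  obtain ⟨p, hp, hps⟩ := H.crossing hX C.mx C.mz hx C.ty hy'
  have hpT := tri_conv x y z _ C.tx _ C.ty hp
  have hpz : dist p z ≤ δ := ball_conv hX z δ _ C.exz _ C.eyz hp
  have hpy : dist p y ≤ δ := ball_conv hX y δ _ C.dxy _ C.dzy hps
  have hp' : dist x' p + dist p y' = dist x' y' := hp
  by_cases hz : z' ∈ triangleG y xs zs
  · obtain ⟨q, hq, hqs⟩ := H.crossing hX C.mx C.mz hz C.ty hy'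
    have hqT := tri_conv x y z _ C.tz _ C.ty hq
    have hqx : dist q x ≤ δ := ball_conv hX x δ _ C.ezx _ C.eyx hq
    have hqy : dist q y ≤ δ := ball_conv hX y δ _ C.dxy _ C.dzy hqs
    have hq' : dist z' q + dist q y' = dist z' y' := hq
    have := C.hmin p hpT y' C.ty q hqT hpy hpz C.eyz C.eyx hqx hqy
    apply seg_conv hX hps hqs
    simp only [seg, Set.mem_ofPred_eq]
    linarith [dist_comm x' p, dist_comm x' z', dist_comm q y', dist_comm p q, dist_comm y' z',
      dist_triangle x' z' q, dist_triangle p x' q]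
  · obtain ⟨q, hq, hqs⟩ := H.crossing hX C.mx C.mz hx C.tz hz
    have := C.hmin p hpT y' C.ty z' C.tz hpy hpz C.eyz C.eyx C.ezx C.ezy
    apply seg_conv hX hps hqs
    have h1 : x' ∈ seg p z' := by
      simp only [seg, Set.mem_ofPred_eq]
      linarith [dist_comm x' p, dist_comm x' z', dist_comm p z', dist_triangle p x' z']
    exact btw_left h1 hq

lemma Cfg.mem (C : Cfg δ x y z x' y' z' xs ys zs) (H : TH φ Θ) (hX : IsBusemannSpace X)
    (h0 : 0 ≤ δ) : x' ∈ triangleG xs ys zs := by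
  have c1 := tri_left xs ys zs
  have c2 := tri_mid xs ys zs
  have c3 := tri_right xs ys zs
  rcases H.tri_four hX C.mx C.my C.mz C.tx with h | h | h | h
  · exfalso
    have hball : triangleG x zs ys ⊆ Metric.closedBall x δ :=
      tri_min (ball_conv hX x δ) (by simpa using h0) C.dzx C.dyx
    exact C.crit x' (hball h) C.exy C.exz
  · exact tri_conv _ _ _ _ c1 _ c3 (C.core H hX h0 h)
  · refine tri_conv _ _ _ _ c1 _ c2 (C.swap.core H hX h0 ?_)
    rwa [tri_swap']
  · exact h

lemma half_le (hX : IsBusemannSpace X) {a b c u v : X}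
    (hu : dist a u = dist a b / 2 ∧ dist u b = dist a b / 2)
    (hv : dist a v = dist a c / 2 ∧ dist v c = dist a c / 2) : dist u v ≤ dist b c / 2 := by
  rw [eq_G_of_dist hX hu, eq_G_of_dist hX hv]
  have := G_conv hX a b a c (t := 1 / 2) (by norm_num)
  rw [dist_self] at this
  linarith

lemma tri_diam (hX : IsBusemannSpace X) {a b c p q : X} (h0 : 0 ≤ δ) (hab : dist a b ≤ δ)
    (hbc : dist b c ≤ δ) (hca : dist c a ≤ δ) (hp : p ∈ triangleG a b c)
    (hq : q ∈ triangleG a b c) : dist p q ≤ δ := by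
  have hv : ∀ r ∈ triangleG a b c, a ∈ Metric.closedBall r δ ∧ b ∈ Metric.closedBall r δ ∧
      c ∈ Metric.closedBall r δ := by
    intro r hr
    simp only [Metric.mem_closedBall]
    refine ⟨?_, ?_, ?_⟩ <;> rw [dist_comm, ← Metric.mem_closedBall] <;>
      refine tri_min (ball_conv hX _ δ) ?_ ?_ ?_ hr <;> rw [Metric.mem_closedBall] <;>
      first
        | (rw [dist_self]; exact h0)
        | assumption
        | (rw [dist_comm]; assumption)
  obtain ⟨h1, h2, h3⟩ := hv q hq
  exact tri_min (ball_conv hX q δ) h1 h2 h3 hp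

end Crit

/-- the critical triangle is contained in the medial triangle;
in particular its sides have length at most `δ`. -/
theorem critical_triangle_in_medial_triangle {X : Type*} [MetricSpace X]
    (hX : IsBusemannSurface X) (δ : ℝ) (hδ : 0 < δ) (x y z x' y' z' : X)
    (hxy : dist x y ≤ 2 * δ) (hyz : dist y z ≤ 2 * δ) (hzx : dist z x ≤ 2 * δ)
    (hcrit : Metric.closedBall x δ ∩ Metric.closedBall y δ ∩ Metric.closedBall z δ = ∅)
    (hx' : x' ∈ triangleG x y z ∩ Metric.closedBall y δ ∩ Metric.closedBall z δ)
    (hy' : y' ∈ triangleG x y z ∩ Metric.closedBall x δ ∩ Metric.closedBall z δ)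
    (hz' : z' ∈ triangleG x y z ∩ Metric.closedBall x δ ∩ Metric.closedBall y δ)
    (hmin : ∀ a ∈ triangleG x y z ∩ Metric.closedBall y δ ∩ Metric.closedBall z δ,
      ∀ b ∈ triangleG x y z ∩ Metric.closedBall x δ ∩ Metric.closedBall z δ,
      ∀ c ∈ triangleG x y z ∩ Metric.closedBall x δ ∩ Metric.closedBall y δ,
      perim x' y' z' ≤ perim a b c)
    (xs ys zs : X)
    (hxs : dist y xs = dist y z / 2 ∧ dist xs z = dist y z / 2)
    (hys : dist x ys = dist x z / 2 ∧ dist ys z = dist x z / 2)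
    (hzs : dist x zs = dist x y / 2 ∧ dist zs y = dist x y / 2) :
    triangleG x' y' z' ⊆ triangleG xs ys zs ∧
      dist x' y' ≤ δ ∧ dist y' z' ≤ δ ∧ dist z' x' ≤ δ := by
  obtain ⟨hB, ⟨ψ⟩⟩ := hX
  have φ : X ≃ₜ ℂ := ψ.trans Complex.orthonormalBasisOneI.repr.toHomeomorph.symm
  obtain ⟨Θ, H⟩ := Crit.exists_TH hB φ
  have C : Crit.Cfg δ x y z x' y' z' xs ys zs :=
    { mx := by simp only [seg, Set.mem_ofPred_eq]; linarith [hxs.1, hxs.2]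
      my := by
        rw [Crit.seg_comm]
        simp only [seg, Set.mem_ofPred_eq]; linarith [hys.1, hys.2]
      mz := by simp only [seg, Set.mem_ofPred_eq]; linarith [hzs.1, hzs.2]
      dxy := by rw [dist_comm]; linarith [hxs.1]
      dxz := by linarith [hxs.2]
      dyz := by linarith [hys.2, dist_comm x z]
      dyx := by rw [dist_comm]; linarith [hys.1, dist_comm x z]
      dzx := by rw [dist_comm]; linarith [hzs.1]
      dzy := by linarith [hzs.2]
      crit := fun p h1 h2 h3 => by
        have hp : p ∈ Metric.closedBall x δ ∩ Metric.closedBall y δ ∩ Metric.closedBall z δ :=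
          ⟨⟨h1, h2⟩, h3⟩
        rw [hcrit] at hp
        exact hp
      tx := hx'.1.1
      ty := hy'.1.1
      tz := hz'.1.1
      exy := hx'.1.2
      exz := hx'.2
      eyz := hy'.2
      eyx := hy'.1.2
      ezx := hz'.1.2
      ezy := hz'.2
      hmin := fun a ha b hb c hc h1 h2 h3 h4 h5 h6 =>
        hmin a ⟨⟨ha, h1⟩, h2⟩ b ⟨⟨hb, h4⟩, h3⟩ c ⟨⟨hc, h5⟩, h6⟩ }
  have m1 := C.mem H hB hδ.le
  have m2 : y' ∈ triangleG xs ys zs := by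
    have := C.rot.mem H hB hδ.le
    rwa [Crit.tri_rot] at this
  have m3 : z' ∈ triangleG xs ys zs := by
    have := C.rot.rot.mem H hB hδ.le
    rwa [Crit.tri_rot, Crit.tri_rot] at this
  have d1 : dist xs ys ≤ δ := by
    have := Crit.half_le hB (a := z) (b := y) (c := x) (u := xs) (v := ys)
      (by rw [dist_comm z xs, dist_comm xs y, dist_comm z y]; exact hxs.symm)
      (by rw [dist_comm z ys, dist_comm ys x, dist_comm z x]; exact hys.symm)
    linarith [dist_comm x y]
  have d2 : dist ys zs ≤ δ := by
    have := Crit.half_le hB hys hzs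
    linarith [dist_comm y z]
  have d3 : dist zs xs ≤ δ := by
    have := Crit.half_le hB (a := y) (b := x) (c := z) (u := zs) (v := xs)
      (by rw [dist_comm y zs, dist_comm zs x, dist_comm y x]; exact hzs.symm) hxs
    linarith [dist_comm x z]
  exact ⟨Crit.tri_min (Crit.tri_conv _ _ _) m1 m2 m3,
    Crit.tri_diam hB hδ.le d1 d2 d3 m1 m2, Crit.tri_diam hB hδ.le d1 d2 d3 m2 m3,
    Crit.tri_diam hB hδ.le d1 d2 d3 m3 m1⟩
end
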